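/- Comparison principle on ℝ^N × (0,T): suppose f and g are uniformly continuous and bounded with f ≥ g, u is an upper semicontinuous viscosity subsolution of u_t − F(x,∇u,D²u) − h(x,t)·∇u|∇u|^α ≤ g(x,t) in ℝ^N × (0,T), and v is a lower semicontinuous viscosity supersolution of v_t − F(x,∇v,D²v) − h(x,t)·∇v|∇v|^α ≥ f(x,t) in ℝ^N × (0,T), with u(x,0) ≤ v(x,0), where x ↦ u(x,0) and x ↦ v(x,0) are Hölder continuous and bounded. Suppose in addition that there exists a constant c₁ such that u(x,t) ≤ u(y,0) + c₁(|x−y|+1) and v(x,t) ≥ v(y,0) − c₁(|x−y|+1) for all x, y ∈ ℝ^N and t ∈ (0,T). Then u(x,t) ≤ v(x,t) on ℝ^N × (0,T). -/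

import Mathlib

open Set Filter Metric
open scoped RealInnerProductSpace

noncomputable section

/-- Euclidean space `ℝ^N`. -/
abbrev EucSp (N : ℕ) := EuclideanSpace ℝ (Fin N)

/-- `N × N` real matrices. -/
abbrev MatN (N : ℕ) := Matrix (Fin N) (Fin N) ℝ

variable {N : ℕ}

/-- Spatial Hessian matrix of a function `φ : ℝ^N → ℝ`. -/
noncomputable def hessMat (φ : EucSp N → ℝ) (x : EucSp N) : MatN N := fun i j =>
  iteratedFDeriv ℝ 2 φ x ![EuclideanSpace.single i (1 : ℝ), EuclideanSpace.single j (1 : ℝ)]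

/-- Upper semicontinuous envelope `u*`. -/
noncomputable def uscEnv (u : EucSp N → ℝ → ℝ) (x : EucSp N) (t : ℝ) : ℝ :=
  Filter.limsup (fun p : EucSp N × ℝ => u p.1 p.2) (nhds (x, t))

/-- Lower semicontinuous envelope `u_*`. -/
noncomputable def lscEnv (u : EucSp N → ℝ → ℝ) (x : EucSp N) (t : ℝ) : ℝ :=
  Filter.liminf (fun p : EucSp N × ℝ => u p.1 p.2) (nhds (x, t))

/-- The first order term `h(x,t)·p |p|^α`. -/
noncomputable def gradTerm (h : EucSp N → ℝ → EucSp N) (α : ℝ) (x : EucSp N) (t : ℝ)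
    (p : EucSp N) : ℝ :=
  ⟪h x t, p⟫ * ‖p‖ ^ α

/-- Viscosity subsolution of `u_t - F(x,∇u,D²u) - h(x,t)·∇u|∇u|^α ≤ f` in `Ω × (0,T)`,
in the sense of Definition 1 of the paper. -/
def IsSubSol (Ω : Set (EucSp N)) (T : ℝ) (F : EucSp N → EucSp N → MatN N → ℝ)
    (h : EucSp N → ℝ → EucSp N) (α : ℝ) (f : EucSp N → ℝ → ℝ)
    (u : EucSp N → ℝ → ℝ) : Prop :=
  ∀ x₀ ∈ Ω, ∀ t₀ ∈ Set.Ioo (0 : ℝ) T,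
    (∀ φ : EucSp N → ℝ → ℝ,
      ContDiff ℝ 2 (fun p : EucSp N × ℝ => φ p.1 p.2) →
      (∀ᶠ p : EucSp N × ℝ in nhds (x₀, t₀), uscEnv u p.1 p.2 ≤ φ p.1 p.2) →
      uscEnv u x₀ t₀ = φ x₀ t₀ →
      gradient (fun x => φ x t₀) x₀ ≠ 0 →
      deriv (fun s => φ x₀ s) t₀
          - F x₀ (gradient (fun x => φ x t₀) x₀) (hessMat (fun x => φ x t₀) x₀)
          - gradTerm h α x₀ t₀ (gradient (fun x => φ x t₀) x₀)
        ≤ f x₀ t₀) ∧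
    (∀ δ₁ > (0 : ℝ), ∀ φ : ℝ → ℝ, ContDiff ℝ 2 φ → φ t₀ = 0 →
      (∀ t ∈ Set.Ioo (t₀ - δ₁) (t₀ + δ₁), uscEnv u x₀ t - φ t ≤ uscEnv u x₀ t₀) →
      (∀ᶠ x in nhds x₀,
        sSup ((fun t => uscEnv u x t - φ t) '' Set.Ioo (t₀ - δ₁) (t₀ + δ₁)) =
          sSup ((fun t => uscEnv u x₀ t - φ t) '' Set.Ioo (t₀ - δ₁) (t₀ + δ₁))) →
      deriv φ t₀ ≤ f x₀ t₀)

/-- Viscosity supersolution of `u_t - F(x,∇u,D²u) - h(x,t)·∇u|∇u|^α ≥ f` in `Ω × (0,T)`,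
in the sense of Definition 1 of the paper. -/
def IsSuperSol (Ω : Set (EucSp N)) (T : ℝ) (F : EucSp N → EucSp N → MatN N → ℝ)
    (h : EucSp N → ℝ → EucSp N) (α : ℝ) (f : EucSp N → ℝ → ℝ)
    (u : EucSp N → ℝ → ℝ) : Prop :=
  ∀ x₀ ∈ Ω, ∀ t₀ ∈ Set.Ioo (0 : ℝ) T,
    (∀ φ : EucSp N → ℝ → ℝ,
      ContDiff ℝ 2 (fun p : EucSp N × ℝ => φ p.1 p.2) →
      (∀ᶠ p : EucSp N × ℝ in nhds (x₀, t₀), φ p.1 p.2 ≤ lscEnv u p.1 p.2) →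
      lscEnv u x₀ t₀ = φ x₀ t₀ →
      gradient (fun x => φ x t₀) x₀ ≠ 0 →
      f x₀ t₀ ≤
        deriv (fun s => φ x₀ s) t₀
          - F x₀ (gradient (fun x => φ x t₀) x₀) (hessMat (fun x => φ x t₀) x₀)
          - gradTerm h α x₀ t₀ (gradient (fun x => φ x t₀) x₀)) ∧
    (∀ δ₁ > (0 : ℝ), ∀ φ : ℝ → ℝ, ContDiff ℝ 2 φ → φ t₀ = 0 →
      (∀ t ∈ Set.Ioo (t₀ - δ₁) (t₀ + δ₁), lscEnv u x₀ t₀ ≤ lscEnv u x₀ t - φ t) →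
      (∀ᶠ x in nhds x₀,
        sInf ((fun t => lscEnv u x t - φ t) '' Set.Ioo (t₀ - δ₁) (t₀ + δ₁)) =
          sInf ((fun t => lscEnv u x₀ t - φ t) '' Set.Ioo (t₀ - δ₁) (t₀ + δ₁))) →
      f x₀ t₀ ≤ deriv φ t₀)

/-- Continuity of `F` on `Ω × (ℝ^N∖{0}) × S`. -/
def Fcont (Ω : Set (EucSp N)) (F : EucSp N → EucSp N → MatN N → ℝ) : Prop :=
  ContinuousOn (fun z : EucSp N × EucSp N × MatN N => F z.1 z.2.1 z.2.2)
    (Ω ×ˢ ({p : EucSp N | p ≠ 0} ×ˢ (Set.univ : Set (MatN N))))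

/-- Hypothesis (H1): homogeneity. -/
def H1 (Ω : Set (EucSp N)) (F : EucSp N → EucSp N → MatN N → ℝ) (α : ℝ) : Prop :=
  ∀ x ∈ Ω, ∀ p : EucSp N, p ≠ 0 → ∀ X : MatN N, X.IsSymm →
    ∀ t : ℝ, t ≠ 0 → ∀ μ : ℝ, 0 ≤ μ →
      F x (t • p) (μ • X) = |t| ^ α * μ * F x p X

/-- Hypothesis (H2): uniform ellipticity. -/
def H2 (Ω : Set (EucSp N)) (F : EucSp N → EucSp N → MatN N → ℝ) (α a A : ℝ) : Prop :=
  0 < a ∧ a ≤ A ∧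
    ∀ x ∈ Ω, ∀ p : EucSp N, p ≠ 0 → ∀ M P : MatN N, M.IsSymm → P.IsSymm → P.PosSemidef →
      a * ‖p‖ ^ α * P.trace ≤ F x p (M + P) - F x p M ∧
        F x p (M + P) - F x p M ≤ A * ‖p‖ ^ α * P.trace

/-- Hypothesis (H3): continuity estimate for doubled variables. -/
def H3 (Ω : Set (EucSp N)) (F : EucSp N → EucSp N → MatN N → ℝ) : Prop :=
  ∃ ω : ℝ → ℝ, Continuous ω ∧ ω 0 = 0 ∧
    ∀ X Y : MatN N, X.IsSymm → Y.IsSymm → ∀ ζ : ℝ, 0 < ζ →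
      (Matrix.fromBlocks X 0 0 Y +
        ζ • (1 : Matrix (Fin N ⊕ Fin N) (Fin N ⊕ Fin N) ℝ)).PosSemidef →
      ((4 * ζ) • Matrix.fromBlocks (1 : MatN N) (-1) (-1) (1 : MatN N) -
        Matrix.fromBlocks X 0 0 Y).PosSemidef →
      ∀ x ∈ Ω, ∀ y ∈ Ω, x ≠ y →
        F x (ζ • (x - y)) X - F y (ζ • (x - y)) (-Y) ≤ ω (ζ * ‖x - y‖ ^ 2)

/-- Frobenius norm of a matrix. -/
noncomputable def frobNorm (X : MatN N) : ℝ := Real.sqrt (∑ i, ∑ j, (X i j) ^ 2)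

/-- Hypothesis (H4): Hölder-type continuity of `F` in `x`. -/
def H4 (Ω : Set (EucSp N)) (F : EucSp N → EucSp N → MatN N → ℝ) (α : ℝ) : Prop :=
  ∃ ω' : ℝ → ℝ, Continuous ω' ∧ ω' 0 = 0 ∧
    ∀ x ∈ Ω, ∀ y ∈ Ω, ∀ p : EucSp N, p ≠ 0 → ∀ X : MatN N, X.IsSymm →
      |F x p X - F y p X| ≤ ω' ‖x - y‖ * ‖p‖ ^ α * frobNorm X

/-- Hypothesis (H5): regularity of `h`. -/
def H5 (Ω : Set (EucSp N)) (T : ℝ) (h : EucSp N → ℝ → EucSp N) (α : ℝ) : Prop :=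
  ∃ ωh : ℝ, 0 < ωh ∧ ωh ≤ 1 ∧ ∃ ch : ℝ, 0 < ch ∧
    (∀ x ∈ Ω, ∀ t ∈ Set.Ioo (0 : ℝ) T, ∀ s ∈ Set.Ioo (0 : ℝ) T,
      ‖h x t - h x s‖ ≤ ch * |t - s| ^ ωh) ∧
    (α ≤ 0 → ∀ x ∈ Ω, ∀ y ∈ Ω, ∀ t ∈ Set.Ioo (0 : ℝ) T,
      ‖h x t - h y t‖ ≤ ch * ‖x - y‖ ^ (1 + α)) ∧
    (0 < α → ∀ x ∈ Ω, ∀ y ∈ Ω, ∀ t ∈ Set.Ioo (0 : ℝ) T,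
      ⟪h x t - h y t, x - y⟫ ≤ 0)

/-- Hypothesis (H6): uniform Lipschitz-type condition on `F` in the gradient variable. -/
def H6 (F : EucSp N → EucSp N → MatN N → ℝ) (α : ℝ) : Prop :=
  ∃ C : ℝ, 0 < C ∧ ∀ x : EucSp N, ∀ p : EucSp N, p ≠ 0 → ∀ q : EucSp N, ‖q‖ < ‖p‖ / 2 →
    ∀ X : MatN N, X.IsSymm →
      |F x (p + q) X - F x p X| ≤ C * ‖p‖ ^ (α - 1) * ‖q‖ * frobNorm X

/-- `h` is continuous and bounded on `Ω × (0,T)`. -/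
def HContBdd (Ω : Set (EucSp N)) (T : ℝ) (h : EucSp N → ℝ → EucSp N) : Prop :=
  ContinuousOn (fun p : EucSp N × ℝ => h p.1 p.2) (Ω ×ˢ Set.Ioo 0 T) ∧
    ∃ C : ℝ, ∀ x ∈ Ω, ∀ t ∈ Set.Ioo (0 : ℝ) T, ‖h x t‖ ≤ C

/-- Uniform exterior cone condition. -/
def UnifExtCone (Ω : Set (EucSp N)) : Prop :=
  ∃ φ₀ ∈ Set.Ioo (0 : ℝ) Real.pi, ∃ r : ℝ, 0 < r ∧
    ∀ z ∈ frontier Ω, ∃ n : EucSp N, ‖n‖ = 1 ∧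
      {x : EucSp N | ⟪x - z, n⟫ ≤ Real.cos φ₀ * ‖x - z‖} ∩ closure Ω ∩
        Metric.ball z r = {z}

/-- `u = ψ` on the parabolic boundary `(∂Ω × (0,T)) ∪ (Ω × {0})`. -/
def BoundaryEq (Ω : Set (EucSp N)) (T : ℝ) (u ψ : EucSp N → ℝ → ℝ) : Prop :=
  (∀ x ∈ frontier Ω, ∀ t ∈ Set.Ioo (0 : ℝ) T, u x t = ψ x t) ∧
    (∀ x ∈ Ω, u x 0 = ψ x 0)

/-- The global barrier family of Proposition 1 of the paper, with Hölder
exponent `γ` and constants `c₁ ≤ W_z(x)/|x-z|^γ ≤ c₂`. -/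
def IsBarrierFamily (Ω : Set (EucSp N)) (T : ℝ) (F : EucSp N → EucSp N → MatN N → ℝ)
    (h : EucSp N → ℝ → EucSp N) (α γ c₁ c₂ : ℝ) : Prop :=
  γ ∈ Set.Ioo (0 : ℝ) 1 ∧ 0 < c₁ ∧ 0 < c₂ ∧
    ∀ z ∈ frontier Ω, ∃ W : EucSp N → ℝ,
      ContinuousOn W (closure Ω) ∧ W z = 0 ∧
      (∀ x ∈ Ω, x ≠ z → 0 < W x) ∧
      (∀ x ∈ Ω, gradient W x ≠ 0) ∧
      (∀ x ∈ Ω, c₁ * ‖x - z‖ ^ γ ≤ W x ∧ W x ≤ c₂ * ‖x - z‖ ^ γ) ∧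
      (∀ x₀ ∈ Ω, ∀ φ : EucSp N → ℝ, ContDiff ℝ 2 φ →
        (∀ᶠ x in nhds x₀, φ x ≤ W x) → φ x₀ = W x₀ → gradient φ x₀ ≠ 0 →
        ∀ t ∈ Set.Ioo (0 : ℝ) T,
          F x₀ (gradient φ x₀) (hessMat φ x₀) + gradTerm h α x₀ t (gradient φ x₀) ≤ -1)

/-- `ψ` is `γ`-Hölder in `x` (with constant `cψ`) and Lipschitz in `t`
(with constant `Lψ`). -/
def PsiHolderLip (Ω : Set (EucSp N)) (T γ cψ Lψ : ℝ) (ψ : EucSp N → ℝ → ℝ) : Prop :=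
  (∀ x ∈ closure Ω, ∀ y ∈ closure Ω, ∀ t ∈ Set.Icc (0 : ℝ) T,
      |ψ x t - ψ y t| ≤ cψ * ‖x - y‖ ^ γ) ∧
    (∀ x ∈ closure Ω, ∀ t ∈ Set.Icc (0 : ℝ) T, ∀ s ∈ Set.Icc (0 : ℝ) T,
      |ψ x t - ψ x s| ≤ Lψ * |t - s|)

/-- A continuous viscosity solution of the problem `1_{f,ψ}` on a bounded domain. -/
def IsSolution (Ω : Set (EucSp N)) (T : ℝ) (F : EucSp N → EucSp N → MatN N → ℝ)
    (h : EucSp N → ℝ → EucSp N) (α : ℝ) (f : EucSp N → ℝ → ℝ)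
    (ψ : EucSp N → ℝ → ℝ) (u : EucSp N → ℝ → ℝ) : Prop :=
  ContinuousOn (fun p : EucSp N × ℝ => u p.1 p.2) (closure Ω ×ˢ Set.Icc 0 T) ∧
    IsSubSol Ω T F h α f u ∧ IsSuperSol Ω T F h α f u ∧ BoundaryEq Ω T u ψ

section SecondOrder

variable {H : Type*} [NormedAddCommGroup H] [InnerProductSpace ℝ H]

/-- `f` has the second order expansion with gradient `p` and Hessian `X` at `x`. -/
def HasSecondOrder (f : H → ℝ) (x p : H) (X : H →L[ℝ] H) : Prop :=
  ∀ δ > (0 : ℝ), ∀ᶠ z in nhds (0 : H),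
    |f (x + z) - f x - ⟪p, z⟫ - ⟪X z, z⟫ / 2| ≤ δ * ‖z‖ ^ 2

theorem secondOrder_step {f : H → ℝ} {K : Set H} {x₀ : H} {r : H → H} {M : H →L[ℝ] H}
    {Λ ρ : ℝ} (hΛ : 0 ≤ Λ)
    (hub : ∀ x ∈ K, ∀ y ∈ ball x₀ ρ, f y ≤ f x + ⟪r x, y - x⟫)
    (hlb : ∀ x ∈ K, ∀ y ∈ ball x₀ ρ, f x + ⟪r x, y - x⟫ - Λ / 2 * ‖y - x‖ ^ 2 ≤ f y)
    {h s η i : ℝ} {z : H} (hh0 : 0 < h) (hh1 : h ≤ 1)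
    (H1 : ∀ y ∈ closedBall x₀ s, ∃ x ∈ K, ‖x - y‖ ≤ h ^ 2 * s)
    (H2 : ∀ x ∈ K, ‖x - x₀‖ < η → ‖r x - r x₀ - M (x - x₀)‖ ≤ h * ‖x - x₀‖)
    (hs : s = ‖z‖) (hs0 : 0 < s) (hsη : 2 * s < η) (hsρ : s < ρ) (hi0 : 0 ≤ i)
    (hih' : (i + 1) * h ≤ 1) :
    |f (x₀ + ((i + 1) * h) • z) - f (x₀ + (i * h) • z) - h * ⟪r x₀, z⟫
        - i * h ^ 2 * ⟪M z, z⟫| ≤ h ^ 2 * s ^ 2 * (2 + ‖M‖ + 2 * Λ) := by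
  have hih : i * h ≤ 1 := by nlinarith
  obtain ⟨y, hy⟩ : ∃ y, y = x₀ + (i * h) • z := ⟨_, rfl⟩
  obtain ⟨y', hy'⟩ : ∃ y, y = x₀ + ((i + 1) * h) • z := ⟨_, rfl⟩
  rw [← hy, ← hy']
  have hyx : ‖y - x₀‖ ≤ s := by
    rw [hy, add_sub_cancel_left, norm_smul, Real.norm_of_nonneg (by positivity), ← hs]
    nlinarith
  have hyx' : ‖y' - x₀‖ ≤ s := by
    rw [hy', add_sub_cancel_left, norm_smul, Real.norm_of_nonneg (by positivity), ← hs]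
    nlinarith
  obtain ⟨x, hxK, hxy⟩ := H1 y (by simpa [dist_eq_norm] using hyx)
  have hh2 : h ^ 2 ≤ h := by nlinarith
  have hh2s : h ^ 2 * s ≤ h * s := by nlinarith
  have hhs' : h * s ≤ s := by nlinarith
  have hxx : ‖x - x₀‖ ≤ 2 * s := by
    calc ‖x - x₀‖ = ‖(x - y) + (y - x₀)‖ := by congr 1; abel
      _ ≤ ‖x - y‖ + ‖y - x₀‖ := norm_add_le _ _
      _ ≤ 2 * s := by linarith
  have hyy : y' - y = h • z := by
    rw [hy, hy', add_sub_add_left_eq_sub, ← sub_smul]; congr 1; ring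
  have hr := H2 x hxK (by linarith)
  have hyb : y ∈ ball x₀ ρ := by rw [mem_ball, dist_eq_norm]; linarith
  have hyb' : y' ∈ ball x₀ ρ := by rw [mem_ball, dist_eq_norm]; linarith
  have u1 := hub x hxK y hyb
  have u2 := hub x hxK y' hyb'
  have l1 := hlb x hxK y hyb
  have l2 := hlb x hxK y' hyb'
  have e1 : ⟪r x, y' - x⟫ = ⟪r x, y - x⟫ + h * ⟪r x, z⟫ := by
    have : y' - x = (y - x) + h • z := by rw [← hyy]; abel
    rw [this, inner_add_right, inner_smul_right]
  have e2 : ⟪r x, z⟫ = ⟪r x₀, z⟫ + i * h * ⟪M z, z⟫ + ⟪r x - r x₀ - M (x - x₀), z⟫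
      + ⟪M (x - y), z⟫ := by
    have : r x = r x₀ + ((i : ℝ) * h) • M z + (r x - r x₀ - M (x - x₀)) + M (x - y) := by
      rw [← map_smul, hy]
      simp only [map_sub, map_add]; abel
    conv_lhs => rw [this]
    simp only [inner_add_left, inner_smul_left]
    simp
  have b1 : |⟪r x - r x₀ - M (x - x₀), z⟫| ≤ 2 * h * s ^ 2 := by
    refine (abs_real_inner_le_norm _ _).trans ?_
    rw [← hs]
    calc _ ≤ (h * (2 * s)) * s := by gcongr; exact hr.trans (by gcongr)
      _ = _ := by ring
  have b2 : |⟪M (x - y), z⟫| ≤ ‖M‖ * h * s ^ 2 := by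
    refine (abs_real_inner_le_norm _ _).trans ?_
    rw [← hs]
    calc _ ≤ (‖M‖ * (h ^ 2 * s)) * s := by
          gcongr; exact (M.le_opNorm _).trans (by gcongr)
      _ = (‖M‖ * h * s ^ 2) * h := by ring
      _ ≤ (‖M‖ * h * s ^ 2) * 1 := by gcongr
      _ = _ := by ring
  have q1 : ‖y - x‖ ^ 2 ≤ h ^ 2 * s ^ 2 := by
    rw [norm_sub_rev]
    calc ‖x - y‖ ^ 2 ≤ (h * s) ^ 2 := by
          gcongr; linarith
      _ = _ := by ring
  have q2 : ‖y' - x‖ ^ 2 ≤ 4 * (h ^ 2 * s ^ 2) := by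
    have : ‖y' - x‖ ≤ 2 * (h * s) := by
      have : y' - x = (y - x) + h • z := by rw [← hyy]; abel
      rw [this]
      refine (norm_add_le _ _).trans ?_
      rw [norm_smul, Real.norm_of_nonneg hh0.le, norm_sub_rev]
      nlinarith [mul_pos hh0 hs0]
    calc ‖y' - x‖ ^ 2 ≤ (2 * (h * s)) ^ 2 := by gcongr
      _ = _ := by ring
  have q1' : Λ / 2 * ‖y - x‖ ^ 2 ≤ Λ / 2 * (h ^ 2 * s ^ 2) := by gcongr
  have q2' : Λ / 2 * ‖y' - x‖ ^ 2 ≤ Λ / 2 * (4 * (h ^ 2 * s ^ 2)) := by gcongr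
  have hhs : 0 ≤ Λ * (h ^ 2 * s ^ 2) := by positivity
  have e3 : h * ⟪r x, z⟫ = h * ⟪r x₀, z⟫ + i * h ^ 2 * ⟪M z, z⟫
    + h * ⟪r x - r x₀ - M (x - x₀), z⟫ + h * ⟪M (x - y), z⟫ := by rw [e2]; ring
  rw [abs_le] at b1 b2
  have b1l := mul_le_mul_of_nonneg_left b1.1 hh0.le
  have b1u := mul_le_mul_of_nonneg_left b1.2 hh0.le
  have b2l := mul_le_mul_of_nonneg_left b2.1 hh0.le
  have b2u := mul_le_mul_of_nonneg_left b2.2 hh0.le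
  rw [abs_le]
  constructor <;> linarith

open Topology in
/-- A function squeezed between an affine function and a paraboloid at each point of `K` has a
second order expansion at the points where `K` has full density and the gradient is
differentiable along `K`. -/
theorem hasSecondOrder_of_dense {f : H → ℝ} {K : Set H} {x₀ : H} {r : H → H} {M : H →L[ℝ] H}
    {Λ ρ : ℝ} (hΛ : 0 ≤ Λ) (hρ : 0 < ρ)
    (hub : ∀ x ∈ K, ∀ y ∈ ball x₀ ρ, f y ≤ f x + ⟪r x, y - x⟫)
    (hlb : ∀ x ∈ K, ∀ y ∈ ball x₀ ρ, f x + ⟪r x, y - x⟫ - Λ / 2 * ‖y - x‖ ^ 2 ≤ f y)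
    (hM : HasFDerivWithinAt r M K x₀)
    (hd : ∀ ε > (0 : ℝ), ∀ᶠ s in 𝓝[>] (0 : ℝ), ∀ y ∈ closedBall x₀ s, ∃ x ∈ K, ‖x - y‖ ≤ ε * s) :
    HasSecondOrder f x₀ (r x₀) M := by
  intro δ hδ
  set C : ℝ := 2 + ‖M‖ + 2 * Λ with hC
  have hC0 : 0 < C := by positivity
  obtain ⟨m, hm⟩ := exists_nat_gt ((C + ‖M‖) / δ + 1)
  have hm1 : (1 : ℝ) < m := lt_of_le_of_lt (by have : 0 ≤ (C + ‖M‖) / δ := by positivity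
                                               linarith) hm
  have hm0 : (0 : ℝ) < m := by linarith
  set h : ℝ := 1 / m with hh
  have hh0 : 0 < h := by positivity
  have hh1 : h ≤ 1 := by rw [hh, div_le_one hm0]; exact hm1.le
  have hmh : (m : ℝ) * h = 1 := by rw [hh]; field_simp
  have hhδ : h * (C + ‖M‖) ≤ δ := by
    have : (C + ‖M‖) / δ < m := by linarith
    rw [div_lt_iff₀ hδ] at this
    rw [hh, one_div, inv_mul_le_iff₀ hm0]; linarith
  obtain ⟨η₁, hη₁, H1⟩ : ∃ η > 0, ∀ s, 0 < s → s < η →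
      ∀ y ∈ closedBall x₀ s, ∃ x ∈ K, ‖x - y‖ ≤ h ^ 2 * s := by
    have := hd (h ^ 2) (by positivity)
    rw [eventually_nhdsWithin_iff, Metric.eventually_nhds_iff] at this
    obtain ⟨η, hη, H⟩ := this
    exact ⟨η, hη, fun s hs hsη => H (by simpa [abs_of_pos hs] using hsη) hs⟩
  obtain ⟨η₂, hη₂, H2⟩ : ∃ η > 0, ∀ x ∈ K, ‖x - x₀‖ < η →
      ‖r x - r x₀ - M (x - x₀)‖ ≤ h * ‖x - x₀‖ := by
    have := hM.isLittleO.def hh0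
    rw [eventually_nhdsWithin_iff, Metric.eventually_nhds_iff] at this
    obtain ⟨η, hη, H⟩ := this
    exact ⟨η, hη, fun x hx hxη => H (by simpa [dist_eq_norm] using hxη) hx⟩
  rw [Metric.eventually_nhds_iff]
  refine ⟨min η₁ (min (η₂ / 3) (ρ / 3)), by positivity, fun z hz => ?_⟩
  rw [dist_zero_right, lt_min_iff, lt_min_iff] at hz
  obtain ⟨hz1, hz2, hz3⟩ := hz
  rcases eq_or_ne z 0 with rfl | hz0
  · simp
  set s := ‖z‖ with hs
  have hs0 : 0 < s := norm_pos_iff.2 hz0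
  have step : ∀ i : ℕ, i < m →
      |f (x₀ + ((i + 1 : ℝ) * h) • z) - f (x₀ + ((i : ℝ) * h) • z) - h * ⟪r x₀, z⟫
        - i * h ^ 2 * ⟪M z, z⟫| ≤ h ^ 2 * s ^ 2 * C := by
    intro i hi
    have hi1 : (i : ℝ) + 1 ≤ m := by exact_mod_cast hi
    have hi0 : (0 : ℝ) ≤ i := by positivity
    have hih' : ((i : ℝ) + 1) * h ≤ 1 := by
      have := mul_le_mul_of_nonneg_right hi1 hh0.le
      rwa [hmh] at this
    exact secondOrder_step hΛ hub hlb hh0 hh1 (H1 s hs0 hz1) (fun x hx hx' => H2 x hx hx') hs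
      hs0 (by linarith) (by linarith) hi0 hih'
  have ind : ∀ i : ℕ, i ≤ m →
      |f (x₀ + ((i : ℝ) * h) • z) - f x₀ - i * h * ⟪r x₀, z⟫
        - (i * (i - 1) / 2) * h ^ 2 * ⟪M z, z⟫| ≤ i * (h ^ 2 * s ^ 2 * C) := by
    intro i
    induction i with
    | zero => intro _; simp
    | succ i ih =>
      intro hi
      have h1 := ih (by omega)
      have h2 := step i (by omega)
      push_cast
      rw [abs_le] at h1 h2 ⊢
      constructor <;> nlinarith
  have fin := ind m le_rfl
  rw [hmh, one_smul, one_mul] at fin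
  have hb : |⟪M z, z⟫| ≤ ‖M‖ * s ^ 2 := by
    refine (abs_real_inner_le_norm _ _).trans ?_
    calc _ ≤ (‖M‖ * s) * s := by gcongr; exact M.le_opNorm _
      _ = _ := by ring
  have e1 : ((m : ℝ) * (m - 1) / 2) * h ^ 2 = 1 / 2 - h / 2 := by
    calc ((m : ℝ) * (m - 1) / 2) * h ^ 2 = ((m * h) ^ 2 - (m * h) * h) / 2 := by ring
      _ = _ := by rw [hmh]; ring
  have e2 : (m : ℝ) * (h ^ 2 * s ^ 2 * C) = h * s ^ 2 * C := by
    calc (m : ℝ) * (h ^ 2 * s ^ 2 * C) = (m * h) * (h * s ^ 2 * C) := by ring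
      _ = _ := by rw [hmh]; ring
  rw [e1, e2] at fin
  have h3 : h * (C + ‖M‖) * s ^ 2 ≤ δ * s ^ 2 := by gcongr
  rw [abs_le] at fin hb ⊢
  have hbl := mul_le_mul_of_nonneg_left hb.1 hh0.le
  have hbu := mul_le_mul_of_nonneg_left hb.2 hh0.le
  have hMs : 0 ≤ h * (‖M‖ * s ^ 2) := by positivity
  constructor <;> nlinarith

end SecondOrder

section Jensen

variable {H : Type*} [NormedAddCommGroup H] [InnerProductSpace ℝ H]

open Topology MeasureTheory Pointwise in
theorem eventually_net_of_density [FiniteDimensional ℝ H] [MeasurableSpace H] [BorelSpace H]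
    (μ : Measure H) [μ.IsAddHaarMeasure] {K : Set H} {x₀ : H}
    (hK : Tendsto (fun r => μ (K ∩ closedBall x₀ r) / μ (closedBall x₀ r)) (𝓝[>] 0) (𝓝 1)) :
    ∀ ε > (0 : ℝ), ∀ᶠ s in 𝓝[>] (0 : ℝ), ∀ y ∈ closedBall x₀ s, ∃ x ∈ K, ‖x - y‖ ≤ ε * s := by
  intro ε hε
  obtain ⟨t, -, ht, htc⟩ := (isCompact_closedBall (0 : H) 1).finite_cover_balls
    (half_pos hε)
  have : ∀ᶠ s in 𝓝[>] (0 : ℝ), ∀ i ∈ t, (K ∩ ({x₀} + s • closedBall i (ε / 2))).Nonempty := by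
    rw [Filter.eventually_all_finite ht]
    intro i _
    exact MeasureTheory.Measure.eventually_nonempty_inter_smul_of_density_one μ K x₀ hK _
      measurableSet_closedBall (measure_closedBall_pos μ _ (half_pos hε)).ne'
  filter_upwards [this, self_mem_nhdsWithin] with s hs hs0 y hy
  have hs0 : 0 < s := hs0
  have hwb : s⁻¹ • (y - x₀) ∈ closedBall (0 : H) 1 := by
    rw [mem_closedBall_zero_iff, norm_smul, norm_inv, Real.norm_of_nonneg hs0.le,
      inv_mul_le_iff₀ hs0, mul_one]
    simpa [dist_eq_norm] using hy
  obtain ⟨i, hi, hwi⟩ := mem_iUnion₂.1 (htc hwb)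
  obtain ⟨x, hxK, hx⟩ := hs i hi
  refine ⟨x, hxK, ?_⟩
  rw [singleton_add, mem_image] at hx
  obtain ⟨w, hw, rfl⟩ := hx
  obtain ⟨w', hw', rfl⟩ := mem_smul_set.1 hw
  have e : x₀ + s • w' - y = s • (w' - s⁻¹ • (y - x₀)) := by
    rw [smul_sub, smul_smul, mul_inv_cancel₀ hs0.ne', one_smul]; abel
  rw [e, norm_smul, Real.norm_of_nonneg hs0.le, mul_comm]
  gcongr
  rw [mem_ball, dist_eq_norm] at hwi
  rw [mem_closedBall, dist_eq_norm] at hw'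
  calc ‖w' - s⁻¹ • (y - x₀)‖ = ‖(w' - i) - (s⁻¹ • (y - x₀) - i)‖ := by congr 1; abel
    _ ≤ ‖w' - i‖ + ‖s⁻¹ • (y - x₀) - i‖ := norm_sub_le _ _
    _ ≤ ε := by linarith

/-- Below a touching affine function the slopes of touching paraboloids agree. -/
theorem slope_eq_of_touch {f : H → ℝ} {x q r : H} {Λ : ℝ}
    (h : ∀ᶠ y in nhds x, f x + ⟪q, y - x⟫ - Λ / 2 * ‖y - x‖ ^ 2 ≤ f x + ⟪r, y - x⟫) :
    q = r := by
  by_contra hne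
  have hd : 0 < ‖q - r‖ := norm_pos_iff.2 (sub_ne_zero.2 hne)
  have ht : Tendsto (fun t : ℝ => x + t • (q - r)) (nhdsWithin 0 (Ioi 0)) (nhds x) := by
    have : Continuous (fun t : ℝ => x + t • (q - r)) := by fun_prop
    have h2 := (this.tendsto 0).mono_left (nhdsWithin_le_nhds (s := Ioi 0))
    simpa using h2
  have h1 : Tendsto (fun t : ℝ => Λ / 2 * t) (nhdsWithin 0 (Ioi 0)) (nhds 0) := by
    have : Continuous (fun t : ℝ => Λ / 2 * t) := by fun_prop
    have h2 := (this.tendsto 0).mono_left (nhdsWithin_le_nhds (s := Ioi 0))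
    simpa using h2
  obtain ⟨t, h2, h3, h4⟩ := ((ht.eventually h).and ((h1.eventually (gt_mem_nhds one_pos)).and
    self_mem_nhdsWithin)).exists
  have h4 : 0 < t := h4
  rw [add_sub_cancel_left, inner_smul_right, inner_smul_right, norm_smul,
    Real.norm_of_nonneg h4.le] at h2
  have e : ⟪q, q - r⟫ - ⟪r, q - r⟫ = ‖q - r‖ ^ 2 := by
    rw [← inner_sub_left, real_inner_self_eq_norm_sq]
  have : t * ‖q - r‖ ^ 2 ≤ Λ / 2 * t * (t * ‖q - r‖ ^ 2) := by 
    have e2 : t * ‖q - r‖ ^ 2 = t * (⟪q, q - r⟫ - ⟪r, q - r⟫) := by rw [e]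
    linarith
  have h5 : 0 < t * ‖q - r‖ ^ 2 := by positivity
  nlinarith

/-- A semiconvex function with a strict maximum at the origin has, arbitrarily near the origin,
points with a second order expansion which are maxima up to a small linear perturbation. -/
theorem exists_secondOrder_of_strictMax [FiniteDimensional ℝ H] {f : H → ℝ} {Λ C ρ ν : ℝ}
    (hρ : 0 < ρ) (hν : 0 < ν) (hΛ : 0 ≤ Λ)
    (hL : ∀ x ∈ closedBall (0 : H) ρ, ∃ q : H, ‖q‖ ≤ C ∧ ∀ y ∈ closedBall (0 : H) ρ,
      f x + ⟪q, y - x⟫ - Λ / 2 * ‖y - x‖ ^ 2 ≤ f y)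
    (hmax : ∀ x ∈ closedBall (0 : H) ρ, f x ≤ f 0 - ν * ‖x‖ ^ 2) {ε : ℝ} (hε : 0 < ε) :
    ∃ (x r : H) (M : H →L[ℝ] H), ‖x‖ < ε ∧ ‖x‖ < ρ ∧ ‖r‖ < ε ∧ HasSecondOrder f x r M ∧
      ∀ y ∈ closedBall (0 : H) ρ, f y ≤ f x + ⟪r, y - x⟫ := by
  classical
  obtain ⟨s, hs0, hsε, hsν, hsρ⟩ : ∃ s > 0, s < ε ∧ s / ν < ε ∧ s / ν < ρ / 3 := by
    have h1 : 0 < min ε (ν * min ε (ρ / 3)) := by positivity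
    obtain ⟨s, hs0, hs⟩ := exists_between h1
    rw [lt_min_iff] at hs
    have h2 : s / ν < min ε (ρ / 3) := by rw [div_lt_iff₀ hν]; linarith
    rw [lt_min_iff] at h2
    exact ⟨s, hs0, hs.1, h2.1, h2.2⟩
  let K : Set H := {x | ‖x‖ ≤ s / ν ∧ ∃ r, ‖r‖ ≤ s ∧ ∀ y ∈ closedBall (0 : H) ρ,
    f y ≤ f x + ⟪r, y - x⟫}
  let R : H → H := fun x => if hx : x ∈ K then hx.2.choose else 0
  have hR : ∀ x ∈ K, ‖R x‖ ≤ s ∧ ∀ y ∈ closedBall (0 : H) ρ, f y ≤ f x + ⟪R x, y - x⟫ := by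
    intro x hx
    simp only [R, dif_pos hx]
    exact hx.2.choose_spec
  have hC0 : 0 ≤ C := by
    obtain ⟨q, hq, -⟩ := hL 0 (by simp [hρ.le])
    exact (norm_nonneg _).trans hq
  have uniq : ∀ x ∈ K, ∀ r : H, (∀ y ∈ closedBall (0 : H) ρ, f y ≤ f x + ⟪r, y - x⟫) →
      ∀ y ∈ closedBall (0 : H) ρ, f x + ⟪r, y - x⟫ - Λ / 2 * ‖y - x‖ ^ 2 ≤ f y := by
    intro x hx r hr y hy
    have hxρ : ‖x‖ < ρ := by linarith [hx.1]
    obtain ⟨q, hq, hqy⟩ := hL x (by simpa using hxρ.le)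
    have : q = r := by
      refine slope_eq_of_touch (f := f) (x := x) (Λ := Λ) ?_
      filter_upwards [isOpen_ball.mem_nhds (show x ∈ ball (0 : H) ρ by simpa using hxρ)] with z hz
      exact (hqy z (ball_subset_closedBall hz)).trans (hr z (ball_subset_closedBall hz))
    rw [← this]; exact hqy y hy
  have hlb : ∀ x ∈ K, ∀ y ∈ closedBall (0 : H) ρ,
      f x + ⟪R x, y - x⟫ - Λ / 2 * ‖y - x‖ ^ 2 ≤ f y :=
    fun x hx => uniq x hx (R x) (hR x hx).2
  have hlip : ∀ x ∈ K, ∀ y ∈ K, ∀ r₁ r₂ : H,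
      (∀ y ∈ closedBall (0 : H) ρ, f y ≤ f x + ⟪r₁, y - x⟫) →
      (∀ z ∈ closedBall (0 : H) ρ, f z ≤ f y + ⟪r₂, z - y⟫) →
      ‖r₁ - r₂‖ ≤ 2 * Λ * ‖x - y‖ := by
    intro x hx y hy r₁ r₂ h1 h2
    rcases eq_or_ne r₁ r₂ with h | h
    · rw [h, sub_self, norm_zero]; positivity
    have hd : 0 < ‖r₁ - r₂‖ := norm_pos_iff.2 (sub_ne_zero.2 h)
    have key : ∀ e : H, y + e ∈ closedBall (0 : H) ρ →
        ⟪r₁ - r₂, e⟫ ≤ Λ / 2 * ‖y - x + e‖ ^ 2 := by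
      intro e he
      have a1 := uniq x hx r₁ h1 _ he
      have a2 := h2 _ he
      have a3 := h1 y (by have := hy.1; simp; linarith)
      rw [add_sub_cancel_left] at a2
      rw [show y + e - x = y - x + e by abel, inner_add_right] at a1
      rw [inner_sub_left]; linarith
    rcases eq_or_ne x y with hxy | hxy
    · exfalso
      subst hxy
      refine h (slope_eq_of_touch (f := fun _ => 0) (x := x) (Λ := Λ) ?_)
      have hxρ : ‖x‖ < ρ := by linarith [hx.1]
      filter_upwards [isOpen_ball.mem_nhds (show x ∈ ball (0 : H) ρ by simpa using hxρ)] with z hz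
      have := key (z - x) (by simpa using (ball_subset_closedBall hz))
      rw [inner_sub_left, sub_self, zero_add] at this
      linarith
    have hn : 0 < ‖x - y‖ := norm_pos_iff.2 (sub_ne_zero.2 hxy)
    have hxyn : ‖x - y‖ ≤ 2 * (s / ν) := by
      refine (norm_sub_le _ _).trans ?_; linarith [hx.1, hy.1]
    have hen : ‖(‖x - y‖ / ‖r₁ - r₂‖) • (r₁ - r₂)‖ = ‖x - y‖ := by
      rw [norm_smul, Real.norm_of_nonneg (by positivity)]; field_simp
    have := key ((‖x - y‖ / ‖r₁ - r₂‖) • (r₁ - r₂)) (by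
      rw [mem_closedBall_zero_iff]
      refine (norm_add_le _ _).trans ?_
      rw [hen]; linarith [hy.1])
    rw [inner_smul_right, real_inner_self_eq_norm_sq] at this
    have h3 : ‖y - x + (‖x - y‖ / ‖r₁ - r₂‖) • (r₁ - r₂)‖ ≤ 2 * ‖x - y‖ := by
      refine (norm_add_le _ _).trans ?_
      rw [hen, norm_sub_rev y x]; linarith
    have h4 : ‖x - y‖ / ‖r₁ - r₂‖ * ‖r₁ - r₂‖ ^ 2 = ‖x - y‖ * ‖r₁ - r₂‖ := by field_simp
    rw [h4] at this
    have h5 : Λ / 2 * ‖y - x + (‖x - y‖ / ‖r₁ - r₂‖) • (r₁ - r₂)‖ ^ 2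
        ≤ Λ / 2 * (2 * ‖x - y‖) ^ 2 := by gcongr
    have h6 : ‖x - y‖ * ‖r₁ - r₂‖ ≤ ‖x - y‖ * (2 * Λ * ‖x - y‖) := by linarith
    exact le_of_mul_le_mul_left h6 hn
  have hLip : LipschitzOnWith (2 * Λ).toNNReal R K := by
    refine LipschitzOnWith.of_dist_le_mul fun x hx y hy => ?_
    rw [dist_eq_norm, dist_eq_norm, Real.coe_toNNReal _ (by positivity)]
    exact hlip x hx y hy _ _ (hR x hx).2 (hR y hy).2
  have hfcont : ContinuousOn f (closedBall (0 : H) ρ) := by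
    have h1 : ∀ x ∈ closedBall (0 : H) ρ, ∀ y ∈ closedBall (0 : H) ρ,
        f x - f y ≤ (C + Λ * ρ) * ‖x - y‖ := by
      intro x hx y hy
      obtain ⟨q, hq, hqy⟩ := hL x hx
      have h2 := hqy y hy
      have h3 : |⟪q, y - x⟫| ≤ C * ‖x - y‖ := by
        refine (abs_real_inner_le_norm _ _).trans ?_
        rw [norm_sub_rev]; gcongr
      have h4 : ‖x - y‖ ≤ 2 * ρ := by
        rw [mem_closedBall_zero_iff] at hx hy
        refine (norm_sub_le _ _).trans ?_; linarith
      rw [norm_sub_rev y x] at h2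
      have h5 : Λ / 2 * ‖x - y‖ ^ 2 ≤ Λ / 2 * (2 * ρ * ‖x - y‖) := by
        gcongr; nlinarith [norm_nonneg (x - y)]
      rw [abs_le] at h3
      linarith [h3.1]
    have : LipschitzOnWith (C + Λ * ρ).toNNReal f (closedBall (0 : H) ρ) := by
      refine LipschitzOnWith.of_dist_le_mul fun x hx y hy => ?_
      rw [Real.dist_eq, dist_eq_norm, Real.coe_toNNReal _ (by positivity), abs_sub_le_iff]
      refine ⟨h1 x hx y hy, ?_⟩
      rw [norm_sub_rev]; exact h1 y hy x hx
    exact this.continuousOn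
  have hsub : closedBall (0 : H) s ⊆ R '' K := by
    intro r hr
    rw [mem_closedBall_zero_iff] at hr
    obtain ⟨x, hx, hxm⟩ := (isCompact_closedBall (0 : H) ρ).exists_isMaxOn
      ⟨0, by simp [hρ.le]⟩ (f := fun x => f x - ⟪r, x⟫) (by fun_prop)
    have hxm' : ∀ y ∈ closedBall (0 : H) ρ, f y ≤ f x + ⟪r, y - x⟫ := by
      intro y hy
      have := isMaxOn_iff.1 hxm y hy
      rw [inner_sub_right]; linarith
    have hxs : ‖x‖ ≤ s / ν := by
      have h1 := hxm' 0 (by simp [hρ.le])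
      have h2 := hmax x hx
      rw [zero_sub, inner_neg_right] at h1
      have h3 : |⟪r, x⟫| ≤ s * ‖x‖ := (abs_real_inner_le_norm _ _).trans (by gcongr)
      rw [abs_le] at h3
      rw [le_div_iff₀ hν]
      by_contra hcon
      push Not at hcon
      have hx0 : 0 < ‖x‖ := by
        rcases (norm_nonneg x).eq_or_lt with h | h
        · rw [← h] at hcon; linarith
        · exact h
      nlinarith
    have hxK : x ∈ K := ⟨hxs, r, hr, hxm'⟩
    refine ⟨x, hxK, ?_⟩
    have := hlip x hxK x hxK _ _ (hR x hxK).2 hxm'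
    rw [sub_self, norm_zero, mul_zero] at this
    exact sub_eq_zero.1 (norm_le_zero_iff.1 this)
  let _ : MeasurableSpace H := borel H
  have : BorelSpace H := ⟨rfl⟩
  obtain ⟨μ, hμ⟩ : ∃ μ : MeasureTheory.Measure H,
      μ = MeasureTheory.Measure.hausdorffMeasure (Module.finrank ℝ H : ℝ) := ⟨_, rfl⟩
  have : μ.IsAddHaarMeasure := by rw [hμ]; infer_instance
  have hμK : μ K ≠ 0 := by
    intro h0
    have h1 := hLip.hausdorffMeasure_image_le (d := Module.finrank ℝ H) (by positivity)
    rw [← hμ, h0, mul_zero] at h1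
    have h2 := MeasureTheory.measure_mono (μ := μ) hsub
    have h3 := measure_closedBall_pos μ (0 : H) hs0
    exact absurd (h3.trans_le (h2.trans h1)) (lt_irrefl _)
  have hae := (MeasureTheory.ae_restrict_of_ae (s := K)
    (hLip.ae_differentiableWithinAt_of_mem (μ := μ))).and
    (Besicovitch.ae_tendsto_measure_inter_div μ K)
  obtain ⟨x, hxK, hx⟩ : ∃ x ∈ K, (x ∈ K → DifferentiableWithinAt ℝ R K x) ∧
      Tendsto (fun r => μ (K ∩ closedBall x r) / μ (closedBall x r))
        (nhdsWithin 0 (Ioi 0)) (nhds 1) := by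
    by_contra hcon
    push Not at hcon
    apply hμK
    refine le_antisymm ?_ bot_le
    have h1 : K ⊆ {x | ¬ ((x ∈ K → DifferentiableWithinAt ℝ R K x) ∧
      Tendsto (fun r => μ (K ∩ closedBall x r) / μ (closedBall x r))
        (nhdsWithin 0 (Ioi 0)) (nhds 1))} := by
      intro x hx h2
      exact hcon x hx h2.1 h2.2
    calc μ K ≤ μ.restrict K _ := by
          refine le_trans ?_ (MeasureTheory.Measure.le_restrict_apply K _)
          exact MeasureTheory.measure_mono (subset_inter h1 subset_rfl)
      _ = 0 := hae
  have hxρ : ‖x‖ < ρ / 3 := by linarith [hxK.1]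
  have hball : ball x (ρ / 3) ⊆ closedBall (0 : H) ρ := by
    intro y hy
    rw [mem_ball, dist_eq_norm] at hy
    rw [mem_closedBall_zero_iff]
    calc ‖y‖ = ‖(y - x) + x‖ := by simp
      _ ≤ ‖y - x‖ + ‖x‖ := norm_add_le _ _
      _ ≤ ρ := by linarith
  refine ⟨x, R x, fderivWithin ℝ R K x, by linarith [hxK.1], by linarith, ?_, ?_, (hR x hxK).2⟩
  · linarith [(hR x hxK).1]
  · exact hasSecondOrder_of_dense hΛ (by positivity : 0 < ρ / 3)
      (fun x hx y hy => (hR x hx).2 y (hball hy)) (fun x hx y hy => hlb x hx y (hball hy))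
      (hx.1 hxK).hasFDerivWithinAt (eventually_net_of_density μ hx.2)

end Jensen

section Sums

variable {E : Type*} [NormedAddCommGroup E] [InnerProductSpace ℝ E]

/-- `W` is the sup-convolution of `w` over the closed ball of radius `ρ`, attained at `Z`. -/
structure IsSupConv (w : E → ℝ) (ρ Λ : ℝ) (W : E → ℝ) (Z : E → E) : Prop where
  mem : ∀ ξ, Z ξ ∈ closedBall (0 : E) ρ
  eq : ∀ ξ, W ξ = w (Z ξ) - Λ / 2 * ‖ξ - Z ξ‖ ^ 2
  le : ∀ ξ, ∀ ζ ∈ closedBall (0 : E) ρ, w ζ - Λ / 2 * ‖ξ - ζ‖ ^ 2 ≤ W ξ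

theorem exists_isSupConv [FiniteDimensional ℝ E] {w : E → ℝ} {ρ : ℝ} (hρ : 0 < ρ)
    (hw : UpperSemicontinuousOn w (closedBall 0 ρ)) (Λ : ℝ) : ∃ W Z, IsSupConv w ρ Λ W Z := by
  have h : ∀ ξ : E, ∃ z ∈ closedBall (0 : E) ρ, ∀ ζ ∈ closedBall (0 : E) ρ,
      w ζ - Λ / 2 * ‖ξ - ζ‖ ^ 2 ≤ w z - Λ / 2 * ‖ξ - z‖ ^ 2 := by
    intro ξ
    have hc : Continuous (fun ζ : E => -(Λ / 2 * ‖ξ - ζ‖ ^ 2)) := by fun_prop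
    obtain ⟨z, hz, hm⟩ := UpperSemicontinuousOn.exists_isMaxOn (s := closedBall (0 : E) ρ)
      ⟨0, by simp [hρ.le]⟩ (isCompact_closedBall _ _)
      (hw.add (hc.upperSemicontinuous.upperSemicontinuousOn _))
    exact ⟨z, hz, fun ζ hζ => by simpa [sub_eq_add_neg] using isMaxOn_iff.1 hm ζ hζ⟩
  choose Z hZ hZ' using h
  exact ⟨_, Z, hZ, fun ξ => rfl, hZ'⟩

theorem IsSupConv.lower {w W : E → ℝ} {Z : E → E} {ρ Λ : ℝ} (h : IsSupConv w ρ Λ W Z) (x y : E) :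
    W x + ⟪Λ • (Z x - x), y - x⟫ - Λ / 2 * ‖y - x‖ ^ 2 ≤ W y := by
  have h1 := h.le y (Z x) (h.mem x)
  rw [h.eq x]
  have e : ‖y - Z x‖ ^ 2 = ‖y - x‖ ^ 2 - 2 * ⟪Z x - x, y - x⟫ + ‖x - Z x‖ ^ 2 := by
    rw [show y - Z x = (y - x) - (Z x - x) by abel, norm_sub_sq_real, norm_sub_rev x (Z x),
      real_inner_comm]
  rw [e] at h1
  rw [inner_smul_left]
  simp only [conj_trivial]
  linarith

theorem HasSecondOrder.slope_eq {W : E → ℝ} {x p q : E} {X : E →L[ℝ] E} {Λ : ℝ}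
    (hW : HasSecondOrder W x p X)
    (h : ∀ y, W x + ⟪q, y - x⟫ - Λ / 2 * ‖y - x‖ ^ 2 ≤ W y) : q = p := by
  refine slope_eq_of_touch (f := W) (x := x) (Λ := Λ + ‖X‖ + 2) ?_
  have h1 := hW 1 one_pos
  have ht : Tendsto (fun y => y - x) (nhds x) (nhds 0) := by
    have : Continuous (fun y => y - x) := by fun_prop
    simpa using this.tendsto x
  filter_upwards [ht.eventually h1] with y hy
  rw [add_sub_cancel, abs_le] at hy
  have h2 : |⟪X (y - x), y - x⟫| ≤ ‖X‖ * ‖y - x‖ ^ 2 := by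
    refine (abs_real_inner_le_norm _ _).trans ?_
    calc _ ≤ (‖X‖ * ‖y - x‖) * ‖y - x‖ := by gcongr; exact X.le_opNorm _
      _ = _ := by ring
  rw [abs_le] at h2
  have := h y
  linarith [hy.2, h2.2]

theorem HasSecondOrder.lower_of_semiconvex {W : E → ℝ} {x p q : E} {X : E →L[ℝ] E} {Λ : ℝ}
    (hW : HasSecondOrder W x p X)
    (h : ∀ y, W x + ⟪q, y - x⟫ - Λ / 2 * ‖y - x‖ ^ 2 ≤ W y) (a : E) :
    -Λ * ‖a‖ ^ 2 ≤ ⟪X a, a⟫ := by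
  obtain rfl := hW.slope_eq h
  refine le_of_forall_pos_le_add fun δ hδ => ?_
  have h1 := hW (δ / (2 * (‖a‖ ^ 2 + 1))) (by positivity)
  have ht : Tendsto (fun t : ℝ => t • a) (nhdsWithin 0 (Ioi 0)) (nhds 0) := by
    have : Continuous (fun t : ℝ => t • a) := by fun_prop
    have h2 := (this.tendsto 0).mono_left (nhdsWithin_le_nhds (s := Ioi 0))
    simpa using h2
  obtain ⟨t, h2, h3⟩ := ((ht.eventually h1).and self_mem_nhdsWithin).exists
  have h3 : 0 < t := h3
  have h4 := h (x + t • a)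
  rw [add_sub_cancel_left] at h4
  rw [abs_le] at h2
  have e : ⟪X (t • a), t • a⟫ = t ^ 2 * ⟪X a, a⟫ := by
    rw [map_smul, inner_smul_left, inner_smul_right]; simp; ring
  have e2 : ‖t • a‖ ^ 2 = t ^ 2 * ‖a‖ ^ 2 := by
    rw [norm_smul, Real.norm_of_nonneg h3.le]; ring
  rw [e, e2] at h2
  rw [e2] at h4
  have h5 : δ / (2 * (‖a‖ ^ 2 + 1)) * ‖a‖ ^ 2 ≤ δ / 2 := by
    rw [div_mul_eq_mul_div, div_le_div_iff₀ (by positivity) (by positivity)]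
    nlinarith
  have h6 : t ^ 2 * (δ / (2 * (‖a‖ ^ 2 + 1)) * ‖a‖ ^ 2) ≤ t ^ 2 * (δ / 2) := by gcongr
  have h7 : t ^ 2 * (-Λ * ‖a‖ ^ 2) ≤ t ^ 2 * (⟪X a, a⟫ + δ) := by
    have := h2.2
    linarith
  exact le_of_mul_le_mul_left h7 (by positivity)

theorem IsSupConv.jet {w W : E → ℝ} {Z : E → E} {ρ Λ : ℝ} (h : IsSupConv w ρ Λ W Z)
    (hΛ : 0 < Λ) {ξ p : E} {X : E →L[ℝ] E} (hW : HasSecondOrder W ξ p X)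
    (hp : ‖ξ‖ + ‖p‖ / Λ < ρ) :
    ‖Z ξ‖ ≤ ‖ξ‖ + ‖p‖ / Λ ∧ ∀ δ > 0, ∀ᶠ z in nhds (0 : E),
      w (Z ξ + z) ≤ w (Z ξ) + ⟪p, z⟫ + ⟪X z, z⟫ / 2 + δ * ‖z‖ ^ 2 := by
  have hZ : Z ξ = ξ + Λ⁻¹ • p := by
    rw [← hW.slope_eq (h.lower ξ), smul_smul, inv_mul_cancel₀ hΛ.ne', one_smul]; abel
  have hZn : ‖Z ξ‖ ≤ ‖ξ‖ + ‖p‖ / Λ := by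
    rw [hZ]
    refine (norm_add_le _ _).trans ?_
    rw [norm_smul, norm_inv, Real.norm_of_nonneg hΛ.le, inv_mul_eq_div]
  refine ⟨hZn, fun δ hδ => ?_⟩
  have ht : Tendsto (fun z => Z ξ + z) (nhds 0) (nhds (Z ξ)) := by
    have : Continuous (fun z => Z ξ + z) := by fun_prop
    simpa using this.tendsto 0
  filter_upwards [hW δ hδ, ht.eventually (isOpen_ball.mem_nhds
    (show Z ξ ∈ ball (0 : E) ρ by simpa using hZn.trans_lt hp))] with z hz hz2
  have h1 := h.le (ξ + z) _ (ball_subset_closedBall hz2)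
  rw [add_sub_add_right_eq_sub] at h1
  have h2 := h.eq ξ
  rw [abs_le] at hz
  linarith [hz.2]

theorem norm_three_sq_le (a b c : E) : ‖a + b + c‖ ^ 2 ≤ 2 * ‖a‖ ^ 2 + 4 * ‖b‖ ^ 2 + 4 * ‖c‖ ^ 2 := by
  have h : ∀ x y : E, ‖x + y‖ ^ 2 ≤ 2 * ‖x‖ ^ 2 + 2 * ‖y‖ ^ 2 := fun x y => by
    have := parallelogram_law_with_norm ℝ x y
    nlinarith [norm_nonneg (x - y)]
  have h1 := h a (b + c)
  have h2 := h b c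
  rw [← add_assoc] at h1
  linarith

theorem IsSupConv.add_le {w₁ w₂ W₁ W₂ : E → ℝ} {Z₁ Z₂ : E → E} {ρ κ : ℝ} (hκ : 0 < κ)
    (h₁ : IsSupConv w₁ ρ (4 * κ) W₁ Z₁) (h₂ : IsSupConv w₂ ρ (4 * κ) W₂ Z₂)
    (hle : ∀ ξ ∈ closedBall (0 : E) ρ, ∀ η ∈ closedBall (0 : E) ρ,
      w₁ ξ + w₂ η ≤ κ / 2 * ‖ξ - η‖ ^ 2) (ξ η : E) :
    W₁ ξ + W₂ η ≤ κ * ‖ξ - η‖ ^ 2 := by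
  have h := hle _ (h₁.mem ξ) _ (h₂.mem η)
  have h3 := norm_three_sq_le (ξ - η) (Z₁ ξ - ξ) (η - Z₂ η)
  rw [show ξ - η + (Z₁ ξ - ξ) + (η - Z₂ η) = Z₁ ξ - Z₂ η by abel, norm_sub_rev (Z₁ ξ) ξ] at h3
  rw [h₁.eq, h₂.eq]
  have h4 : κ / 2 * ‖Z₁ ξ - Z₂ η‖ ^ 2
      ≤ κ / 2 * (2 * ‖ξ - η‖ ^ 2 + 4 * ‖ξ - Z₁ ξ‖ ^ 2 + 4 * ‖η - Z₂ η‖ ^ 2) := by gcongr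
  linarith

theorem HasSecondOrder.restrict {H : Type*} [NormedAddCommGroup H] [InnerProductSpace ℝ H]
    {f : H → ℝ} {x r : H} {M : H →L[ℝ] H} (hf : HasSecondOrder f x r M) (L : E →L[ℝ] H)
    (hL : ∀ a, ‖L a‖ = ‖a‖) {W : E → ℝ} {ξ p : E} {X : E →L[ℝ] E}
    (h : ∀ z, W (ξ + z) - W ξ - ⟪p, z⟫ - ⟪X z, z⟫ / 2
      = f (x + L z) - f x - ⟪r, L z⟫ - ⟪M (L z), L z⟫ / 2) : HasSecondOrder W ξ p X := by
  intro δ hδ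
  have ht : Tendsto L (nhds 0) (nhds 0) := by simpa using L.continuous.tendsto 0
  filter_upwards [ht.eventually (hf δ hδ)] with z hz
  rw [h, ← hL z]; exact hz

/-- Second order expansions of two functions whose sum is controlled by a paraboloid. -/
theorem hessian_sum_le {W₁ W₂ : E → ℝ} {ξ η p q : E} {X Y : E →L[ℝ] E}
    (h₁ : HasSecondOrder W₁ ξ p X) (h₂ : HasSecondOrder W₂ η q Y) {a b : E} {c : ℝ}
    (hc : ∀ᶠ t in nhds (0 : ℝ),
      W₁ (ξ + t • a) + W₂ (η + t • b) ≤ W₁ ξ + W₂ η + t * (⟪p, a⟫ + ⟪q, b⟫) + t ^ 2 * c) :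
    ⟪X a, a⟫ + ⟪Y b, b⟫ ≤ 2 * c := by
  refine le_of_forall_pos_le_add fun δ hδ => ?_
  obtain ⟨D, hD, hD0⟩ : ∃ D > 0, D * (‖a‖ ^ 2 + ‖b‖ ^ 2) ≤ δ / 2 := by
    refine ⟨δ / (2 * (‖a‖ ^ 2 + ‖b‖ ^ 2 + 1)), by positivity, ?_⟩
    rw [div_mul_eq_mul_div, div_le_div_iff₀ (by positivity) (by positivity)]
    nlinarith
  have ht : ∀ a : E, Tendsto (fun t : ℝ => t • a) (nhdsWithin 0 (Ioi 0)) (nhds 0) := by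
    intro a
    have : Continuous (fun t : ℝ => t • a) := by fun_prop
    have h2 := (this.tendsto 0).mono_left (nhdsWithin_le_nhds (s := Ioi 0))
    simpa using h2
  obtain ⟨t, k1, k2, k3, k4⟩ := (((ht a).eventually (h₁ D hD)).and
    (((ht b).eventually (h₂ D hD)).and
      ((hc.filter_mono nhdsWithin_le_nhds).and self_mem_nhdsWithin))).exists
  have k4 : 0 < t := k4
  have k3 : W₁ (ξ + t • a) + W₂ (η + t • b)
    ≤ W₁ ξ + W₂ η + t * (⟪p, a⟫ + ⟪q, b⟫) + t ^ 2 * c := k3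
  have e : ∀ (X : E →L[ℝ] E) (a : E), ⟪X (t • a), t • a⟫ = t ^ 2 * ⟪X a, a⟫ := by
    intro X a
    rw [map_smul, inner_smul_left, inner_smul_right]; simp; ring
  have e2 : ∀ a : E, ‖t • a‖ ^ 2 = t ^ 2 * ‖a‖ ^ 2 := by
    intro a
    rw [norm_smul, Real.norm_of_nonneg k4.le]; ring
  rw [abs_le, e, e2, inner_smul_right] at k1 k2
  have h7 : t ^ 2 * (⟪X a, a⟫ + ⟪Y b, b⟫) ≤ t ^ 2 * (2 * c + δ) := by
    have : t ^ 2 * (D * (‖a‖ ^ 2 + ‖b‖ ^ 2)) ≤ t ^ 2 * (δ / 2) := by gcongr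
    linarith [k1.1, k2.1]
  exact le_of_mul_le_mul_left h7 (by positivity)

/-- The theorem on sums for a quadratic coupling of two copies of the same space. -/
theorem exists_jets_of_sum_le [FiniteDimensional ℝ E] {w₁ w₂ : E → ℝ} {ρ κ : ℝ} (hρ : 0 < ρ)
    (hκ : 0 < κ) (hw₁ : UpperSemicontinuousOn w₁ (closedBall 0 ρ))
    (hw₂ : UpperSemicontinuousOn w₂ (closedBall 0 ρ)) (h₁ : w₁ 0 = 0) (h₂ : w₂ 0 = 0)
    (hle : ∀ ξ ∈ closedBall (0 : E) ρ, ∀ η ∈ closedBall (0 : E) ρ,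
      w₁ ξ + w₂ η ≤ κ / 2 * ‖ξ - η‖ ^ 2) {ε : ℝ} (hε : 0 < ε) :
    ∃ (ξ η p q : E) (X Y : E →L[ℝ] E), ‖ξ‖ < ε ∧ ‖η‖ < ε ∧ ‖p‖ < ε ∧ ‖q‖ < ε ∧
      (∀ δ > 0, ∀ᶠ z in nhds (0 : E),
        w₁ (ξ + z) ≤ w₁ ξ + ⟪p, z⟫ + ⟪X z, z⟫ / 2 + δ * ‖z‖ ^ 2) ∧
      (∀ δ > 0, ∀ᶠ z in nhds (0 : E),
        w₂ (η + z) ≤ w₂ η + ⟪q, z⟫ + ⟪Y z, z⟫ / 2 + δ * ‖z‖ ^ 2) ∧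
      (∀ a b, ⟪X a, a⟫ + ⟪Y b, b⟫ ≤ 2 * κ * ‖a - b‖ ^ 2 + ε * (‖a‖ ^ 2 + ‖b‖ ^ 2)) ∧
      (∀ a, -(4 * κ) * ‖a‖ ^ 2 ≤ ⟪X a, a⟫) ∧ (∀ a, -(4 * κ) * ‖a‖ ^ 2 ≤ ⟪Y a, a⟫) := by
  obtain ⟨W₁, Z₁, s₁⟩ := exists_isSupConv hρ hw₁ (4 * κ)
  obtain ⟨W₂, Z₂, s₂⟩ := exists_isSupConv hρ hw₂ (4 * κ)
  have hW := s₁.add_le hκ s₂ hle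
  have hW10 : 0 ≤ W₁ 0 := by simpa [h₁] using s₁.le 0 0 (by simp [hρ.le])
  have hW20 : 0 ≤ W₂ 0 := by simpa [h₂] using s₂.le 0 0 (by simp [hρ.le])
  have hW0 : W₁ 0 + W₂ 0 ≤ 0 := by simpa using hW 0 0
  obtain ⟨ν, hν⟩ : ∃ ν, ν = ε / 2 := ⟨_, rfl⟩
  have hν0 : 0 < ν := by rw [hν]; positivity
  let f : WithLp 2 (E × E) → ℝ := fun y => W₁ y.fst + W₂ y.snd - κ * ‖y.fst - y.snd‖ ^ 2
    - ν * (‖y.fst‖ ^ 2 + ‖y.snd‖ ^ 2)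
  have hn1 : ∀ y : WithLp 2 (E × E), ‖y.fst‖ ≤ ‖y‖ := fun y => WithLp.norm_fst_le _ _
  have hn2 : ∀ y : WithLp 2 (E × E), ‖y.snd‖ ≤ ‖y‖ := fun y => WithLp.norm_snd_le _ _
  have hin : ∀ x y : WithLp 2 (E × E), ⟪x, y⟫ = ⟪x.fst, y.fst⟫ + ⟪x.snd, y.snd⟫ :=
    fun x y => WithLp.prod_inner_apply x y
  have hnq : ∀ y : WithLp 2 (E × E), ‖y‖ ^ 2 = ‖y.fst‖ ^ 2 + ‖y.snd‖ ^ 2 :=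
    fun y => WithLp.prod_norm_sq_eq_of_L2 y
  have hf0 : f 0 = 0 := by
    simp only [f, WithLp.zero_fst, WithLp.zero_snd, sub_self, norm_zero]
    linarith
  have hmax : ∀ x ∈ closedBall (0 : WithLp 2 (E × E)) ρ, f x ≤ f 0 - ν * ‖x‖ ^ 2 := by
    intro x _
    rw [hf0, hnq]
    have := hW x.fst x.snd
    simp only [f]; linarith
  have hL : ∀ x ∈ closedBall (0 : WithLp 2 (E × E)) ρ, ∃ q : WithLp 2 (E × E),
      ‖q‖ ≤ 2 * (8 * κ * ρ + 4 * κ * ρ + 2 * ν * ρ) ∧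
      ∀ y ∈ closedBall (0 : WithLp 2 (E × E)) ρ,
        f x + ⟪q, y - x⟫ - (8 * κ + 2 * ν) / 2 * ‖y - x‖ ^ 2 ≤ f y := by
    intro x hx
    rw [mem_closedBall_zero_iff] at hx
    have b1 : ‖x.fst‖ ≤ ρ := (hn1 x).trans hx
    have b2 : ‖x.snd‖ ≤ ρ := (hn2 x).trans hx
    have hb : ∀ Z : E → E, ∀ x : E, Z x ∈ closedBall (0 : E) ρ → ‖x‖ ≤ ρ →
        ‖(4 * κ) • (Z x - x)‖ ≤ 8 * κ * ρ := by
      intro Z x h1 h2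
      rw [mem_closedBall_zero_iff] at h1
      rw [norm_smul, Real.norm_of_nonneg (by positivity)]
      calc 4 * κ * ‖Z x - x‖ ≤ 4 * κ * (ρ + ρ) := by
            gcongr; exact (norm_sub_le _ _).trans (add_le_add h1 h2)
        _ = _ := by ring
    have hd : ‖(2 * κ) • (x.fst - x.snd)‖ ≤ 4 * κ * ρ := by
      rw [norm_smul, Real.norm_of_nonneg (by positivity)]
      calc 2 * κ * ‖x.fst - x.snd‖ ≤ 2 * κ * (ρ + ρ) := by
            gcongr; exact (norm_sub_le _ _).trans (add_le_add b1 b2)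
        _ = _ := by ring
    have he : ∀ x : E, ‖x‖ ≤ ρ → ‖(2 * ν) • x‖ ≤ 2 * ν * ρ := by
      intro x hx
      rw [norm_smul, Real.norm_of_nonneg (by positivity)]; gcongr
    refine ⟨WithLp.toLp 2 ((4 * κ) • (Z₁ x.fst - x.fst) - (2 * κ) • (x.fst - x.snd)
      - (2 * ν) • x.fst, (4 * κ) • (Z₂ x.snd - x.snd) + (2 * κ) • (x.fst - x.snd)
      - (2 * ν) • x.snd), ?_, ?_⟩
    · obtain ⟨q, hq⟩ : ∃ q : WithLp 2 (E × E), q =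
        WithLp.toLp 2 ((4 * κ) • (Z₁ x.fst - x.fst) - (2 * κ) • (x.fst - x.snd)
        - (2 * ν) • x.fst, (4 * κ) • (Z₂ x.snd - x.snd) + (2 * κ) • (x.fst - x.snd)
        - (2 * ν) • x.snd) := ⟨_, rfl⟩
      rw [← hq]
      have q1 : ‖q.fst‖ ≤ 8 * κ * ρ + 4 * κ * ρ + 2 * ν * ρ := by
        rw [hq]
        exact (norm_sub_le _ _).trans (add_le_add ((norm_sub_le _ _).trans
          (add_le_add (hb Z₁ _ (s₁.mem _) b1) hd)) (he _ b1))
      have q2 : ‖q.snd‖ ≤ 8 * κ * ρ + 4 * κ * ρ + 2 * ν * ρ := by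
        rw [hq]
        exact (norm_sub_le _ _).trans (add_le_add ((norm_add_le _ _).trans
          (add_le_add (hb Z₂ _ (s₂.mem _) b2) hd)) (he _ b2))
      refine le_of_sq_le_sq ?_ (by positivity)
      rw [hnq]
      nlinarith [norm_nonneg q.fst, norm_nonneg q.snd]
    · intro y _
      obtain ⟨e, rfl⟩ : ∃ e, y = x + e := ⟨y - x, by abel⟩
      have l1 := s₁.lower x.fst (x.fst + e.fst)
      have l2 := s₂.lower x.snd (x.snd + e.snd)
      rw [add_sub_cancel_left] at l1 l2 ⊢
      rw [hin, hnq]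
      simp only [f, WithLp.add_fst, WithLp.add_snd]
      simp only [WithLp.toLp_fst, WithLp.toLp_snd, inner_sub_left, inner_add_left,
        inner_smul_left, conj_trivial] at l1 l2 ⊢
      have e1 : ‖x.fst + e.fst - (x.snd + e.snd)‖ ^ 2 = ‖x.fst - x.snd‖ ^ 2
          + 2 * ⟪x.fst - x.snd, e.fst - e.snd⟫ + ‖e.fst - e.snd‖ ^ 2 := by
        rw [← norm_add_sq_real]; congr 2; abel
      have e2 : ‖e.fst - e.snd‖ ^ 2 ≤ 2 * ‖e.fst‖ ^ 2 + 2 * ‖e.snd‖ ^ 2 := by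
        have := parallelogram_law_with_norm ℝ e.fst e.snd
        nlinarith [norm_nonneg (e.fst + e.snd)]
      have e3 := mul_le_mul_of_nonneg_left e2 hκ.le
      rw [e1, norm_add_sq_real x.fst, norm_add_sq_real x.snd]
      simp only [inner_sub_left, inner_sub_right]
      linarith
  obtain ⟨ε', hε', hε'ε, hε'ρ⟩ : ∃ ε' > 0, ε' * (2 + 1 / (4 * κ) + ν / (2 * κ) + 4 * κ + 2 * ν) < ε ∧
      ε' * (2 + 1 / (4 * κ) + ν / (2 * κ) + 4 * κ + 2 * ν) < ρ := by
    obtain ⟨ε', h1, h2⟩ := exists_between (show 0 < min ε ρ / (2 + 1 / (4 * κ) + ν / (2 * κ) + 4 * κ + 2 * ν) by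
      positivity)
    rw [lt_div_iff₀ (by positivity), lt_min_iff] at h2
    exact ⟨ε', h1, h2.1, h2.2⟩
  obtain ⟨x, r, M, hx, hxρ, hr, hM, hc⟩ :=
    exists_secondOrder_of_strictMax hρ hν0 (by positivity) hL hmax hε'
  let J₁ : E →L[ℝ] WithLp 2 (E × E) :=
    (WithLp.prodContinuousLinearEquiv 2 ℝ E E).symm.toContinuousLinearMap ∘L
      ContinuousLinearMap.inl ℝ E E
  let J₂ : E →L[ℝ] WithLp 2 (E × E) :=
    (WithLp.prodContinuousLinearEquiv 2 ℝ E E).symm.toContinuousLinearMap ∘L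
      ContinuousLinearMap.inr ℝ E E
  have J1f : ∀ a, (J₁ a).fst = a := fun a => rfl
  have J1s : ∀ a, (J₁ a).snd = 0 := fun a => rfl
  have J2f : ∀ a, (J₂ a).fst = 0 := fun a => rfl
  have J2s : ∀ a, (J₂ a).snd = a := fun a => rfl
  let X : E →L[ℝ] E := WithLp.fstL 2 ℝ E E ∘L M ∘L J₁ +
    (2 * κ + 2 * ν) • ContinuousLinearMap.id ℝ E
  let Y : E →L[ℝ] E := WithLp.sndL 2 ℝ E E ∘L M ∘L J₂ +
    (2 * κ + 2 * ν) • ContinuousLinearMap.id ℝ E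
  have hX : ∀ a, X a = (M (J₁ a)).fst + (2 * κ + 2 * ν) • a := fun a => rfl
  have hY : ∀ a, Y a = (M (J₂ a)).snd + (2 * κ + 2 * ν) • a := fun a => rfl
  obtain ⟨ξ, hξ⟩ : ∃ ξ, ξ = x.fst := ⟨_, rfl⟩
  obtain ⟨η, hη⟩ : ∃ η, η = x.snd := ⟨_, rfl⟩
  obtain ⟨p, hp⟩ : ∃ p, p = r.fst + (2 * κ) • (ξ - η) + (2 * ν) • ξ := ⟨_, rfl⟩
  obtain ⟨q, hq⟩ : ∃ q, q = r.snd - (2 * κ) • (ξ - η) + (2 * ν) • η := ⟨_, rfl⟩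
  have hξn : ‖ξ‖ < ε' := by rw [hξ]; exact (hn1 x).trans_lt hx
  have hηn : ‖η‖ < ε' := by rw [hη]; exact (hn2 x).trans_lt hx
  have hξη : ‖ξ - η‖ ≤ 2 * ε' := (norm_sub_le _ _).trans (by linarith)
  have hκξ : ‖(2 * κ) • (ξ - η)‖ ≤ 4 * κ * ε' := by
    rw [norm_smul, Real.norm_of_nonneg (by positivity)]; nlinarith
  have hpn : ‖p‖ ≤ ε' + 4 * κ * ε' + 2 * ν * ε' := by
    rw [hp]
    refine (norm_add_le _ _).trans (add_le_add ((norm_add_le _ _).trans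
      (add_le_add ((hn1 r).trans hr.le) hκξ)) ?_)
    rw [norm_smul, Real.norm_of_nonneg (by positivity)]; gcongr
  have hqn : ‖q‖ ≤ ε' + 4 * κ * ε' + 2 * ν * ε' := by
    rw [hq]
    refine (norm_add_le _ _).trans (add_le_add ((norm_sub_le _ _).trans
      (add_le_add ((hn2 r).trans hr.le) hκξ)) ?_)
    rw [norm_smul, Real.norm_of_nonneg (by positivity)]; gcongr
  have hW1 : HasSecondOrder W₁ ξ p X := by
    refine hM.restrict J₁ (fun a => ?_) fun z => ?_
    · have := hnq (J₁ a)
      rw [J1f, J1s, norm_zero] at this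
      exact (sq_eq_sq₀ (norm_nonneg _) (norm_nonneg _)).1 (by linarith)
    · simp only [f, hX, hp, hξ, hη, hin, WithLp.add_fst, WithLp.add_snd, J1f, J1s, add_zero,
        inner_zero_right, inner_add_left, inner_smul_left, conj_trivial]
      rw [show x.fst + z - x.snd = (x.fst - x.snd) + z by abel, norm_add_sq_real, norm_add_sq_real,
        real_inner_self_eq_norm_sq]
      ring
  have hW2 : HasSecondOrder W₂ η q Y := by
    refine hM.restrict J₂ (fun a => ?_) fun z => ?_
    · have := hnq (J₂ a)
      rw [J2f, J2s, norm_zero] at this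
      exact (sq_eq_sq₀ (norm_nonneg _) (norm_nonneg _)).1 (by linarith)
    · simp only [f, hY, hq, hξ, hη, hin, WithLp.add_fst, WithLp.add_snd, J2f, J2s, add_zero, zero_add,
        inner_zero_right, inner_add_left, inner_sub_left (𝕜 := ℝ) (_ : E) _ z, inner_smul_left,
        conj_trivial]
      rw [show x.fst - (x.snd + z) = (x.fst - x.snd) - z by abel, norm_sub_sq_real,
        norm_add_sq_real, real_inner_self_eq_norm_sq, inner_sub_left]
      ring
  have hpκ : ∀ p : E, ‖p‖ ≤ ε' + 4 * κ * ε' + 2 * ν * ε' →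
      ‖p‖ / (4 * κ) ≤ ε' * (1 / (4 * κ) + 1 + ν / (2 * κ)) := by
    intro p hp
    rw [div_le_iff₀ (by positivity)]
    refine hp.trans (le_of_eq ?_)
    field_simp
    ring
  have b1 : 0 < ε' * (4 * κ) := by positivity
  have b2 : 0 < ε' * ν := by positivity
  have b3 : 0 < ε' * (1 / (4 * κ)) := by positivity
  have b4 : 0 < ε' * (ν / (2 * κ)) := by positivity
  have c1 := hpκ p hpn
  have c2 := hpκ q hqn
  obtain ⟨d1, d2⟩ := s₁.jet (by positivity) hW1 (by linarith)
  obtain ⟨d3, d4⟩ := s₂.jet (by positivity) hW2 (by linarith)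
  refine ⟨Z₁ ξ, Z₂ η, p, q, X, Y, by linarith, by linarith, by linarith, by linarith, d2, d4,
    fun a b => ?_, hW1.lower_of_semiconvex (s₁.lower ξ), hW2.lower_of_semiconvex (s₂.lower η)⟩
  have hsum : ⟪X a, a⟫ + ⟪Y b, b⟫ ≤ 2 * (κ * ‖a - b‖ ^ 2 + ν * (‖a‖ ^ 2 + ‖b‖ ^ 2)) := by
    refine hessian_sum_le hW1 hW2 ?_
    have ht : Tendsto (fun t : ℝ => x + t • WithLp.toLp 2 (a, b)) (nhds 0) (nhds x) := by
      have : Continuous (fun t : ℝ => x + t • WithLp.toLp 2 (a, b)) := by fun_prop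
      simpa using this.tendsto 0
    filter_upwards [ht.eventually (isOpen_ball.mem_nhds
      (show x ∈ ball (0 : WithLp 2 (E × E)) ρ by simpa using hxρ))] with t htx
    have h5 := hc _ (ball_subset_closedBall htx)
    simp only [f, hin, WithLp.add_fst, WithLp.add_snd, WithLp.smul_fst, WithLp.smul_snd,
      WithLp.toLp_fst, WithLp.toLp_snd, add_sub_cancel_left, inner_smul_right] at h5
    rw [hξ, hη, hp, hq]
    rw [show x.fst + t • a - (x.snd + t • b) = (x.fst - x.snd) + t • (a - b) by
      rw [smul_sub]; abel, norm_add_sq_real, norm_add_sq_real, norm_add_sq_real] at h5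
    simp only [norm_smul, inner_smul_right, mul_pow, Real.norm_eq_abs, sq_abs] at h5
    simp only [inner_add_left, inner_sub_left, inner_smul_left, conj_trivial, hξ, hη]
    simp only [inner_sub_left, inner_sub_right] at h5
    linarith
  rw [hν] at hsum
  linarith

end Sums

section Jets

/-- The symmetric bilinear form of a bounded operator. -/
def symForm {E : Type*} [NormedAddCommGroup E] [InnerProductSpace ℝ E] (X : E →L[ℝ] E) :
    E →L[ℝ] E →L[ℝ] ℝ :=
  LinearMap.mkContinuous₂ (LinearMap.mk₂ ℝ (fun v w => (⟪X v, w⟫ + ⟪X w, v⟫) / 2)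
    (fun a b c => by simp only [map_add, inner_add_left, inner_add_right]; ring)
    (fun a b c => by
      simp only [map_smul, inner_smul_left, inner_smul_right, smul_eq_mul, conj_trivial]; ring)
    (fun a b c => by simp only [map_add, inner_add_left, inner_add_right]; ring)
    (fun a b c => by
      simp only [map_smul, inner_smul_left, inner_smul_right, smul_eq_mul, conj_trivial]; ring))
    ‖X‖ (fun v w => by
      have h : ∀ v w : E, |⟪X v, w⟫| ≤ ‖X‖ * ‖v‖ * ‖w‖ := fun v w =>
        (abs_real_inner_le_norm _ _).trans (by gcongr; exact X.le_opNorm _)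
      have h1 := abs_le.1 (h v w)
      have h2 := abs_le.1 (h w v)
      rw [LinearMap.mk₂_apply, Real.norm_eq_abs, abs_le]
      constructor <;> linarith [h1.1, h2.1, h1.2, h2.2])

theorem symForm_apply {E : Type*} [NormedAddCommGroup E] [InnerProductSpace ℝ E] (X : E →L[ℝ] E)
    (v w : E) : symForm X v w = (⟪X v, w⟫ + ⟪X w, v⟫) / 2 := rfl

/-- The symmetric matrix of the quadratic form of a bounded operator. -/
def symMat (X : EucSp N →L[ℝ] EucSp N) : MatN N := fun i j =>
  symForm X (EuclideanSpace.single i (1 : ℝ)) (EuclideanSpace.single j (1 : ℝ))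

theorem hasFDerivAt_quadratic (c : ℝ) (p x₀ : EucSp N) (X : EucSp N →L[ℝ] EucSp N) (y : EucSp N) :
    HasFDerivAt (fun x => c + ⟪p, x - x₀⟫ + ⟪X (x - x₀), x - x₀⟫ / 2)
      (innerSL ℝ p + symForm X (y - x₀)) y := by
  have h1 : HasFDerivAt (fun x : EucSp N => x - x₀) (ContinuousLinearMap.id ℝ _) y :=
    (hasFDerivAt_id y).sub_const x₀
  have h2 : HasFDerivAt (fun x : EucSp N => X (x - x₀)) (X ∘L ContinuousLinearMap.id ℝ _) y :=
    X.hasFDerivAt.comp y h1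
  have h3 := ((hasFDerivAt_const p y).inner ℝ h1).const_add c
  have h4 := (h2.inner ℝ h1).const_mul (2⁻¹ : ℝ)
  refine ((h3.add h4).congr_of_eventuallyEq
    (Eventually.of_forall fun x => by simp; ring)).congr_fderiv ?_
  ext v
  have e : ⟪y - x₀, X v⟫ = ⟪X v, y - x₀⟫ := real_inner_comm _ _
  simp only [ContinuousLinearMap.add_apply, symForm_apply, innerSL_apply_apply]
  simp [fderivInnerCLM_apply, e]
  ring

theorem gradient_quadratic (c : ℝ) (p x₀ : EucSp N) (X : EucSp N →L[ℝ] EucSp N) :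
    gradient (fun x => c + ⟪p, x - x₀⟫ + ⟪X (x - x₀), x - x₀⟫ / 2) x₀ = p := by
  apply HasGradientAt.gradient
  rw [hasGradientAt_iff_hasFDerivAt]
  refine (hasFDerivAt_quadratic c p x₀ X x₀).congr_fderiv ?_
  ext v; simp [innerSL_apply_apply]

theorem hessMat_quadratic (c : ℝ) (p x₀ : EucSp N) (X : EucSp N →L[ℝ] EucSp N) :
    hessMat (fun x => c + ⟪p, x - x₀⟫ + ⟪X (x - x₀), x - x₀⟫ / 2) x₀ = symMat X := by
  have h : fderiv ℝ (fun x => c + ⟪p, x - x₀⟫ + ⟪X (x - x₀), x - x₀⟫ / 2)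
      = fun y => innerSL ℝ p + symForm X (y - x₀) := by
    funext y; exact (hasFDerivAt_quadratic c p x₀ X y).fderiv
  have h2 : HasFDerivAt (fun y => innerSL ℝ p + symForm X (y - x₀)) (symForm X) x₀ := by
    have := ((symForm X).hasFDerivAt.comp x₀ ((hasFDerivAt_id x₀).sub_const x₀)).const_add
      (innerSL ℝ p)
    exact this
  funext i j
  rw [hessMat, iteratedFDeriv_two_apply, h, h2.fderiv]
  simp [symMat]

theorem uscEnv_eq {T : ℝ} {w : EucSp N → ℝ → ℝ}
    (hw : UpperSemicontinuousOn (fun p : EucSp N × ℝ => w p.1 p.2) (univ ×ˢ Ico 0 T))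
    {x : EucSp N} {t : ℝ} (ht : t ∈ Ioo 0 T) : uscEnv w x t = w x t := by
  have hn : univ ×ˢ Ico 0 T ∈ nhds (x, t) :=
    prod_mem_nhds univ_mem (Ico_mem_nhds ht.1 ht.2)
  have hlt : ∀ c, w x t < c → ∀ᶠ p : EucSp N × ℝ in nhds (x, t), w p.1 p.2 < c := by
    intro c hc
    have := hw (x, t) ⟨mem_univ _, ht.1.le, ht.2⟩ c hc
    rwa [nhdsWithin_eq_nhds.2 hn] at this
  have hf : ∃ᶠ p : EucSp N × ℝ in nhds (x, t), w x t ≤ w p.1 p.2 := by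
    intro h
    exact h.self_of_nhds le_rfl
  have hb : IsBoundedUnder (· ≤ ·) (nhds (x, t)) (fun p : EucSp N × ℝ => w p.1 p.2) :=
    ⟨w x t + 1, eventually_map.2 ((hlt _ (lt_add_one _)).mono fun _ h => h.le)⟩
  refine le_antisymm (le_of_forall_gt_imp_ge_of_dense fun c hc => ?_)
    (le_limsup_of_frequently_le hf hb)
  exact limsup_le_of_le (IsCoboundedUnder.of_frequently_ge hf) ((hlt c hc).mono fun _ h => h.le)

theorem IsSubSol.jet {T α : ℝ} {F : EucSp N → EucSp N → MatN N → ℝ} {h : EucSp N → ℝ → EucSp N}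
    {g w : EucSp N → ℝ → ℝ}
    (hw : UpperSemicontinuousOn (fun p : EucSp N × ℝ => w p.1 p.2) (univ ×ˢ Ico 0 T))
    (hs : IsSubSol univ T F h α g w) {x₀ : EucSp N} {t₀ : ℝ} (ht : t₀ ∈ Ioo 0 T)
    {p b : EucSp N} {X : EucSp N →L[ℝ] EucSp N} {a c : ℝ} (hp : p ≠ 0)
    (hle : ∀ᶠ z : EucSp N × ℝ in nhds (x₀, t₀), w z.1 z.2 ≤ w x₀ t₀ + ⟪p, z.1 - x₀⟫
      + ⟪X (z.1 - x₀), z.1 - x₀⟫ / 2 + a * (z.2 - t₀) + (z.2 - t₀) * ⟪b, z.1 - x₀⟫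
      + c * (z.2 - t₀) ^ 2) :
    a - F x₀ p (symMat X) - gradTerm h α x₀ t₀ p ≤ g x₀ t₀ := by
  let φ : EucSp N → ℝ → ℝ := fun x t => w x₀ t₀ + ⟪p, x - x₀⟫
      + ⟪X (x - x₀), x - x₀⟫ / 2 + a * (t - t₀) + (t - t₀) * ⟪b, x - x₀⟫
      + c * (t - t₀) ^ 2
  have hφ : (fun x => φ x t₀) = fun x => w x₀ t₀ + ⟪p, x - x₀⟫ + ⟪X (x - x₀), x - x₀⟫ / 2 := by
    funext x; simp [φ]
  have hφt : deriv (fun s => φ x₀ s) t₀ = a := by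
    have : HasDerivAt (fun s => φ x₀ s) (a * 1 + c * (2 * (t₀ - t₀) ^ 1 * 1)) t₀ := by
      have h1 := (hasDerivAt_id t₀).sub_const t₀
      have h2 := ((h1.const_mul a).add ((h1.pow 2).const_mul c)).const_add (w x₀ t₀)
      refine (h2.congr_of_eventuallyEq (Eventually.of_forall fun s => ?_)).congr_deriv ?_
      · simp [φ]; ring
      · simp
    rw [this.deriv]; simp
  have key := (hs x₀ (mem_univ _) t₀ ht).1 φ ?_ ?_ ?_ ?_
  · rw [hφ, gradient_quadratic, hessMat_quadratic, hφt] at key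
    exact key
  · have k1 : ContDiff ℝ 2 (fun z : EucSp N × ℝ => z.1 - x₀) := by fun_prop
    have k2 : ContDiff ℝ 2 (fun z : EucSp N × ℝ => X (z.1 - x₀)) := by fun_prop
    have k3 : ContDiff ℝ 2 (fun z : EucSp N × ℝ => z.2 - t₀) := by fun_prop
    exact ((((contDiff_const.add (contDiff_const.inner ℝ k1)).add
      ((k2.inner ℝ k1).div_const 2)).add (contDiff_const.mul k3)).add
      (k3.mul (contDiff_const.inner ℝ k1))).add (contDiff_const.mul (k3.pow 2))
  · have : ∀ᶠ z : EucSp N × ℝ in nhds (x₀, t₀), z.2 ∈ Ioo 0 T :=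
      continuous_snd.continuousAt.eventually (Ioo_mem_nhds ht.1 ht.2)
    filter_upwards [hle, this] with z hz hz2
    rw [uscEnv_eq hw hz2]; exact hz
  · rw [uscEnv_eq hw ht]; simp [φ]
  · rw [hφ, gradient_quadratic]; exact hp

end Jets

section Facts

theorem symMat_isSymm (X : EucSp N →L[ℝ] EucSp N) : (symMat X).IsSymm := by
  ext i j
  simp only [Matrix.transpose_apply, symMat, symForm_apply]
  ring

theorem symMat_add (X Y : EucSp N →L[ℝ] EucSp N) : symMat (X + Y) = symMat X + symMat Y := by
  ext i j
  simp only [Matrix.add_apply, symMat, symForm_apply, add_apply, inner_add_left]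
  ring

theorem symMat_smul (c : ℝ) (X : EucSp N →L[ℝ] EucSp N) : symMat (c • X) = c • symMat X := by
  ext i j
  simp only [Matrix.smul_apply, symMat, symForm_apply, smul_apply,
    real_inner_smul_left, smul_eq_mul]
  ring

theorem symMat_neg (X : EucSp N →L[ℝ] EucSp N) : symMat (-X) = -symMat X := by
  rw [← neg_one_smul ℝ X, symMat_smul, neg_one_smul]

theorem symMat_sub (X Y : EucSp N →L[ℝ] EucSp N) : symMat (X - Y) = symMat X - symMat Y := by
  rw [sub_eq_add_neg, symMat_add, symMat_neg, sub_eq_add_neg]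

theorem dotProduct_symMat (X : EucSp N →L[ℝ] EucSp N) (v : Fin N → ℝ) :
    v ⬝ᵥ (symMat X).mulVec v = ⟪X (WithLp.toLp 2 v), WithLp.toLp 2 v⟫ := by
  have hv : WithLp.toLp 2 v = ∑ i, v i • EuclideanSpace.single i (1 : ℝ) := by
    ext j
    simp [Finset.sum_apply, Pi.single_apply]
  have h1 : ⟪X (WithLp.toLp 2 v), WithLp.toLp 2 v⟫
      = symForm X (WithLp.toLp 2 v) (WithLp.toLp 2 v) := by
    rw [symForm_apply]; ring
  rw [h1, hv]
  simp only [map_sum, map_smul, sum_apply, smul_apply,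
    smul_eq_mul, dotProduct, Matrix.mulVec, symMat, Finset.mul_sum]
  rw [Finset.sum_comm]
  refine Finset.sum_congr rfl fun i _ => Finset.sum_congr rfl fun j _ => ?_
  ring_nf

theorem symMat_posSemidef {X : EucSp N →L[ℝ] EucSp N} (hX : ∀ a, 0 ≤ ⟪X a, a⟫) :
    (symMat X).PosSemidef := by
  refine Matrix.PosSemidef.of_dotProduct_mulVec_nonneg ?_ fun v => ?_
  · have := symMat_isSymm X
    rwa [Matrix.IsHermitian, Matrix.conjTranspose_eq_transpose_of_trivial]
  · have := dotProduct_symMat X v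
    simp only [star_trivial]
    rw [this]; exact hX _

theorem trace_symMat_le {X : EucSp N →L[ℝ] EucSp N} {b : ℝ} (hX : ∀ a, ⟪X a, a⟫ ≤ b * ‖a‖ ^ 2) :
    (symMat X).trace ≤ N * b := by
  have : ∀ i : Fin N, symMat X i i ≤ b := fun i => by
    have := hX (EuclideanSpace.single i (1 : ℝ))
    simp only [symMat, symForm_apply]
    simp only [PiLp.norm_single, norm_one, one_pow, mul_one] at this
    linarith
  calc (symMat X).trace = ∑ i, symMat X i i := rfl
    _ ≤ ∑ _i : Fin N, b := Finset.sum_le_sum fun i _ => this i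
    _ = N * b := by simp

theorem abs_symForm_le {X : EucSp N →L[ℝ] EucSp N} {b : ℝ} (hX : ∀ a, |⟪X a, a⟫| ≤ b * ‖a‖ ^ 2)
    (v w : EucSp N) : |symForm X v w| ≤ b / 2 * (‖v‖ ^ 2 + ‖w‖ ^ 2) := by
  have e : symForm X v w = (⟪X (v + w), v + w⟫ - ⟪X (v - w), v - w⟫) / 4 := by
    simp only [symForm_apply, map_add, map_sub, inner_add_left, inner_add_right, inner_sub_left,
      inner_sub_right]
    ring
  have h1 := abs_le.1 (hX (v + w))
  have h2 := abs_le.1 (hX (v - w))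
  have h3 := parallelogram_law_with_norm ℝ v w
  have h4 : b * ‖v + w‖ ^ 2 + b * ‖v - w‖ ^ 2 = 2 * b * (‖v‖ ^ 2 + ‖w‖ ^ 2) := by
    linear_combination b * h3
  rw [e, abs_le]
  constructor <;> linarith [h1.1, h1.2, h2.1, h2.2]

theorem frobNorm_symMat_le {X : EucSp N →L[ℝ] EucSp N} {b : ℝ} (hb : 0 ≤ b)
    (hX : ∀ a, |⟪X a, a⟫| ≤ b * ‖a‖ ^ 2) : frobNorm (symMat X) ≤ N * b := by
  have : ∀ i j : Fin N, symMat X i j ^ 2 ≤ b ^ 2 := fun i j => by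
    have := abs_symForm_le hX (EuclideanSpace.single i (1 : ℝ)) (EuclideanSpace.single j (1 : ℝ))
    simp only [PiLp.norm_single, norm_one, one_pow] at this
    refine sq_le_sq' ?_ ?_ <;> simp only [symMat] <;> linarith [abs_le.1 this]
  rw [frobNorm]
  refine Real.sqrt_le_iff.2 ⟨by positivity, ?_⟩
  calc ∑ i, ∑ j, symMat X i j ^ 2 ≤ ∑ _i : Fin N, ∑ _j : Fin N, b ^ 2 :=
        Finset.sum_le_sum fun i _ => Finset.sum_le_sum fun j _ => this i j
    _ = (N * b) ^ 2 := by simp; ring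

variable {F : EucSp N → EucSp N → MatN N → ℝ} {α a A : ℝ}

theorem H1.map_zero (h : H1 univ F α) (x : EucSp N) {p : EucSp N} (hp : p ≠ 0) :
    F x p 0 = 0 := by
  have := h x (mem_univ _) p hp 0 (by simp [Matrix.IsSymm]) 1 one_ne_zero 0 le_rfl
  simpa using this

theorem H2.mono (h : H2 univ F α a A) (x : EucSp N) {p : EucSp N} (hp : p ≠ 0)
    {X Y : EucSp N →L[ℝ] EucSp N} (hXY : ∀ v, ⟪X v, v⟫ ≤ ⟪Y v, v⟫) :
    F x p (symMat X) ≤ F x p (symMat Y) := by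
  have hpos : ∀ v, 0 ≤ ⟪(Y - X) v, v⟫ := fun v => by
    rw [sub_apply, inner_sub_left]; linarith [hXY v]
  have hP := symMat_posSemidef hpos
  have := (h.2.2 x (mem_univ _) p hp (symMat X) (symMat (Y - X)) (symMat_isSymm _)
    (symMat_isSymm _) hP).1
  have e : symMat X + symMat (Y - X) = symMat Y := by rw [symMat_sub]; abel
  rw [e] at this
  have h2 : 0 ≤ a * ‖p‖ ^ α * (symMat (Y - X)).trace :=
    mul_nonneg (mul_nonneg h.1.le (by positivity)) hP.trace_nonneg
  linarith

theorem H2.sub_le (h : H2 univ F α a A) (x : EucSp N) {p : EucSp N} (hp : p ≠ 0)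
    {X Y : EucSp N →L[ℝ] EucSp N} {b : ℝ} (hXY : ∀ v, ⟪X v, v⟫ ≤ ⟪Y v, v⟫)
    (hb : ∀ v, ⟪Y v, v⟫ ≤ ⟪X v, v⟫ + b * ‖v‖ ^ 2) :
    F x p (symMat Y) ≤ F x p (symMat X) + A * N * (‖p‖ ^ α * b) := by
  have hpos : ∀ v, 0 ≤ ⟪(Y - X) v, v⟫ := fun v => by
    rw [sub_apply, inner_sub_left]; linarith [hXY v]
  have hP := symMat_posSemidef hpos
  have := (h.2.2 x (mem_univ _) p hp (symMat X) (symMat (Y - X)) (symMat_isSymm _)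
    (symMat_isSymm _) hP).2
  have e : symMat X + symMat (Y - X) = symMat Y := by rw [symMat_sub]; abel
  rw [e] at this
  have ht : (symMat (Y - X)).trace ≤ N * b := trace_symMat_le fun v => by
    rw [sub_apply, inner_sub_left]; linarith [hb v]
  have hA : 0 ≤ A := h.1.le.trans h.2.1
  have h2 : A * ‖p‖ ^ α * (symMat (Y - X)).trace ≤ A * ‖p‖ ^ α * (N * b) := by
    gcongr
  nlinarith

theorem H2.abs_form_le (h : H2 univ F α a A) (h1 : H1 univ F α) (x : EucSp N) {p : EucSp N} (hp : p ≠ 0)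
    {X : EucSp N →L[ℝ] EucSp N} {b : ℝ} (hX : ∀ v, |⟪X v, v⟫| ≤ b * ‖v‖ ^ 2) :
    |F x p (symMat X)| ≤ A * N * (‖p‖ ^ α * b) := by
  have h0 : F x p (symMat 0) = 0 := by
    have : symMat (0 : EucSp N →L[ℝ] EucSp N) = 0 := by
      rw [← zero_smul ℝ (0 : EucSp N →L[ℝ] EucSp N), symMat_smul, zero_smul]
    rw [this, h1.map_zero x hp]
  let I := ContinuousLinearMap.id ℝ (EucSp N)
  have hI : ∀ (c : ℝ) (v : EucSp N), ⟪(c • I) v, v⟫ = c * ‖v‖ ^ 2 := fun c v => by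
    simp [I, real_inner_smul_left]
  have hb0 : ∀ v : EucSp N, 0 ≤ b * ‖v‖ ^ 2 := fun v => (abs_nonneg _).trans (hX v)
  have u1 := h.mono x hp (X := X) (Y := b • I) fun v => by rw [hI]; exact (abs_le.1 (hX v)).2
  have u2 := h.sub_le x hp (X := 0) (Y := b • I) (b := b) (fun v => by rw [hI]; simpa using hb0 v)
    (fun v => by rw [hI]; simp)
  have u3 := h.mono x hp (X := (-b) • I) (Y := X) fun v => by
    rw [hI]; linarith [(abs_le.1 (hX v)).1]
  have u4 := h.sub_le x hp (X := (-b) • I) (Y := 0) (b := b)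
    (fun v => by rw [hI]; simpa using hb0 v) (fun v => by rw [hI]; simp)
  rw [abs_le]; constructor <;> linarith

theorem gradTerm_neg (h : EucSp N → ℝ → EucSp N) (α : ℝ) (x : EucSp N) (t : ℝ) (p : EucSp N) :
    gradTerm h α x t (-p) = -gradTerm h α x t p := by
  simp [gradTerm]

theorem abs_gradTerm_le {h : EucSp N → ℝ → EucSp N} {α : ℝ} {x : EucSp N} {t : ℝ} {p : EucSp N}
    (hp : p ≠ 0) {H : ℝ} (hH : ‖h x t‖ ≤ H) : |gradTerm h α x t p| ≤ H * ‖p‖ ^ (1 + α) := by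
  rw [gradTerm, abs_mul, abs_of_nonneg (by positivity : (0 : ℝ) ≤ ‖p‖ ^ α),
    Real.rpow_add (norm_pos_iff.2 hp), Real.rpow_one, ← mul_assoc]
  gcongr
  exact (abs_real_inner_le_norm _ _).trans (by gcongr)

theorem lscEnv_eq {T : ℝ} {v : EucSp N → ℝ → ℝ}
    (hv : LowerSemicontinuousOn (fun p : EucSp N × ℝ => v p.1 p.2) (univ ×ˢ Ico 0 T))
    {x : EucSp N} {t : ℝ} (ht : t ∈ Ioo 0 T) : lscEnv v x t = v x t := by
  have hn : univ ×ˢ Ico 0 T ∈ nhds (x, t) :=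
    prod_mem_nhds univ_mem (Ico_mem_nhds ht.1 ht.2)
  have hlt : ∀ c, c < v x t → ∀ᶠ p : EucSp N × ℝ in nhds (x, t), c < v p.1 p.2 := by
    intro c hc
    have := hv (x, t) ⟨mem_univ _, ht.1.le, ht.2⟩ c hc
    rwa [nhdsWithin_eq_nhds.2 hn] at this
  have hf : ∃ᶠ p : EucSp N × ℝ in nhds (x, t), v p.1 p.2 ≤ v x t := by
    intro h
    exact h.self_of_nhds le_rfl
  have hb : IsBoundedUnder (· ≥ ·) (nhds (x, t)) (fun p : EucSp N × ℝ => v p.1 p.2) :=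
    ⟨v x t - 1, eventually_map.2 ((hlt _ (sub_one_lt _)).mono fun _ h => h.le)⟩
  refine le_antisymm (liminf_le_of_frequently_le hf hb)
    (le_of_forall_lt_imp_le_of_dense fun c hc => ?_)
  exact le_liminf_of_le (IsCoboundedUnder.of_frequently_le hf) ((hlt c hc).mono fun _ h => h.le)

theorem IsSuperSol.jet {T α : ℝ} {F : EucSp N → EucSp N → MatN N → ℝ} {h : EucSp N → ℝ → EucSp N}
    {f v : EucSp N → ℝ → ℝ}
    (hv : LowerSemicontinuousOn (fun p : EucSp N × ℝ => v p.1 p.2) (univ ×ˢ Ico 0 T))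
    (hs : IsSuperSol univ T F h α f v) {x₀ : EucSp N} {t₀ : ℝ} (ht : t₀ ∈ Ioo 0 T)
    {p b : EucSp N} {X : EucSp N →L[ℝ] EucSp N} {a c : ℝ} (hp : p ≠ 0)
    (hle : ∀ᶠ z : EucSp N × ℝ in nhds (x₀, t₀), -v z.1 z.2 ≤ -v x₀ t₀ + ⟪p, z.1 - x₀⟫
      + ⟪X (z.1 - x₀), z.1 - x₀⟫ / 2 + a * (z.2 - t₀) + (z.2 - t₀) * ⟪b, z.1 - x₀⟫
      + c * (z.2 - t₀) ^ 2) :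
    a + F x₀ (-p) (symMat (-X)) - gradTerm h α x₀ t₀ p ≤ -f x₀ t₀ := by
  let φ : EucSp N → ℝ → ℝ := fun x t => v x₀ t₀ + ⟪-p, x - x₀⟫
      + ⟪(-X) (x - x₀), x - x₀⟫ / 2 + (-a) * (t - t₀) + (t - t₀) * ⟪-b, x - x₀⟫
      + (-c) * (t - t₀) ^ 2
  have hφ : (fun x => φ x t₀)
      = fun x => v x₀ t₀ + ⟪-p, x - x₀⟫ + ⟪(-X) (x - x₀), x - x₀⟫ / 2 := by
    funext x; simp [φ]
  have hφt : deriv (fun s => φ x₀ s) t₀ = -a := by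
    have : HasDerivAt (fun s => φ x₀ s) ((-a) * 1 + (-c) * (2 * (t₀ - t₀) ^ 1 * 1)) t₀ := by
      have h1 := (hasDerivAt_id t₀).sub_const t₀
      have h2 := ((h1.const_mul (-a)).add ((h1.pow 2).const_mul (-c))).const_add (v x₀ t₀)
      refine (h2.congr_of_eventuallyEq (Eventually.of_forall fun s => ?_)).congr_deriv ?_
      · simp [φ]; ring
      · simp
    rw [this.deriv]; simp
  have key := (hs x₀ (mem_univ _) t₀ ht).1 φ ?_ ?_ ?_ ?_
  · rw [hφ, gradient_quadratic, hessMat_quadratic, hφt, gradTerm_neg] at key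
    linarith
  · have k1 : ContDiff ℝ 2 (fun z : EucSp N × ℝ => z.1 - x₀) := by fun_prop
    have k2 : ContDiff ℝ 2 (fun z : EucSp N × ℝ => (-X) (z.1 - x₀)) := by fun_prop
    have k3 : ContDiff ℝ 2 (fun z : EucSp N × ℝ => z.2 - t₀) := by fun_prop
    exact ((((contDiff_const.add (contDiff_const.inner ℝ k1)).add
      ((k2.inner ℝ k1).div_const 2)).add (contDiff_const.mul k3)).add
      (k3.mul (contDiff_const.inner ℝ k1))).add (contDiff_const.mul (k3.pow 2))
  · have : ∀ᶠ z : EucSp N × ℝ in nhds (x₀, t₀), z.2 ∈ Ioo 0 T :=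
      continuous_snd.continuousAt.eventually (Ioo_mem_nhds ht.1 ht.2)
    filter_upwards [hle, this] with z hz hz2
    rw [lscEnv_eq hv hz2]
    simp only [φ, inner_neg_left, neg_apply]
    linarith
  · rw [lscEnv_eq hv ht]; simp [φ]
  · rw [hφ, gradient_quadratic]; exact neg_ne_zero.2 hp

/-- The consequences of being a subsolution used away from the doubling argument. -/
structure ParSub (T α Λ : ℝ) (g w : EucSp N → ℝ → ℝ) : Prop where
  usc : UpperSemicontinuousOn (fun p : EucSp N × ℝ => w p.1 p.2) (univ ×ˢ Ico 0 T)
  jet : ∀ x₀ : EucSp N, ∀ t₀ ∈ Ioo 0 T, ∀ p : EucSp N, p ≠ 0 → ∀ κ a c : ℝ, 0 ≤ κ →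
    (∀ᶠ z : EucSp N × ℝ in nhds (x₀, t₀), w z.1 z.2 ≤ w x₀ t₀ + ⟪p, z.1 - x₀⟫
      + κ / 2 * ‖z.1 - x₀‖ ^ 2 + a * (z.2 - t₀) + c * (z.2 - t₀) ^ 2) →
    a ≤ g x₀ t₀ + Λ * (‖p‖ ^ α * κ + ‖p‖ ^ (1 + α))
  time : ∀ x₀ : EucSp N, ∀ t₀, ∀ δ > 0, 0 < t₀ - δ → t₀ + δ < T → ∀ φ : ℝ → ℝ,
    ContDiff ℝ 2 φ → φ t₀ = 0 →
    (∀ t ∈ Ioo (t₀ - δ) (t₀ + δ), w x₀ t - φ t ≤ w x₀ t₀) →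
    (∀ᶠ x in nhds x₀, sSup ((fun t => w x t - φ t) '' Ioo (t₀ - δ) (t₀ + δ)) =
      sSup ((fun t => w x₀ t - φ t) '' Ioo (t₀ - δ) (t₀ + δ))) →
    deriv φ t₀ ≤ g x₀ t₀

theorem smul_id_form (c : ℝ) (v : EucSp N) :
    ⟪(c • ContinuousLinearMap.id ℝ (EucSp N)) v, v⟫ = c * ‖v‖ ^ 2 := by
  simp [real_inner_smul_left]

theorem IsSubSol.parSub {T H : ℝ} {h : EucSp N → ℝ → EucSp N} {g w : EucSp N → ℝ → ℝ}
    (h1 : H1 univ F α) (h2 : H2 univ F α a A) (hH0 : 0 ≤ H)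
    (hH : ∀ x, ∀ t ∈ Ioo 0 T, ‖h x t‖ ≤ H)
    (hw : UpperSemicontinuousOn (fun p : EucSp N × ℝ => w p.1 p.2) (univ ×ˢ Ico 0 T))
    (hs : IsSubSol univ T F h α g w) : ParSub T α (A * N + H) g w := by
  have hA : 0 ≤ A := h2.1.le.trans h2.2.1
  refine ⟨hw, fun x₀ t₀ ht p hp κ a c hκ hle => ?_, fun x₀ t₀ δ hδ hd0 hdT φ hφ h0 hle hc => ?_⟩
  · have := hs.jet hw (x₀ := x₀) ht (b := 0) (X := κ • ContinuousLinearMap.id ℝ _) (a := a) (c := c) hp ?_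
    · have e1 := h2.abs_form_le h1 x₀ hp (X := κ • ContinuousLinearMap.id ℝ _) (b := κ) fun v => by
        rw [smul_id_form, abs_of_nonneg (by positivity)]
      have e2 := abs_gradTerm_le (α := α) hp (hH x₀ t₀ ht)
      have e3 : 0 ≤ H * (‖p‖ ^ α * κ) + A * N * ‖p‖ ^ (1 + α) := by positivity
      nlinarith [abs_le.1 e1, abs_le.1 e2]
    · filter_upwards [hle] with z hz
      rw [smul_id_form]
      simp only [inner_zero_left]
      linarith
  · have hsub : Ioo (t₀ - δ) (t₀ + δ) ⊆ Ioo 0 T := Ioo_subset_Ioo hd0.le hdT.le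
    have ht : t₀ ∈ Ioo 0 T := ⟨by linarith, by linarith⟩
    have heq : ∀ x, (fun t => uscEnv w x t - φ t) '' Ioo (t₀ - δ) (t₀ + δ)
        = (fun t => w x t - φ t) '' Ioo (t₀ - δ) (t₀ + δ) := fun x =>
      image_congr fun t ht => by rw [uscEnv_eq hw (hsub ht)]
    refine (hs x₀ (mem_univ _) t₀ ht).2 δ hδ φ hφ h0 (fun t ht' => ?_) ?_
    · rw [uscEnv_eq hw ht, uscEnv_eq hw (hsub ht')]; exact hle t ht'
    · simpa only [heq] using hc

theorem IsSuperSol.parSub {T H : ℝ} {h : EucSp N → ℝ → EucSp N} {f v : EucSp N → ℝ → ℝ}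
    (h1 : H1 univ F α) (h2 : H2 univ F α a A) (hH0 : 0 ≤ H)
    (hH : ∀ x, ∀ t ∈ Ioo 0 T, ‖h x t‖ ≤ H)
    (hv : LowerSemicontinuousOn (fun p : EucSp N × ℝ => v p.1 p.2) (univ ×ˢ Ico 0 T))
    (hs : IsSuperSol univ T F h α f v) :
    ParSub T α (A * N + H) (fun x t => -f x t) (fun x t => -v x t) := by
  have hA : 0 ≤ A := h2.1.le.trans h2.2.1
  refine ⟨hv.neg, fun x₀ t₀ ht p hp κ a c hκ hle => ?_, fun x₀ t₀ δ hδ hd0 hdT φ hφ h0 hle hc => ?_⟩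
  · have := hs.jet hv (x₀ := x₀) ht (b := 0) (X := κ • ContinuousLinearMap.id ℝ _) (a := a) (c := c) hp ?_
    · have e1 := h2.abs_form_le h1 x₀ (neg_ne_zero.2 hp) (X := -(κ • ContinuousLinearMap.id ℝ _))
        (b := κ) fun v => by
        rw [neg_apply, inner_neg_left, smul_id_form, abs_neg, abs_of_nonneg (by positivity)]
      have e2 := abs_gradTerm_le (α := α) hp (hH x₀ t₀ ht)
      have e3 : 0 ≤ H * (‖p‖ ^ α * κ) + A * N * ‖p‖ ^ (1 + α) := by positivity
      rw [norm_neg] at e1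
      nlinarith [abs_le.1 e1, abs_le.1 e2]
    · filter_upwards [hle] with z hz
      rw [smul_id_form]
      simp only [inner_zero_left]
      linarith
  · have hsub : Ioo (t₀ - δ) (t₀ + δ) ⊆ Ioo 0 T := Ioo_subset_Ioo hd0.le hdT.le
    have ht : t₀ ∈ Ioo 0 T := ⟨by linarith, by linarith⟩
    have heq : ∀ x, sInf ((fun t => lscEnv v x t - -φ t) '' Ioo (t₀ - δ) (t₀ + δ))
        = -sSup ((fun t => -v x t - φ t) '' Ioo (t₀ - δ) (t₀ + δ)) := fun x => by
      rw [Real.sInf_def, ← image_neg_eq_neg, image_image]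
      congr 2
      refine image_congr fun t ht => ?_
      rw [lscEnv_eq hv (hsub ht)]; ring
    have key := (hs x₀ (mem_univ _) t₀ ht).2 δ hδ (fun t => -φ t) hφ.neg (by simp [h0])
      (fun t ht' => ?_) ?_
    · have e : deriv (fun t => -φ t) t₀ = -deriv φ t₀ := deriv.fun_neg
      rw [e] at key
      linarith
    · rw [lscEnv_eq hv ht, lscEnv_eq hv (hsub ht')]; linarith [hle t ht']
    · simp only [heq]
      filter_upwards [hc] with x hx
      rw [hx]

end Facts

section Powers

theorem nat_le_three_pow (n : ℕ) : (n : ℝ) ≤ 3 ^ n := by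
  exact_mod_cast (Nat.lt_pow_self (by norm_num : 1 < 3)).le

theorem add_pow_le_second_order (n : ℕ) {S d : ℝ} (hd : |d| ≤ S) :
    (S + d) ^ (n + 2) ≤ S ^ (n + 2) + (n + 2) * S ^ (n + 1) * d + 3 ^ (n + 2) * S ^ n * d ^ 2 := by
  have hS : 0 ≤ S := (abs_nonneg d).trans hd
  have h1 := abs_le.1 hd
  induction n with
  | zero => norm_num; nlinarith [sq_nonneg d]
  | succ n ih =>
    have h2 : (S + d) ^ (n + 1 + 2) = (S + d) ^ (n + 2) * (S + d) := pow_succ _ _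
    have h3 := mul_le_mul_of_nonneg_right ih (by linarith : 0 ≤ S + d)
    have h4 : 3 ^ (n + 2) * S ^ n * d ^ 2 * d ≤ 3 ^ (n + 2) * S ^ n * d ^ 2 * S :=
      mul_le_mul_of_nonneg_left h1.2 (by positivity)
    have h5 : ((n + 2 : ℕ) : ℝ) ≤ 3 ^ (n + 2) := nat_le_three_pow _
    have h6 := mul_le_mul_of_nonneg_right h5 (by positivity : 0 ≤ S ^ (n + 1) * d ^ 2)
    rw [h2]
    push_cast at *
    calc _ ≤ _ := h3
      _ ≤ _ := by
        ring_nf at h4 h6 ⊢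
        linarith

/-- The quadratic constant in the expansion of `‖z‖ ^ (2 * n + 4)`. -/
def powC (n : ℕ) : ℝ := (n + 2) + 9 * 3 ^ (n + 2)

theorem powC_pos (n : ℕ) : 0 < powC n := by unfold powC; positivity

theorem norm_add_pow_le {E : Type*} [NormedAddCommGroup E] [InnerProductSpace ℝ E] (n : ℕ)
    {z h : E} (hh : ‖h‖ ≤ ‖z‖ / 3) :
    ‖z + h‖ ^ (2 * n + 4) ≤ ‖z‖ ^ (2 * n + 4) + (2 * n + 4) * ‖z‖ ^ (2 * n + 2) * ⟪z, h⟫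
      + powC n * ‖z‖ ^ (2 * n + 2) * ‖h‖ ^ 2 := by
  have h1 : ‖z + h‖ ^ 2 = ‖z‖ ^ 2 + (2 * ⟪z, h⟫ + ‖h‖ ^ 2) := by
    rw [norm_add_sq_real]; ring
  have h2 := abs_real_inner_le_norm z h
  have hz := norm_nonneg z
  have hh0 := norm_nonneg h
  have h3 : |2 * ⟪z, h⟫ + ‖h‖ ^ 2| ≤ 3 * (‖z‖ * ‖h‖) := by
    have := abs_le.1 h2
    rw [abs_le]; constructor <;> nlinarith
  have h4 : |2 * ⟪z, h⟫ + ‖h‖ ^ 2| ≤ ‖z‖ ^ 2 := h3.trans (by nlinarith)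
  have h5 := add_pow_le_second_order n h4
  rw [← h1] at h5
  have h6 : (2 * ⟪z, h⟫ + ‖h‖ ^ 2) ^ 2 ≤ 9 * ‖z‖ ^ 2 * ‖h‖ ^ 2 := by
    calc _ = |2 * ⟪z, h⟫ + ‖h‖ ^ 2| ^ 2 := (sq_abs _).symm
      _ ≤ (3 * (‖z‖ * ‖h‖)) ^ 2 := by gcongr
      _ = _ := by ring
  have h7 : (3 : ℝ) ^ (n + 2) * (‖z‖ ^ 2) ^ n * (2 * ⟪z, h⟫ + ‖h‖ ^ 2) ^ 2
      ≤ 3 ^ (n + 2) * (‖z‖ ^ 2) ^ n * (9 * ‖z‖ ^ 2 * ‖h‖ ^ 2) := by gcongr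
  calc ‖z + h‖ ^ (2 * n + 4) = (‖z + h‖ ^ 2) ^ (n + 2) := by rw [← pow_mul]; congr 1
    _ ≤ _ := h5.trans (add_le_add_right h7 _)
    _ = _ := by unfold powC; ring

/-- `(a + b) ^ k ≤ 2 ^ k (a ^ k + b ^ k)`. -/
theorem add_pow_le_two_pow {a b : ℝ} (ha : 0 ≤ a) (hb : 0 ≤ b) (k : ℕ) :
    (a + b) ^ k ≤ 2 ^ k * (a ^ k + b ^ k) := by
  have h : a + b ≤ 2 * max a b := by
    have := le_max_left a b; have := le_max_right a b; linarith
  calc (a + b) ^ k ≤ (2 * max a b) ^ k := by gcongr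
    _ = 2 ^ k * max a b ^ k := mul_pow _ _ _
    _ ≤ _ := by
      gcongr
      rcases le_total a b with h | h
      · rw [max_eq_right h]; linarith [pow_nonneg ha k]
      · rw [max_eq_left h]; linarith [pow_nonneg hb k]

end Powers

section ZeroGradient

variable {T α Λ : ℝ} {g w : EucSp N → ℝ → ℝ}

/-- The constant in the power test. -/
def testC (n : ℕ) (α Λ : ℝ) : ℝ :=
  Λ * ((2 * n + 4 : ℝ) ^ α * (2 * powC n) + (2 * n + 4 : ℝ) ^ (1 + α))

theorem testC_nonneg (n : ℕ) (hΛ : 0 ≤ Λ) : 0 ≤ testC n α Λ := by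
  have := powC_pos n
  unfold testC; positivity

theorem ParSub.pow_jet (hs : ParSub T α Λ g w) (hΛ : 0 ≤ Λ) {n : ℕ}
    (hn : 2 ≤ (2 * n + 3) * (1 + α)) {x z : EucSp N} {t K a c : ℝ} (ht : t ∈ Ioo 0 T)
    (hK : 0 < K) (hx : x ≠ z) (hx1 : ‖x - z‖ ≤ 1)
    (hle : ∀ᶠ y : EucSp N × ℝ in nhds (x, t), w y.1 y.2 ≤ w x t
      + K * (‖y.1 - z‖ ^ (2 * n + 4) - ‖x - z‖ ^ (2 * n + 4)) + a * (y.2 - t)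
      + c * (y.2 - t) ^ 2) :
    a ≤ g x t + testC n α Λ * K ^ (1 + α) * ‖x - z‖ := by
  set d := ‖x - z‖ with hd
  have hd0 : 0 < d := norm_pos_iff.2 (sub_ne_zero.2 hx)
  have hpos : 0 < (2 * n + 4 : ℝ) * K * d ^ (2 * n + 2) := by positivity
  have hC := powC_pos n
  have key := hs.jet x t ht (((2 * n + 4) * K * d ^ (2 * n + 2)) • (x - z))
    (smul_ne_zero hpos.ne' (sub_ne_zero.2 hx)) (2 * powC n * K * d ^ (2 * n + 2)) a c
    (by positivity) ?_
  · refine key.trans (add_le_add_right ?_ _)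
    have hp : ‖((2 * n + 4 : ℝ) * K * d ^ (2 * n + 2)) • (x - z)‖
        = (2 * n + 4) * K * d ^ (2 * n + 3) := by
      rw [norm_smul, ← hd, Real.norm_of_nonneg hpos.le]; ring
    rw [hp]
    have hα1 : 0 < 1 + α := by
      by_contra hcon
      have : (2 * (n : ℝ) + 3) * (1 + α) ≤ 0 :=
        mul_nonpos_of_nonneg_of_nonpos (by positivity) (by linarith)
      linarith
    have e1 : ((2 * n + 4) * K * d ^ (2 * n + 3) : ℝ) ^ (1 + α)
        = (2 * n + 4 : ℝ) ^ (1 + α) * K ^ (1 + α) * d ^ ((2 * n + 3) * (1 + α)) := by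
      rw [Real.mul_rpow (by positivity) (by positivity), Real.mul_rpow (by positivity) hK.le,
        ← Real.rpow_natCast d, ← Real.rpow_mul hd0.le]
      push_cast; ring
    have e2 : ((2 * n + 4) * K * d ^ (2 * n + 3) : ℝ) ^ α * (2 * powC n * K * d ^ (2 * n + 2))
        = (2 * n + 4 : ℝ) ^ α * (2 * powC n) * K ^ (1 + α)
          * d ^ ((2 * n + 3) * (1 + α) - 1) := by
      rw [Real.mul_rpow (by positivity) (by positivity), Real.mul_rpow (by positivity) hK.le,
        ← Real.rpow_natCast d, ← Real.rpow_natCast d, ← Real.rpow_mul hd0.le,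
        Real.rpow_add hK 1 α, Real.rpow_one]
      have : d ^ ((2 * n + 3 : ℝ) * (1 + α) - 1)
          = d ^ (((2 * n + 3 : ℕ) : ℝ) * α) * d ^ (((2 * n + 2 : ℕ)) : ℝ) := by
        rw [← Real.rpow_add hd0]; push_cast; ring_nf
      rw [this]; ring
    have b1 : d ^ ((2 * n + 3 : ℝ) * (1 + α)) ≤ d := by
      calc _ ≤ d ^ (1 : ℝ) := Real.rpow_le_rpow_of_exponent_ge hd0 hx1 (by linarith)
        _ = d := Real.rpow_one d
    have b2 : d ^ ((2 * n + 3 : ℝ) * (1 + α) - 1) ≤ d := by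
      calc _ ≤ d ^ (1 : ℝ) := Real.rpow_le_rpow_of_exponent_ge hd0 hx1 (by linarith)
        _ = d := Real.rpow_one d
    rw [e1, e2]
    calc Λ * ((2 * n + 4 : ℝ) ^ α * (2 * powC n) * K ^ (1 + α) * d ^ ((2 * n + 3 : ℝ) * (1 + α) - 1)
          + (2 * n + 4 : ℝ) ^ (1 + α) * K ^ (1 + α) * d ^ ((2 * n + 3 : ℝ) * (1 + α)))
        ≤ Λ * ((2 * n + 4 : ℝ) ^ α * (2 * powC n) * K ^ (1 + α) * d
          + (2 * n + 4 : ℝ) ^ (1 + α) * K ^ (1 + α) * d) := by gcongr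
      _ = _ := by unfold testC; ring
  · have hnear : ∀ᶠ y : EucSp N × ℝ in nhds (x, t), ‖y.1 - x‖ ≤ d / 3 := by
      have hc : Tendsto (fun y : EucSp N × ℝ => ‖y.1 - x‖) (nhds (x, t)) (nhds ‖x - x‖) :=
        (continuous_fst.sub continuous_const).norm.continuousAt
      rw [sub_self, norm_zero] at hc
      exact hc.eventually (Iic_mem_nhds (by positivity))
    filter_upwards [hle, hnear] with y hy hy2
    have h1 := norm_add_pow_le n (z := x - z) (h := y.1 - x) hy2
    rw [show x - z + (y.1 - x) = y.1 - z by abel, ← hd] at h1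
    have h2 := mul_le_mul_of_nonneg_left h1 hK.le
    rw [real_inner_smul_left]
    linarith

end ZeroGradient

section Key

variable {T α Λ : ℝ} {g w : EucSp N → ℝ → ℝ}

theorem eventuallyConst_of_power_le {E : Type*} [NormedAddCommGroup E] [NormedSpace ℝ E]
    {M : E → ℝ} {x₀ : E} {ε K : ℝ} (hε : 0 < ε) {k : ℕ}
    (h : ∀ y ∈ ball x₀ ε, ∀ z ∈ ball x₀ ε, M y ≤ M z + K * ‖y - z‖ ^ (k + 2)) :
    ∀ z ∈ ball x₀ ε, M z = M x₀ := by
  have hd : ∀ z ∈ ball x₀ ε, HasFDerivAt M (0 : E →L[ℝ] ℝ) z := fun z hz => by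
    have : (fun y => M y - M z) =O[nhds z] fun y => ‖y - z‖ ^ (k + 2) := by
      refine Asymptotics.IsBigO.of_bound K ?_
      filter_upwards [isOpen_ball.mem_nhds hz] with y hy
      rw [Real.norm_eq_abs, norm_pow, norm_norm, abs_le]
      have h1 := h y hy z hz
      have h2 := h z hz y hy
      rw [norm_sub_rev] at h2
      constructor <;> linarith
    rw [hasFDerivAt_iff_isLittleO]
    simp only [zero_apply, sub_zero]
    refine this.trans_isLittleO ?_
    exact Asymptotics.isLittleO_norm_left.1 (Asymptotics.isLittleO_pow_sub_sub z (by omega)).norm_left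
  intro z hz
  exact isOpen_ball.is_const_of_fderiv_eq_zero (convex_ball x₀ ε).isPreconnected
    (fun y hy => (hd y hy).differentiableAt.differentiableWithinAt)
    (fun y hy => (hd y hy).fderiv) hz (mem_ball_self hε)

theorem ParSub.key (hs : ParSub T α Λ g w) (hΛ : 0 ≤ Λ) {n : ℕ}
    (hn : 2 ≤ (2 * n + 3) * (1 + α)) {x₀ : EucSp N} {t₀ K a b : ℝ} (ht : t₀ ∈ Ioo 0 T)
    (hg : ContinuousAt (fun p : EucSp N × ℝ => g p.1 p.2) (x₀, t₀)) (hK : 0 < K)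
    (hle : ∀ᶠ y : EucSp N × ℝ in nhds (x₀, t₀), w y.1 y.2 ≤ w x₀ t₀
      + K * ‖y.1 - x₀‖ ^ (2 * n + 4) + a * (y.2 - t₀) + b * (y.2 - t₀) ^ 2) :
    a ≤ g x₀ t₀ := by
  by_contra! hlt
  have hT : ∀ᶠ y : EucSp N × ℝ in nhds (x₀, t₀), y.2 ∈ Ioo 0 T :=
    continuous_snd.continuousAt.eventually (Ioo_mem_nhds ht.1 ht.2)
  obtain ⟨r', hr', hr'2⟩ := Metric.eventually_nhds_iff.1 (hle.and hT)
  obtain ⟨r, hr, hrr', hr1⟩ : ∃ r : ℝ, 0 < r ∧ r < r' ∧ r ≤ 1 :=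
    ⟨min (r' / 2) 1, by positivity, (min_le_left _ _).trans_lt (by linarith), min_le_right _ _⟩
  have hbox : ∀ x ∈ closedBall x₀ r, ∀ t ∈ Icc (t₀ - r) (t₀ + r), (w x t ≤ w x₀ t₀
      + K * ‖x - x₀‖ ^ (2 * n + 4) + a * (t - t₀) + b * (t - t₀) ^ 2) ∧ t ∈ Ioo 0 T := by
    intro x hx t ht'
    refine hr'2 (y := (x, t)) ?_
    rw [Prod.dist_eq]
    refine max_lt (lt_of_le_of_lt hx hrr') (lt_of_le_of_lt ?_ hrr')
    rw [Real.dist_eq, abs_le]; constructor <;> linarith [ht'.1, ht'.2]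
  set φ : ℝ → ℝ := fun t => a * (t - t₀) + (b + 1) * (t - t₀) ^ 2 with hφ
  have hψ : ∀ x ∈ closedBall x₀ r, ∀ t ∈ Icc (t₀ - r) (t₀ + r), w x t - φ t ≤ w x₀ t₀
      + K * ‖x - x₀‖ ^ (2 * n + 4) - (t - t₀) ^ 2 := fun x hx t ht' => by
    have := (hbox x hx t ht').1; simp only [hφ]; linarith
  have h0T : 0 < t₀ - r := (hbox x₀ (mem_closedBall_self hr.le) (t₀ - r)
    ⟨le_rfl, by linarith⟩).2.1
  have hTT : t₀ + r < T := (hbox x₀ (mem_closedBall_self hr.le) (t₀ + r)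
    ⟨by linarith, le_rfl⟩).2.2
  set I := Ioo (t₀ - r) (t₀ + r) with hI
  have hIc : I ⊆ Icc (t₀ - r) (t₀ + r) := Ioo_subset_Icc_self
  set M : EucSp N → ℝ := fun x => sSup ((fun t => w x t - φ t) '' I) with hM
  have hbdd : ∀ x ∈ closedBall x₀ r, BddAbove ((fun t => w x t - φ t) '' I) := fun x hx =>
    ⟨w x₀ t₀ + K * ‖x - x₀‖ ^ (2 * n + 4), by
      rintro _ ⟨t, ht', rfl⟩
      have := hψ x hx t (hIc ht')
      nlinarith [sq_nonneg (t - t₀)]⟩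
  have ht₀I : t₀ ∈ I := ⟨by linarith, by linarith⟩
  by_cases hconst : ∀ᶠ x in nhds x₀, M x = M x₀
  · have := hs.time x₀ t₀ r hr h0T hTT φ (by fun_prop) (by simp [hφ]) (fun t ht' => ?_) hconst
    · have e : deriv φ t₀ = a := by
        have h1 := (hasDerivAt_id t₀).sub_const t₀
        have h2 := (h1.const_mul a).add ((h1.pow 2).const_mul (b + 1))
        have h3 : HasDerivAt φ a t₀ := by
          refine (h2.congr_of_eventuallyEq (Eventually.of_forall fun s => ?_)).congr_deriv ?_
          · simp [hφ]
          · simp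
        exact h3.deriv
      linarith
    · have := hψ x₀ (mem_closedBall_self hr.le) t (hIc ht')
      simp only [sub_self, norm_zero] at this
      rw [zero_pow (by omega)] at this
      nlinarith [sq_nonneg (t - t₀)]
  set K' := 2 ^ (2 * n + 4) * K + 1 with hK'
  have hK'pos : 0 < K' := by positivity
  -- a scale on which the equation contradicts the touching
  obtain ⟨ρ, hρ, hρr, hρg⟩ : ∃ ρ : ℝ, 0 < ρ ∧ ρ ≤ r ∧ ∀ x t d, ‖x - x₀‖ < ρ → |t - t₀| < ρ →
      |d| < ρ → g x t + testC n α Λ * K' ^ (1 + α) * d < a + 2 * (b + 1) * (t - t₀) := by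
    have hc : ContinuousAt (fun p : (EucSp N × ℝ) × ℝ => g p.1.1 p.1.2
        + testC n α Λ * K' ^ (1 + α) * p.2 - (a + 2 * (b + 1) * (p.1.2 - t₀))) ((x₀, t₀), 0) := by
      have hg' : ContinuousAt (fun p : (EucSp N × ℝ) × ℝ => g p.1.1 p.1.2) ((x₀, t₀), 0) :=
        ContinuousAt.comp (f := Prod.fst) (x := ((x₀, t₀), (0 : ℝ))) hg continuousAt_fst
      exact (hg'.add (by fun_prop)).sub (by fun_prop)
    have : ∀ᶠ p : (EucSp N × ℝ) × ℝ in nhds ((x₀, t₀), 0), g p.1.1 p.1.2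
        + testC n α Λ * K' ^ (1 + α) * p.2 - (a + 2 * (b + 1) * (p.1.2 - t₀)) < 0 := by
      refine hc.eventually (Iio_mem_nhds ?_)
      simp only [mul_zero, sub_self, add_zero]; linarith
    obtain ⟨ρ, hρ, h⟩ := Metric.eventually_nhds_iff.1 this
    refine ⟨min ρ r, by positivity, min_le_right _ _, fun x t d hx ht' hd => ?_⟩
    have := h (y := ((x, t), d)) ?_
    · simp only at this; linarith
    · rw [Prod.dist_eq, Prod.dist_eq]
      refine max_lt (max_lt ?_ ?_) ?_
      · rw [dist_eq_norm]; exact hx.trans_le (min_le_left _ _)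
      · rw [Real.dist_eq]; exact ht'.trans_le (min_le_left _ _)
      · rw [Real.dist_eq, sub_zero]; exact hd.trans_le (min_le_left _ _)
  obtain ⟨ε, hε, hερ, hε2⟩ : ∃ ε : ℝ, 0 < ε ∧ ε ≤ ρ / 2 ∧
      (2 ^ (2 * n + 4) * K + K') * ε ^ (2 * n + 4) < (ρ / 2) ^ (2 * n + 4) := by
    have hc : Continuous fun ε : ℝ => (2 ^ (2 * n + 4) * K + K') * ε ^ (2 * n + 4) := by fun_prop
    have : ∀ᶠ ε in nhds (0 : ℝ),
        (2 ^ (2 * n + 4) * K + K') * ε ^ (2 * n + 4) < (ρ / 2) ^ (2 * n + 4) := by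
      refine hc.continuousAt.eventually (Iio_mem_nhds ?_)
      beta_reduce
      rw [zero_pow (by omega), mul_zero]; positivity
    obtain ⟨δ, hδ, h⟩ := Metric.eventually_nhds_iff.1 this
    refine ⟨min (δ / 2) (ρ / 2), by positivity, min_le_right _ _, h ?_⟩
    rw [Real.dist_eq, sub_zero, abs_of_pos (by positivity)]
    exact (min_le_left _ _).trans_lt (by linarith)
  obtain ⟨y, hy, z, hz, hyz⟩ : ∃ y ∈ ball x₀ ε, ∃ z ∈ ball x₀ ε,
      M z + K' * ‖y - z‖ ^ (2 * n + 4) < M y := by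
    by_contra! hcon
    exact hconst (eventually_of_mem (ball_mem_nhds x₀ hε)
      (eventuallyConst_of_power_le hε (k := 2 * n + 2) hcon))
  have hεr : ε < r := by linarith
  have hyr : y ∈ closedBall x₀ r := ball_subset_closedBall (ball_subset_ball hεr.le hy)
  have hzr : z ∈ closedBall x₀ r := ball_subset_closedBall (ball_subset_ball hεr.le hz)
  obtain ⟨_, ⟨s, hs', rfl⟩, hys⟩ := exists_lt_of_lt_csSup ((nonempty_Ioo.2 (by linarith)).image _) hyz
  have husc : UpperSemicontinuousOn (fun p : EucSp N × ℝ => w p.1 p.2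
      + -(φ p.2 + K' * ‖p.1 - z‖ ^ (2 * n + 4))) (closedBall x₀ r ×ˢ Icc (t₀ - r) (t₀ + r)) := by
    refine (hs.usc.mono ?_).add ((Continuous.upperSemicontinuous ?_).upperSemicontinuousOn _)
    · exact prod_mono (subset_univ _) fun t ht' => ⟨by linarith [ht'.1], by linarith [ht'.2]⟩
    · simp only [hφ]; fun_prop
  obtain ⟨⟨x', t'⟩, hx', hmax⟩ := husc.exists_isMaxOn
    (show (closedBall x₀ r ×ˢ Icc (t₀ - r) (t₀ + r)).Nonempty from
      ⟨(x₀, t₀), mem_closedBall_self hr.le, hIc ht₀I⟩)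
    ((isCompact_closedBall x₀ r).prod isCompact_Icc)
  have hmax := isMaxOn_iff.1 hmax
  have m1 := hmax (y, s) ⟨hyr, hIc hs'⟩
  have m2 := hmax (x₀, t₀) ⟨mem_closedBall_self hr.le, hIc ht₀I⟩
  have m3 := hψ x' hx'.1 t' hx'.2
  have e0 : φ t₀ = 0 := by simp [hφ]
  have hzn : ‖x₀ - z‖ ≤ ε := by rw [← dist_eq_norm, dist_comm]; exact (mem_ball.1 hz).le
  have hp1 : ‖x₀ - z‖ ^ (2 * n + 4) ≤ ε ^ (2 * n + 4) := by gcongr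
  have hp2 : ‖x' - x₀‖ ^ (2 * n + 4) ≤ 2 ^ (2 * n + 4) * (‖x' - z‖ ^ (2 * n + 4)
      + ε ^ (2 * n + 4)) := by
    calc ‖x' - x₀‖ ^ (2 * n + 4) ≤ (‖x' - z‖ + ε) ^ (2 * n + 4) := by
          gcongr
          calc ‖x' - x₀‖ = ‖(x' - z) - (x₀ - z)‖ := by congr 1; abel
            _ ≤ ‖x' - z‖ + ‖x₀ - z‖ := norm_sub_le _ _
            _ ≤ _ := by gcongr
      _ ≤ _ := add_pow_le_two_pow (norm_nonneg _) hε.le _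
  have hsmall : (t' - t₀) ^ 2 + ‖x' - z‖ ^ (2 * n + 4) < (ρ / 2) ^ (2 * n + 4) := by
    have a1 := mul_le_mul_of_nonneg_left hp1 hK'pos.le
    have a2 := mul_le_mul_of_nonneg_left hp2 hK.le
    simp only [e0, zero_add] at m2
    have a3 : K' * ‖x' - z‖ ^ (2 * n + 4) = 2 ^ (2 * n + 4) * K * ‖x' - z‖ ^ (2 * n + 4)
      + ‖x' - z‖ ^ (2 * n + 4) := by rw [hK']; ring
    linarith
  have hd : ‖x' - z‖ < ρ / 2 := by
    refine lt_of_pow_lt_pow_left₀ (2 * n + 4) (by positivity) ?_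
    nlinarith [sq_nonneg (t' - t₀)]
  have htt : |t' - t₀| < ρ / 2 := by
    refine abs_lt_of_sq_lt_sq ?_ (by positivity)
    have : (ρ / 2) ^ (2 * n + 4) ≤ (ρ / 2) ^ 2 :=
      pow_le_pow_of_le_one (by positivity) (by linarith) (by omega)
    have : 0 ≤ ‖x' - z‖ ^ (2 * n + 4) := by positivity
    linarith
  have hxx : ‖x' - x₀‖ < ρ := by
    calc ‖x' - x₀‖ = ‖(x' - z) - (x₀ - z)‖ := by congr 1; abel
      _ ≤ ‖x' - z‖ + ‖x₀ - z‖ := norm_sub_le _ _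
      _ < ρ := by linarith
  have htI : t' ∈ I := ⟨by linarith [(abs_lt.1 htt).1], by linarith [(abs_lt.1 htt).2]⟩
  have hne : x' ≠ z := by
    rintro rfl
    have h1 : w x' t' - φ t' ≤ M x' := le_csSup (hbdd x' hx'.1) ⟨t', htI, rfl⟩
    simp only [sub_self, norm_zero] at m1
    rw [zero_pow (by omega), mul_zero] at m1
    linarith
  have hev : ∀ᶠ p : EucSp N × ℝ in nhds (x', t'),
      p ∈ closedBall x₀ r ×ˢ Icc (t₀ - r) (t₀ + r) := by
    refine prod_mem_nhds (closedBall_mem_nhds_of_mem ?_) (Icc_mem_nhds htI.1 htI.2)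
    rw [mem_ball, dist_eq_norm]; linarith
  have hjet := hs.pow_jet hΛ hn (hbox x' hx'.1 t' hx'.2).2 hK'pos hne (by linarith)
    (a := a + 2 * (b + 1) * (t' - t₀)) (c := b + 1) ?_
  · have := hρg x' t' ‖x' - z‖ hxx (by linarith) (by rw [abs_norm]; linarith)
    linarith
  · filter_upwards [hev] with p hp
    have := hmax p hp
    simp only [hφ] at this
    linarith

theorem ParSub.pow_test (hs : ParSub T α Λ g w) (hΛ : 0 ≤ Λ) {n : ℕ}
    (hn : 2 ≤ (2 * n + 3) * (1 + α)) {x z : EucSp N} {t K a c : ℝ} (ht : t ∈ Ioo 0 T)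
    (hg : ContinuousAt (fun p : EucSp N × ℝ => g p.1 p.2) (x, t))
    (hK : 0 < K) (hx1 : ‖x - z‖ ≤ 1)
    (hle : ∀ᶠ y : EucSp N × ℝ in nhds (x, t), w y.1 y.2 ≤ w x t
      + K * (‖y.1 - z‖ ^ (2 * n + 4) - ‖x - z‖ ^ (2 * n + 4)) + a * (y.2 - t)
      + c * (y.2 - t) ^ 2) :
    a ≤ g x t + testC n α Λ * K ^ (1 + α) := by
  have hC := testC_nonneg (α := α) n hΛ
  have hKp : 0 ≤ K ^ (1 + α) := by positivity
  by_cases hx : x = z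
  · subst hx
    have := hs.key hΛ hn ht hg hK (a := a) (b := c) (by simpa using hle)
    have := mul_nonneg hC hKp
    linarith
  · refine (hs.pow_jet hΛ hn ht hK hx hx1 hle).trans ?_
    have := mul_le_mul_of_nonneg_left hx1 (mul_nonneg hC hKp)
    linarith

end Key

section Barrier

/-- A smooth penalisation of the times after `τ`. -/
def timePen (τ C t : ℝ) : ℝ := C * max (t - τ) 0 ^ 2

theorem timePen_nonneg {τ C : ℝ} (hC : 0 ≤ C) (t : ℝ) : 0 ≤ timePen τ C t := by
  unfold timePen; positivity

theorem timePen_of_le {τ C t : ℝ} (ht : t ≤ τ) : timePen τ C t = 0 := by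
  simp [timePen, max_eq_right (sub_nonpos.2 ht)]

theorem continuous_timePen (τ C : ℝ) : Continuous (timePen τ C) := by
  unfold timePen; fun_prop

theorem timePen_le {τ C : ℝ} (hC : 0 ≤ C) (t s : ℝ) :
    timePen τ C t ≤ timePen τ C s + 2 * C * max (s - τ) 0 * (t - s) + C * (t - s) ^ 2 := by
  have h : max (t - τ) 0 ^ 2 ≤ (max (s - τ) 0 + (t - s)) ^ 2 := by
    rcases le_total (t - τ) 0 with h | h
    · rw [max_eq_right h, zero_pow two_ne_zero]; positivity
    · rw [max_eq_left h]
      have := le_max_left (s - τ) 0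
      exact pow_le_pow_left₀ h (by linarith) 2
  unfold timePen
  nlinarith [mul_le_mul_of_nonneg_left h hC]

theorem exists_power_dominates (c : ℝ) {γ ε : ℝ} (hγ : 0 < γ) (hε : 0 < ε) (k : ℕ) :
    ∃ K > 0, ∀ d ∈ Icc (0 : ℝ) 1, c * d ^ γ ≤ ε + K * d ^ k := by
  have hc : ContinuousAt (fun d : ℝ => c * d ^ γ) 0 :=
    continuousAt_const.mul (Real.continuousAt_rpow_const _ _ (Or.inr hγ.le))
  have : ∀ᶠ d in nhds (0 : ℝ), c * d ^ γ < ε := by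
    refine hc.eventually (Iio_mem_nhds ?_)
    beta_reduce
    rw [Real.zero_rpow hγ.ne', mul_zero]; exact hε
  obtain ⟨ρ, hρ, h⟩ := Metric.eventually_nhds_iff.1 this
  refine ⟨(|c| + 1) / ρ ^ k, by positivity, fun d hd => ?_⟩
  rcases lt_or_ge d ρ with hdρ | hdρ
  · have h1 := h (y := d) (by rwa [Real.dist_eq, sub_zero, abs_of_nonneg hd.1])
    have : 0 ≤ (|c| + 1) / ρ ^ k * d ^ k := mul_nonneg (by positivity) (pow_nonneg hd.1 k)
    linarith
  · have h1 : c * d ^ γ ≤ |c| := by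
      calc c * d ^ γ ≤ |c| * d ^ γ := by
            gcongr
            · exact Real.rpow_nonneg hd.1 _
            · exact le_abs_self c
        _ ≤ |c| * 1 := by
            gcongr
            exact Real.rpow_le_one hd.1 hd.2 hγ.le
        _ = |c| := mul_one _
    have h2 : |c| + 1 ≤ (|c| + 1) / ρ ^ k * d ^ k := by
      rw [div_mul_eq_mul_div, le_div_iff₀ (by positivity)]
      gcongr
    linarith

variable {T α Λ : ℝ} {g w : EucSp N → ℝ → ℝ}

theorem ParSub.barrier (hs : ParSub T α Λ g w) (hΛ : 0 ≤ Λ) {n : ℕ}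
    (hn : 2 ≤ (2 * n + 3) * (1 + α))
    (hg : ∀ x, ∀ t ∈ Ioo 0 T, ContinuousAt (fun p : EucSp N × ℝ => g p.1 p.2) (x, t)) {Mg B c γ : ℝ}
    (hgM : ∀ x, ∀ t ∈ Ioo 0 T, g x t ≤ Mg) (hB : ∀ x, ∀ t ∈ Ico 0 T, w x t ≤ B)
    (h0B : ∀ x, -B ≤ w x 0) (hγ : 0 < γ) (hol : ∀ x y, w x 0 ≤ w y 0 + c * ‖x - y‖ ^ γ)
    {ε : ℝ} (hε : 0 < ε) :
    ∃ L, 0 ≤ L ∧ ∀ x, ∀ t ∈ Ioo 0 T, w x t ≤ w x 0 + ε + L * t := by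
  obtain ⟨K₀, hK₀, hdom⟩ := exists_power_dominates c hγ hε (2 * n + 4)
  set K := max K₀ (2 * B) with hKdef
  have hK : 0 < K := hK₀.trans_le (le_max_left _ _)
  have hCn := testC_nonneg (α := α) n hΛ
  have hKp : 0 ≤ K ^ (1 + α) := by positivity
  refine ⟨|Mg| + testC n α Λ * K ^ (1 + α) + 1, by positivity, fun z t₁ ht₁ => ?_⟩
  set L := |Mg| + testC n α Λ * K ^ (1 + α) + 1 with hL
  have hLpos : 0 < L := by positivity
  by_contra! hlt
  obtain ⟨T₂, h12, h2T⟩ := exists_between ht₁.2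
  have h02 : 0 < T₂ := ht₁.1.trans h12
  set Cθ := |2 * B| / (T₂ - t₁) ^ 2 with hCθ
  have h21 : 0 < T₂ - t₁ := sub_pos.2 h12
  have hCθ0 : 0 ≤ Cθ := by positivity
  have husc : UpperSemicontinuousOn (fun p : EucSp N × ℝ => w p.1 p.2
      + -(K * ‖p.1 - z‖ ^ (2 * n + 4) + L * p.2 + timePen t₁ Cθ p.2))
      (closedBall z 1 ×ˢ Icc 0 T₂) := by
    refine (hs.usc.mono ?_).add ((Continuous.upperSemicontinuous ?_).upperSemicontinuousOn _)
    · exact prod_mono (subset_univ _) fun t ht' => ⟨ht'.1, ht'.2.trans_lt h2T⟩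
    · have := continuous_timePen t₁ Cθ
      fun_prop
  have hzmem : (z, t₁) ∈ closedBall z 1 ×ˢ Icc 0 T₂ :=
    ⟨mem_closedBall_self zero_le_one, ht₁.1.le, h12.le⟩
  obtain ⟨⟨x', t'⟩, hx', hmax⟩ := husc.exists_isMaxOn
    (show (closedBall z 1 ×ˢ Icc 0 T₂).Nonempty from ⟨_, hzmem⟩)
    ((isCompact_closedBall z 1).prod isCompact_Icc)
  have hmax := isMaxOn_iff.1 hmax
  have m1 := hmax _ hzmem
  simp only [sub_self, norm_zero, timePen_of_le le_rfl] at m1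
  rw [zero_pow (by omega)] at m1
  have hd1 : ‖x' - z‖ ≤ 1 := by rw [← dist_eq_norm]; exact hx'.1
  have hp0 := timePen_nonneg (τ := t₁) hCθ0 t'
  have hwB := hB x' t' ⟨hx'.2.1, hx'.2.2.trans_lt h2T⟩
  have hz0 := h0B z
  have hKn : 0 ≤ K * ‖x' - z‖ ^ (2 * n + 4) := by positivity
  have hLt : 0 ≤ L * t' := mul_nonneg hLpos.le hx'.2.1
  have ht'0 : 0 < t' := by
    rcases hx'.2.1.lt_or_eq with h | h
    · exact h
    · exfalso
      simp only at h
      rw [← h] at m1 hp0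
      have a1 := hol x' z
      have a2 := hdom ‖x' - z‖ ⟨norm_nonneg _, hd1⟩
      have a3 : K₀ * ‖x' - z‖ ^ (2 * n + 4) ≤ K * ‖x' - z‖ ^ (2 * n + 4) := by
        gcongr; exact le_max_left _ _
      linarith
  have ht'2 : t' < T₂ := by
    rcases hx'.2.2.lt_or_eq with h | h
    · exact h
    · exfalso
      simp only at h
      have : timePen t₁ Cθ t' = |2 * B| := by
        rw [h, timePen, max_eq_left h21.le, hCθ, div_mul_cancel₀]
        positivity
      have := le_abs_self (2 * B)
      linarith
  have hdlt : ‖x' - z‖ < 1 := by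
    rcases hd1.lt_or_eq with h | h
    · exact h
    · exfalso
      rw [h, one_pow] at m1
      have := le_max_right K₀ (2 * B)
      linarith
  have hev : ∀ᶠ p : EucSp N × ℝ in nhds (x', t'), p ∈ closedBall z 1 ×ˢ Icc 0 T₂ := by
    refine prod_mem_nhds (closedBall_mem_nhds_of_mem ?_) (Icc_mem_nhds ht'0 ht'2)
    rw [mem_ball, dist_eq_norm]; exact hdlt
  have ht'T : t' ∈ Ioo 0 T := ⟨ht'0, ht'2.trans h2T⟩
  have key := hs.pow_test hΛ hn ht'T (hg x' t' ht'T) hK hd1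
    (a := L + 2 * Cθ * max (t' - t₁) 0) (c := Cθ) ?_
  · have a1 := hgM x' t' ht'T
    have a2 := le_abs_self Mg
    have a3 : 0 ≤ 2 * Cθ * max (t' - t₁) 0 := by positivity
    linarith
  · filter_upwards [hev] with p hp
    have a1 := hmax p hp
    have a2 := timePen_le (τ := t₁) hCθ0 p.2 t'
    simp only at a1
    linarith

end Barrier

section Selection

/-- `p` maximises `Ψ` over `D` up to `ε`. -/
def NearMax {β : Type*} (Ψ : β → ℝ) (D : Set β) (ε : ℝ) (p : β) : Prop :=
  p ∈ D ∧ ∀ p' ∈ D, Ψ p' ≤ Ψ p + ε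

theorem exists_nearMax {β : Type*} {Ψ : β → ℝ} {D : Set β} (hD : D.Nonempty)
    (hb : BddAbove (Ψ '' D)) {ε : ℝ} (hε : 0 < ε) :
    ∃ p, NearMax Ψ D ε p ∧ sSup (Ψ '' D) ≤ Ψ p + ε := by
  obtain ⟨_, ⟨p, hp, rfl⟩, h⟩ := exists_lt_of_lt_csSup (hD.image Ψ) (sub_lt_self _ hε)
  exact ⟨p, ⟨hp, fun p' hp' => by linarith [le_csSup hb ⟨p', hp', rfl⟩]⟩, by linarith⟩

variable {E : Type*} [NormedAddCommGroup E]

/-- The doubled functional. -/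
def dbl (q : ℕ) (U V : E → ℝ → ℝ) (j k : ℝ) (ζ : E) (p : (E × ℝ) × (E × ℝ)) : ℝ :=
  U p.1.1 p.1.2 + V p.2.1 p.2.2 - j * ‖p.1.1 - p.2.1 - ζ‖ ^ q - k * (p.1.2 - p.2.2) ^ 2

/-- Pairs of points with times in `I`. -/
def dblDom (E : Type*) (I : Set ℝ) : Set ((E × ℝ) × (E × ℝ)) := (univ ×ˢ I) ×ˢ (univ ×ˢ I)

theorem mem_dblDom {I : Set ℝ} {p : (E × ℝ) × (E × ℝ)} :
    p ∈ dblDom E I ↔ p.1.2 ∈ I ∧ p.2.2 ∈ I := by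
  simp [dblDom]

theorem exists_sub_le_of_antitone {S : ℕ → ℝ} (hS : Antitone S) (hb : BddBelow (range S)) {ε : ℝ}
    (hε : 0 < ε) : ∃ i, S i - S (i + 1) ≤ ε := by
  have h := tendsto_atTop_ciInf hS hb
  have h2 := h.sub (h.comp (tendsto_add_atTop_nat 1))
  rw [sub_self] at h2
  obtain ⟨i, hi⟩ := (h2.eventually (Iio_mem_nhds hε)).exists
  exact ⟨i, le_of_lt hi⟩

theorem exists_good_parameters [ProperSpace E] {q : ℕ} (hq : q ≠ 0) {U V : E → ℝ → ℝ} {I : Set ℝ}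
    {B σ ε : ℝ} (hub : ∀ x, ∀ t ∈ I, ∀ y, ∀ s ∈ I, U x t + V y s ≤ B) (hσ : 0 < σ)
    (hbase : ∃ x, ∃ t ∈ I, 4 * σ ≤ U x t + V x t) (hε : 0 < ε) (κ : ℝ → ℝ) :
    ∃ j k ρ ε₁ : ℝ, 1 ≤ j ∧ κ j ≤ k ∧ 0 < k ∧ 0 < ρ ∧ 0 < ε₁ ∧ ∀ ζ : E, ‖ζ‖ < ρ → ∀ p,
      NearMax (dbl q U V j k ζ) (dblDom E I) ε₁ p →
      j * ‖p.1.1 - p.2.1 - ζ‖ ^ q ≤ ε ∧ 2 * σ ≤ U p.1.1 p.1.2 + V p.2.1 p.2.2 ∧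
        k * (p.1.2 - p.2.2) ^ 2 ≤ B := by
  obtain ⟨xb, tb, htb, hb4⟩ := hbase
  have hB : 0 < B := by have := hub xb tb htb xb tb htb; linarith
  have hD : (dblDom E I).Nonempty := ⟨((xb, tb), (xb, tb)), mem_dblDom.2 ⟨htb, htb⟩⟩
  have hbdd : ∀ j k : ℝ, 0 ≤ j → 0 ≤ k → ∀ ζ : E, BddAbove (dbl q U V j k ζ '' dblDom E I) :=
    fun j k hj hk ζ => ⟨B, by
      rintro _ ⟨p, hp, rfl⟩
      obtain ⟨h1, h2⟩ := mem_dblDom.1 hp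
      have := hub p.1.1 _ h1 p.2.1 _ h2
      have a1 : 0 ≤ j * ‖p.1.1 - p.2.1 - ζ‖ ^ q := by positivity
      have a2 : 0 ≤ k * (p.1.2 - p.2.2) ^ 2 := by positivity
      unfold dbl; linarith⟩
  set K : ℕ → ℝ := fun i => 1 + ∑ l ∈ Finset.range (i + 1), |κ (2 ^ l)| with hK
  have hKpos : ∀ i, 0 < K i := fun i => by
    have : 0 ≤ ∑ l ∈ Finset.range (i + 1), |κ (2 ^ l)| := Finset.sum_nonneg fun _ _ => abs_nonneg _
    simp only [hK]; linarith
  have hKmono : ∀ i, K i ≤ K (i + 1) := fun i => by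
    simp only [hK]
    rw [Finset.sum_range_succ _ (i + 1)]
    linarith [abs_nonneg (κ (2 ^ (i + 1)))]
  have hKκ : ∀ i, κ (2 ^ i) ≤ K i := fun i => by
    have : |κ (2 ^ i)| ≤ ∑ l ∈ Finset.range (i + 1), |κ (2 ^ l)| :=
      Finset.single_le_sum (f := fun l => |κ (2 ^ l)|) (fun _ _ => abs_nonneg _)
        (Finset.mem_range.2 (Nat.lt_succ_self i))
    simp only [hK]; linarith [le_abs_self (κ (2 ^ i))]
  set S : ℕ → ℝ := fun i => sSup (dbl q U V (2 ^ i) (K i) 0 '' dblDom E I) with hS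
  have hbd : ∀ i, BddAbove (dbl q U V (2 ^ i) (K i) 0 '' dblDom E I) := fun i =>
    hbdd _ _ (by positivity) (hKpos i).le 0
  have hstep : ∀ i p, dbl q U V (2 ^ (i + 1)) (K (i + 1)) 0 p + 2 ^ i * ‖p.1.1 - p.2.1‖ ^ q
      ≤ dbl q U V (2 ^ i) (K i) 0 p := fun i p => by
    have := mul_le_mul_of_nonneg_right (hKmono i) (sq_nonneg (p.1.2 - p.2.2))
    simp only [dbl, sub_zero, pow_succ (2 : ℝ) i]
    linarith
  have hanti : Antitone S := antitone_nat_of_succ_le fun i => by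
    refine csSup_le (hD.image _) ?_
    rintro _ ⟨p, hp, rfl⟩
    have h1 := hstep i p
    have h2 := le_csSup (hbd i) ⟨p, hp, rfl⟩
    have h3 : 0 ≤ 2 ^ i * ‖p.1.1 - p.2.1‖ ^ q := by positivity
    simp only [hS]; linarith
  have hlow : BddBelow (range S) := ⟨4 * σ, by
    rintro _ ⟨i, rfl⟩
    have := le_csSup (hbd i) ⟨((xb, tb), (xb, tb)), mem_dblDom.2 ⟨htb, htb⟩, rfl⟩
    simp only [dbl, sub_self, norm_zero] at this
    rw [zero_pow hq, mul_zero] at this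
    simp only [hS]; linarith⟩
  set e := min ε σ / 11 with he
  have hepos : 0 < e := by positivity
  have heε : 11 * e ≤ ε := by rw [he]; linarith [min_le_left ε σ]
  have heσ : 11 * e ≤ σ := by rw [he]; linarith [min_le_right ε σ]
  obtain ⟨i, hi⟩ := exists_sub_le_of_antitone hanti hlow hepos
  set j : ℝ := 2 ^ (i + 1) with hj
  have hj1 : 1 ≤ j := one_le_pow₀ (by norm_num)
  obtain ⟨ρ, hρ, hmod⟩ : ∃ ρ > 0, ∀ a b : E, ‖a‖ ≤ 1 + B → ‖a - b‖ < ρ →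
      |j * ‖a‖ ^ q - j * ‖b‖ ^ q| ≤ e := by
    have hc : Continuous fun a : E => j * ‖a‖ ^ q := by fun_prop
    have := (isCompact_closedBall (0 : E) (2 + B)).uniformContinuousOn_of_continuous hc.continuousOn
    obtain ⟨ρ, hρ, h⟩ := Metric.uniformContinuousOn_iff.1 this e hepos
    refine ⟨min ρ 1, by positivity, fun a b ha hab => ?_⟩
    have hb : ‖b‖ ≤ 2 + B := by
      have := norm_sub_norm_le b a
      rw [norm_sub_rev] at this
      have := hab.le.trans (min_le_right _ _)
      linarith
    exact (h a (by simpa using (by linarith : ‖a‖ ≤ 2 + B)) b (by simpa using hb)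
      (by rw [dist_eq_norm]; exact hab.trans_le (min_le_left _ _))).le
  have hnorm : ∀ a : E, j * ‖a‖ ^ q ≤ B → ‖a‖ ≤ 1 + B := fun a ha => by
    by_contra! hcon
    have h1 : ‖a‖ ≤ ‖a‖ ^ q := le_self_pow₀ (by linarith) hq
    have h2 : ‖a‖ ^ q ≤ j * ‖a‖ ^ q := le_mul_of_one_le_left (by positivity) hj1
    linarith
  have hpos : ∀ ζ : E, ∀ p ∈ dblDom E I, 2 * σ ≤ dbl q U V j (K (i + 1)) ζ p →
      j * ‖p.1.1 - p.2.1 - ζ‖ ^ q ≤ B ∧ 2 * σ ≤ U p.1.1 p.1.2 + V p.2.1 p.2.2 ∧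
        K (i + 1) * (p.1.2 - p.2.2) ^ 2 ≤ B := by
    intro ζ p hp h
    obtain ⟨h1, h2⟩ := mem_dblDom.1 hp
    have h3 := hub p.1.1 _ h1 p.2.1 _ h2
    have a1 : 0 ≤ j * ‖p.1.1 - p.2.1 - ζ‖ ^ q := by positivity
    have a2 : 0 ≤ K (i + 1) * (p.1.2 - p.2.2) ^ 2 := mul_nonneg (hKpos _).le (sq_nonneg _)
    unfold dbl at h
    refine ⟨?_, ?_, ?_⟩ <;> linarith
  have hnear : ∀ ζ : E, ‖ζ‖ < ρ → ∀ p, NearMax (dbl q U V j (K (i + 1)) ζ) (dblDom E I) e p →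
      2 * σ ≤ dbl q U V j (K (i + 1)) ζ p := by
    intro ζ hζ p hp
    have h1 := hp.2 ((xb, tb), (xb, tb)) (mem_dblDom.2 ⟨htb, htb⟩)
    have h2 := hmod 0 (-ζ) (by simp; positivity) (by simpa using hζ)
    rw [norm_zero, zero_pow hq, mul_zero, zero_sub, abs_neg] at h2
    have h3 := le_abs_self (j * ‖-ζ‖ ^ q)
    simp only [dbl, sub_self, zero_sub] at h1 ⊢
    rw [zero_pow two_ne_zero, mul_zero] at h1
    linarith
  refine ⟨j, K (i + 1), ρ, e, hj1, hKκ (i + 1), hKpos _, hρ, hepos, fun ζ hζ p hp => ?_⟩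
  obtain ⟨b1, b2, b3⟩ := hpos ζ p hp.1 (hnear ζ hζ p hp)
  refine ⟨?_, b2, b3⟩
  obtain ⟨p₀, hp₀, hS₀⟩ := exists_nearMax hD (hbd (i + 1)) hepos
  obtain ⟨d1, -, -⟩ := hpos 0 p₀ hp₀.1 (hnear 0 (by simpa using hρ) p₀ hp₀)
  rw [sub_zero] at d1
  have m1 := abs_le.1 (hmod (p₀.1.1 - p₀.2.1) (p₀.1.1 - p₀.2.1 - ζ) (hnorm _ d1) (by simpa using hζ))
  have m2 := abs_le.1 (hmod (p.1.1 - p.2.1 - ζ) (p.1.1 - p.2.1) (hnorm _ b1) (by simpa using hζ))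
  have n1 := hp.2 p₀ hp₀.1
  have n2 := hstep i p
  have n3 := le_csSup (hbd i) ⟨p, hp.1, rfl⟩
  have n4 : j * ‖p.1.1 - p.2.1‖ ^ q = 2 * (2 ^ i * ‖p.1.1 - p.2.1‖ ^ q) := by
    rw [hj, pow_succ]; ring
  simp only [hS, dbl, sub_zero] at hS₀ n1 n2 n3 hi
  linarith [m1.1, m1.2, m2.1, m2.2]

end Selection

section Penalised

/-- A function penalised linearly in time and quadratically after the time `τ`. -/
def pen (η τ C : ℝ) {E : Type*} (w : E → ℝ → ℝ) (x : E) (t : ℝ) : ℝ := w x t - η * t - timePen τ C t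

theorem pen_le {E : Type*} {η τ C t : ℝ} (hη : 0 ≤ η) (hC : 0 ≤ C) (ht : 0 ≤ t) (w : E → ℝ → ℝ)
    (x : E) : pen η τ C w x t ≤ w x t := by
  have := timePen_nonneg (τ := τ) hC t
  have := mul_nonneg hη ht
  unfold pen; linarith

theorem pen_usc {E : Type*} [TopologicalSpace E] {η τ C : ℝ} {w : E → ℝ → ℝ} {D : Set (E × ℝ)}
    (hw : UpperSemicontinuousOn (fun p : E × ℝ => w p.1 p.2) D) :
    UpperSemicontinuousOn (fun p : E × ℝ => pen η τ C w p.1 p.2) D := by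
  have h2 : Continuous fun p : E × ℝ => -(η * p.2) - timePen τ C p.2 := by
    have := (continuous_timePen τ C).comp (continuous_snd (X := E) (Y := ℝ))
    exact (by fun_prop : Continuous fun p : E × ℝ => -(η * p.2)).sub this
  have h3 := hw.add (h2.upperSemicontinuous.upperSemicontinuousOn D)
  have h4 : (fun p : E × ℝ => pen η τ C w p.1 p.2) =
      fun p => w p.1 p.2 + (-(η * p.2) - timePen τ C p.2) := by
    funext p; simp only [pen]; ring
  rw [h4]; exact h3

theorem pen_interior {E : Type*} [NormedAddCommGroup E] {w₁ w₂ : E → ℝ → ℝ}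
    {T₂ τ C η σ B c γ : ℝ} (hη : 0 ≤ η) (hC : 0 ≤ C) (hB₁ : ∀ x, ∀ t ∈ Icc 0 T₂, w₁ x t ≤ B)
    (hB₂ : ∀ x, ∀ t ∈ Icc 0 T₂, w₂ x t ≤ B) (hτ : τ < T₂) (hpen : 2 * B ≤ C * (T₂ - τ) ^ 2)
    (hb₁ : ∀ ε > 0, ∃ L, 0 ≤ L ∧ ∀ x, ∀ t ∈ Icc 0 T₂, w₁ x t ≤ w₁ x 0 + ε + L * t)
    (hb₂ : ∀ ε > 0, ∃ L, 0 ≤ L ∧ ∀ x, ∀ t ∈ Icc 0 T₂, w₂ x t ≤ w₂ x 0 + ε + L * t)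
    (h0 : ∀ x, w₁ x 0 + w₂ x 0 ≤ 0) (hγ : 0 < γ)
    (hol : ∀ x y, w₁ x 0 ≤ w₁ y 0 + c * ‖x - y‖ ^ γ) (hσ : 0 < σ) :
    ∃ r > 0, ∀ x y, ∀ t ∈ Icc 0 T₂, ∀ s ∈ Icc 0 T₂, ‖x - y‖ ≤ r → |t - s| ≤ r →
      2 * σ ≤ pen η τ C w₁ x t + pen 0 τ C w₂ y s → t ∈ Ioo 0 T₂ ∧ s ∈ Ioo 0 T₂ := by
  obtain ⟨L₁, hL₁, hb₁⟩ := hb₁ (σ / 2) (by positivity)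
  obtain ⟨L₂, hL₂, hb₂⟩ := hb₂ (σ / 2) (by positivity)
  obtain ⟨r, hr, hrc⟩ : ∃ r > 0, ∀ d, 0 ≤ d → d ≤ r → c * d ^ γ ≤ σ / 2 := by
    obtain ⟨K, hK, h⟩ := exists_power_dominates c hγ (by positivity : 0 < σ / 4) 1
    refine ⟨min 1 (σ / (4 * K)), by positivity, fun d hd hdr => (h d ⟨hd, hdr.trans (min_le_left _ _)⟩).trans ?_⟩
    have := mul_le_mul_of_nonneg_left (hdr.trans (min_le_right _ _)) hK.le
    rw [pow_one]
    have h2 : K * (σ / (4 * K)) = σ / 4 := by field_simp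
    linarith
  refine ⟨min r (σ / (2 * (L₁ + L₂ + 1))), by positivity, fun x y t ht s hs hxy hts hge => ?_⟩
  have hL : ∀ d, d ≤ σ / (2 * (L₁ + L₂ + 1)) → L₁ * d ≤ σ / 2 ∧ L₂ * d ≤ σ / 2 := fun d hd => by
    have h2 : (L₁ + L₂ + 1) * (σ / (2 * (L₁ + L₂ + 1))) = σ / 2 := by field_simp
    have h0 : 0 < σ / (2 * (L₁ + L₂ + 1)) := by positivity
    constructor <;> nlinarith [mul_nonneg hL₁ h0.le, mul_nonneg hL₂ h0.le]
  have hd := hrc _ (norm_nonneg _) (hxy.trans (min_le_left _ _))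
  have hts' := abs_le.1 (hts.trans (min_le_right _ _))
  have p₁ := pen_le (τ := τ) hη hC ht.1 w₁ x
  have p₂ := pen_le (τ := τ) le_rfl hC hs.1 w₂ y
  have hT₂ : ∀ {z : E} {θ : ℝ} {w : E → ℝ → ℝ}, 0 ≤ θ → (∀ x, ∀ t ∈ Icc 0 T₂, w x t ≤ B) →
      T₂ ∈ Icc 0 T₂ → pen θ τ C w z T₂ ≤ -B := fun {z θ w} hθ hw hT => by
    have h1 := hw z T₂ hT
    have h2 := mul_nonneg hθ hT.1
    rw [← max_eq_left (sub_nonneg.2 hτ.le)] at hpen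
    unfold pen timePen; linarith
  have ht2 : t ≠ T₂ := fun h => by
    subst h
    have := hT₂ (z := x) hη hB₁ ht
    have := hB₂ y s hs
    linarith
  have hs2 : s ≠ T₂ := fun h => by
    subst h
    have := hT₂ (z := y) le_rfl hB₂ hs
    have := hB₁ x t ht
    linarith
  have ht0 : t ≠ 0 := fun h => by
    subst h
    have h1 := hb₂ y s hs
    have h2 := (hL s (by linarith [hts'.1])).2
    have h3 := hol x y
    have h4 := h0 y
    linarith
  have hs0 : s ≠ 0 := fun h => by
    subst h
    have h1 := hb₁ x t ht
    have h2 := (hL t (by linarith [hts'.2])).1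
    have h3 := hol x y
    have h4 := h0 y
    linarith
  exact ⟨⟨lt_of_le_of_ne ht.1 (Ne.symm ht0), lt_of_le_of_ne ht.2 ht2⟩,
    ⟨lt_of_le_of_ne hs.1 (Ne.symm hs0), lt_of_le_of_ne hs.2 hs2⟩⟩

end Penalised

section FlatCase

theorem exists_max_pair {E : Type*} [NormedAddCommGroup E] [ProperSpace E] {U V : E → ℝ → ℝ}
    {I : Set ℝ} (hI : IsCompact I)
    (hU : UpperSemicontinuousOn (fun p : E × ℝ => U p.1 p.2) (univ ×ˢ I))
    (hV : UpperSemicontinuousOn (fun p : E × ℝ => V p.1 p.2) (univ ×ˢ I))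
    {Ψ : (E × ℝ) × (E × ℝ) → ℝ} (hΨ : Continuous Ψ) {x₀ y₀ : E} {t₀ s₀ r : ℝ} (hr : 0 ≤ r)
    (ht : t₀ ∈ I) (hs : s₀ ∈ I) :
    ∃ x ∈ closedBall x₀ r, ∃ t ∈ I, ∃ y ∈ closedBall y₀ r, ∃ s ∈ I,
      ∀ x' ∈ closedBall x₀ r, ∀ t' ∈ I, ∀ y' ∈ closedBall y₀ r, ∀ s' ∈ I,
        U x' t' + V y' s' - Ψ ((x', t'), (y', s')) ≤ U x t + V y s - Ψ ((x, t), (y, s)) := by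
  set K := (closedBall x₀ r ×ˢ I) ×ˢ (closedBall y₀ r ×ˢ I) with hK
  have hKc : IsCompact K := ((isCompact_closedBall _ _).prod hI).prod ((isCompact_closedBall _ _).prod hI)
  have h₁ : UpperSemicontinuousOn (fun p : (E × ℝ) × (E × ℝ) => U p.1.1 p.1.2) K :=
    hU.comp (g := Prod.fst) (t := K) continuous_fst.continuousOn fun q hq => ⟨mem_univ _, hq.1.2⟩
  have h₂ : UpperSemicontinuousOn (fun p : (E × ℝ) × (E × ℝ) => V p.2.1 p.2.2) K :=
    hV.comp (g := Prod.snd) (t := K) continuous_snd.continuousOn fun q hq => ⟨mem_univ _, hq.2.2⟩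
  have h₃ := (h₁.add h₂).add (hΨ.neg.upperSemicontinuous.upperSemicontinuousOn K)
  obtain ⟨p, hp, hm⟩ := h₃.exists_isMaxOn (show K.Nonempty from
    ⟨((x₀, t₀), (y₀, s₀)), ⟨mem_closedBall_self hr, ht⟩, ⟨mem_closedBall_self hr, hs⟩⟩) hKc
  refine ⟨p.1.1, hp.1.1, p.1.2, hp.1.2, p.2.1, hp.2.1, p.2.2, hp.2.2, fun x' hx' t' ht' y' hy' s' hs' => ?_⟩
  exact isMaxOn_iff.1 hm ((x', t'), (y', s')) ⟨⟨hx', ht'⟩, ⟨hy', hs'⟩⟩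

variable {T α Λ : ℝ} {g w : EucSp N → ℝ → ℝ}

theorem ParSub.pen_pow_test (hs : ParSub T α Λ g w) (hΛ : 0 ≤ Λ) {n : ℕ}
    (hn : 2 ≤ (2 * n + 3) * (1 + α)) {x z : EucSp N} {t K a c η τ C : ℝ} (ht : t ∈ Ioo 0 T)
    (hC : 0 ≤ C)
    (hg : ContinuousAt (fun p : EucSp N × ℝ => g p.1 p.2) (x, t))
    (hK : 0 < K) (hx1 : ‖x - z‖ ≤ 1)
    (hle : ∀ᶠ y : EucSp N × ℝ in nhds (x, t), pen η τ C w y.1 y.2 ≤ pen η τ C w x t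
      + K * (‖y.1 - z‖ ^ (2 * n + 4) - ‖x - z‖ ^ (2 * n + 4)) + a * (y.2 - t)
      + c * (y.2 - t) ^ 2) :
    a + η ≤ g x t + testC n α Λ * K ^ (1 + α) := by
  have := hs.pow_test hΛ hn ht hg hK hx1 (a := a + η + 2 * C * max (t - τ) 0) (c := c + C) ?_
  · have h2 : 0 ≤ 2 * C * max (t - τ) 0 := by positivity
    linarith
  · filter_upwards [hle] with y hy
    have := timePen_le (τ := τ) hC y.2 t
    simp only [pen] at hy
    linarith

set_option maxHeartbeats 400000 in
theorem ParSub.not_flat {g₁ g₂ w₁ w₂ : EucSp N → ℝ → ℝ} (hs₁ : ParSub T α Λ g₁ w₁)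
    (hs₂ : ParSub T α Λ g₂ w₂) (hΛ : 0 ≤ Λ) (hα : -1 < α) {n : ℕ}
    (hn : 2 ≤ (2 * n + 3) * (1 + α))
    (hg₁ : ∀ x, ∀ t ∈ Ioo 0 T, ContinuousAt (fun p : EucSp N × ℝ => g₁ p.1 p.2) (x, t))
    (hg₂ : ∀ x, ∀ t ∈ Ioo 0 T, ContinuousAt (fun p : EucSp N × ℝ => g₂ p.1 p.2) (x, t))
    {η τ C T₂ k S ζ₀ ε₁ : ℝ} (hC : 0 ≤ C) (hη : 0 < η) (hT₂ : T₂ < T) (hζ₀ : 0 < ζ₀)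
    (hε₁ : 0 < ε₁)
    (hflat : ∀ x y, ∀ t ∈ Icc 0 T₂, ∀ s ∈ Icc 0 T₂, ‖x - y‖ < ζ₀ →
      pen η τ C w₁ x t + pen 0 τ C w₂ y s - k * (t - s) ^ 2 ≤ S)
    (hnear : ∀ ε > 0, ∃ x y, ∃ t ∈ Icc 0 T₂, ∃ s ∈ Icc 0 T₂, ‖x - y‖ < ζ₀ / 2 ∧
      S - ε ≤ pen η τ C w₁ x t + pen 0 τ C w₂ y s - k * (t - s) ^ 2)
    (hinside : ∀ x y, ∀ t ∈ Icc 0 T₂, ∀ s ∈ Icc 0 T₂, ‖x - y‖ < ζ₀ →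
      S - ε₁ ≤ pen η τ C w₁ x t + pen 0 τ C w₂ y s - k * (t - s) ^ 2 →
      t ∈ Ioo 0 T₂ ∧ s ∈ Ioo 0 T₂ ∧ g₁ x t + g₂ y s ≤ η / 4) : False := by
  obtain ⟨K, hK, hKη⟩ : ∃ K > 0, testC n α Λ * K ^ (1 + α) ≤ η / 4 := by
    have hc : ContinuousAt (fun d : ℝ => testC n α Λ * d ^ (1 + α)) 0 :=
      continuousAt_const.mul (Real.continuousAt_rpow_const _ _ (Or.inr (by linarith)))
    have : ∀ᶠ d in nhds (0 : ℝ), testC n α Λ * d ^ (1 + α) < η / 4 := by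
      refine hc.eventually (Iio_mem_nhds ?_)
      beta_reduce
      rw [Real.zero_rpow (by linarith), mul_zero]; positivity
    obtain ⟨ρ, hρ, h⟩ := Metric.eventually_nhds_iff.1 this
    refine ⟨ρ / 2, by positivity, (h ?_).le⟩
    rw [Real.dist_eq, sub_zero, abs_of_pos (by positivity)]; linarith
  set r := min (ζ₀ / 4) 1 with hr
  have hr0 : 0 < r := by positivity
  have hr1 : r ≤ 1 := min_le_right _ _
  have hr4 : r ≤ ζ₀ / 4 := min_le_left _ _
  have hKr : 0 < K * r ^ (2 * n + 4) := by positivity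
  obtain ⟨x₀, y₀, t₀, ht₀, s₀, hs₀, hxy₀, hge₀⟩ := hnear (min ε₁ (K * r ^ (2 * n + 4) / 2)) (by positivity)
  have husc : ∀ {θ : ℝ} {w g : EucSp N → ℝ → ℝ}, ParSub T α Λ g w → UpperSemicontinuousOn
      (fun p : EucSp N × ℝ => pen θ τ C w p.1 p.2) (univ ×ˢ Icc 0 T₂) := fun h =>
    pen_usc (h.usc.mono (prod_mono le_rfl fun t ht => ⟨ht.1, ht.2.trans_lt hT₂⟩))
  obtain ⟨x, hx, t, ht, y, hy, s, hs, hmax⟩ := exists_max_pair isCompact_Icc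
    (husc (θ := η) hs₁) (husc (θ := 0) hs₂)
    (Ψ := fun p => k * (p.1.2 - p.2.2) ^ 2 + K * ‖p.1.1 - x₀‖ ^ (2 * n + 4)
      + K * ‖p.2.1 - y₀‖ ^ (2 * n + 4)) (by fun_prop) (x₀ := x₀) (y₀ := y₀) hr0.le ht₀ hs₀
  simp only [mem_closedBall, dist_eq_norm] at hx hy hmax
  have h0 := hmax x₀ (by simpa using hr0.le) t₀ ht₀ y₀ (by simpa using hr0.le) s₀ hs₀
  simp only [sub_self, norm_zero, zero_pow (by omega : 2 * n + 4 ≠ 0), mul_zero, add_zero] at h0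
  have hxy : ‖x - y‖ < ζ₀ := by
    have : x - y = (x - x₀) + (x₀ - y₀) - (y - y₀) := by abel
    rw [this]
    have := norm_sub_le ((x - x₀) + (x₀ - y₀)) (y - y₀)
    have := norm_add_le (x - x₀) (x₀ - y₀)
    linarith
  have hS := hflat x y t ht s hs hxy
  have hnx : 0 ≤ K * ‖x - x₀‖ ^ (2 * n + 4) := by positivity
  have hny : 0 ≤ K * ‖y - y₀‖ ^ (2 * n + 4) := by positivity
  have hm₁ := min_le_left ε₁ (K * r ^ (2 * n + 4) / 2)
  have hm₂ := min_le_right ε₁ (K * r ^ (2 * n + 4) / 2)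
  obtain ⟨hti, hsi, hg⟩ := hinside x y t ht s hs hxy (by linarith)
  have hlt : ∀ {d : ℝ}, 0 ≤ d → K * d ^ (2 * n + 4) ≤ K * r ^ (2 * n + 4) / 2 → d < r := by
    intro d hd h
    by_contra! hc
    have := mul_le_mul_of_nonneg_left (pow_le_pow_left₀ hr0.le hc (2 * n + 4)) hK.le
    linarith
  have hxr := hlt (norm_nonneg (x - x₀)) (by linarith)
  have hyr := hlt (norm_nonneg (y - y₀)) (by linarith)
  have hnb : ∀ {z z₀ : EucSp N} {θ : ℝ}, ‖z - z₀‖ < r → θ ∈ Ioo 0 T₂ →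
      ∀ᶠ p : EucSp N × ℝ in nhds (z, θ), ‖p.1 - z₀‖ ≤ r ∧ p.2 ∈ Icc 0 T₂ := by
    intro z z₀ θ hz hθ
    have h1 : ∀ᶠ p : EucSp N × ℝ in nhds (z, θ), ‖p.1 - z₀‖ < r :=
      ((by fun_prop : Continuous fun p : EucSp N × ℝ => ‖p.1 - z₀‖).tendsto (z, θ)).eventually_lt_const
        hz
    have h2 : ∀ᶠ p : EucSp N × ℝ in nhds (z, θ), p.2 ∈ Icc 0 T₂ :=
      continuous_snd.continuousAt.eventually (Icc_mem_nhds hθ.1 hθ.2)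
    filter_upwards [h1, h2] with p h1 h2 using ⟨h1.le, h2⟩
  have e₁ := hs₁.pen_pow_test hΛ hn (K := K) (a := 2 * k * (t - s)) (c := k) (z := x₀) (η := η) (τ := τ)
    ⟨hti.1, hti.2.trans hT₂⟩ hC
    (hg₁ x t ⟨hti.1, hti.2.trans hT₂⟩) hK (hx.trans hr1) (by
      filter_upwards [hnb hxr hti] with p hp
      have := hmax p.1 hp.1 p.2 hp.2 y hy s hs
      linarith)
  have e₂ := hs₂.pen_pow_test hΛ hn (K := K) (a := -(2 * k * (t - s))) (c := k) (z := y₀) (η := 0) (τ := τ)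
    ⟨hsi.1, hsi.2.trans hT₂⟩ hC
    (hg₂ y s ⟨hsi.1, hsi.2.trans hT₂⟩) hK (hy.trans hr1) (by
      filter_upwards [hnb hyr hsi] with p hp
      have := hmax x hx t ht p.1 hp.1 p.2 hp.2
      linarith)
  linarith

end FlatCase

section ParabolicJets

variable {E : Type*} [NormedAddCommGroup E] [InnerProductSpace ℝ E]

/-- Inclusion of the space variable in the `L²` product with the time axis. -/
def spaceIncl (E : Type*) [NormedAddCommGroup E] [InnerProductSpace ℝ E] : E →L[ℝ] WithLp 2 (E × ℝ) :=
  ((WithLp.prodContinuousLinearEquiv 2 ℝ E ℝ).symm : E × ℝ →L[ℝ] WithLp 2 (E × ℝ)).comp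
    (ContinuousLinearMap.inl ℝ E ℝ)

theorem spaceIncl_apply (a : E) : spaceIncl E a = WithLp.toLp 2 (a, 0) := rfl

/-- The spatial block of an operator on space-time. -/
def spaceBlock (X : WithLp 2 (E × ℝ) →L[ℝ] WithLp 2 (E × ℝ)) : E →L[ℝ] E :=
  (WithLp.fstL 2 ℝ E ℝ).comp (X.comp (spaceIncl E))

theorem inner_spaceBlock (X : WithLp 2 (E × ℝ) →L[ℝ] WithLp 2 (E × ℝ)) (a b : E) :
    ⟪spaceBlock X a, b⟫ = ⟪X (spaceIncl E a), spaceIncl E b⟫ := by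
  simp [spaceBlock, spaceIncl_apply, WithLp.prod_inner_apply]

/-- A space-time function recentred at a point, with rescaled time, after subtracting an affine
function and a spatial quadratic. -/
def recentre (W : E → ℝ → ℝ) (x₀ : E) (t₀ : ℝ) (P : E) (c β θ : ℝ) (ξ : WithLp 2 (E × ℝ)) : ℝ :=
  W (x₀ + ξ.fst) (t₀ + θ * ξ.snd) - W x₀ t₀ - ⟪P, ξ.fst⟫ - c * (θ * ξ.snd) - β * ‖ξ.fst‖ ^ 2

theorem recentre_zero (W : E → ℝ → ℝ) (x₀ : E) (t₀ : ℝ) (P : E) (c β θ : ℝ) :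
    recentre W x₀ t₀ P c β θ 0 = 0 := by
  simp [recentre]

theorem recentre_usc {W : E → ℝ → ℝ} {I : Set ℝ}
    (hW : UpperSemicontinuousOn (fun p : E × ℝ => W p.1 p.2) (univ ×ˢ I)) {x₀ : E} {t₀ : ℝ} {P : E}
    {c β θ ρ : ℝ} (hI : ∀ ξ : WithLp 2 (E × ℝ), ‖ξ‖ ≤ ρ → t₀ + θ * ξ.snd ∈ I) :
    UpperSemicontinuousOn (recentre W x₀ t₀ P c β θ) (closedBall 0 ρ) := by
  have hf : Continuous fun ξ : WithLp 2 (E × ℝ) => ξ.fst := (WithLp.fstL 2 ℝ E ℝ).continuous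
  have hs : Continuous fun ξ : WithLp 2 (E × ℝ) => ξ.snd := (WithLp.sndL 2 ℝ E ℝ).continuous
  have h1 := hW.comp (g := fun ξ : WithLp 2 (E × ℝ) => (x₀ + ξ.fst, t₀ + θ * ξ.snd))
    (t := closedBall 0 ρ) (by fun_prop)
    (fun ξ hξ => ⟨mem_univ _, hI ξ (by simpa using hξ)⟩)
  have h2 : Continuous fun ξ : WithLp 2 (E × ℝ) =>
      - W x₀ t₀ - ⟪P, ξ.fst⟫ - c * (θ * ξ.snd) - β * ‖ξ.fst‖ ^ 2 := by fun_prop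
  have h3 := h1.add (h2.upperSemicontinuous.upperSemicontinuousOn _)
  have h4 : recentre W x₀ t₀ P c β θ = fun ξ => ((fun p : E × ℝ => W p.1 p.2) ∘
      fun ξ : WithLp 2 (E × ℝ) => (x₀ + ξ.fst, t₀ + θ * ξ.snd)) ξ +
      (- W x₀ t₀ - ⟪P, ξ.fst⟫ - c * (θ * ξ.snd) - β * ‖ξ.fst‖ ^ 2) := by
    funext ξ; simp only [recentre, Function.comp]; ring
  rw [h4]; exact h3

theorem jet_of_recentre [FiniteDimensional ℝ E] {W : E → ℝ → ℝ} {x₀ : E} {t₀ : ℝ} {P : E}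
    {c β θ : ℝ} (hθ : 0 < θ)
    {ξ p : WithLp 2 (E × ℝ)} {X : WithLp 2 (E × ℝ) →L[ℝ] WithLp 2 (E × ℝ)} {δ : ℝ}
    (hjet : ∀ᶠ z in nhds 0, recentre W x₀ t₀ P c β θ (ξ + z) ≤ recentre W x₀ t₀ P c β θ ξ
      + ⟪p, z⟫ + ⟪X z, z⟫ / 2 + δ * ‖z‖ ^ 2) :
    ∃ b c', ∀ᶠ z : E × ℝ in nhds (x₀ + ξ.fst, t₀ + θ * ξ.snd),
      W z.1 z.2 ≤ W (x₀ + ξ.fst) (t₀ + θ * ξ.snd)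
        + ⟪P + p.fst + (2 * β) • ξ.fst, z.1 - (x₀ + ξ.fst)⟫
        + ⟪(spaceBlock X + (2 * β + 2 * δ) • ContinuousLinearMap.id ℝ E) (z.1 - (x₀ + ξ.fst)),
            z.1 - (x₀ + ξ.fst)⟫ / 2
        + (c + p.snd / θ) * (z.2 - (t₀ + θ * ξ.snd))
        + (z.2 - (t₀ + θ * ξ.snd)) * ⟪b, z.1 - (x₀ + ξ.fst)⟫
        + c' * (z.2 - (t₀ + θ * ξ.snd)) ^ 2 := by
  set e : WithLp 2 (E × ℝ) := WithLp.toLp 2 (0, 1) with he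
  refine ⟨(1 / (2 * θ)) • ((X e).fst + (ContinuousLinearMap.adjoint X e).fst),
    (⟪X e, e⟫ / 2 + δ) / θ ^ 2, ?_⟩
  set x₁ := x₀ + ξ.fst with hx₁
  set t₁ := t₀ + θ * ξ.snd with ht₁
  have hcont : Continuous fun z : E × ℝ =>
      (WithLp.toLp 2 (z.1 - x₁, (z.2 - t₁) / θ) : WithLp 2 (E × ℝ)) :=
    (WithLp.prodContinuousLinearEquiv 2 ℝ E ℝ).symm.continuous.comp
      (f := fun z : E × ℝ => (z.1 - x₁, (z.2 - t₁) / θ)) (by fun_prop)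
  have htend : Tendsto (fun z : E × ℝ =>
      (WithLp.toLp 2 (z.1 - x₁, (z.2 - t₁) / θ) : WithLp 2 (E × ℝ))) (nhds (x₁, t₁)) (nhds 0) := by
    have := hcont.tendsto (x₁, t₁)
    simp only [sub_self, zero_div] at this
    exact this
  filter_upwards [htend.eventually hjet] with z hz
  set d := z.1 - x₁ with hd
  set σ := (z.2 - t₁) / θ with hσ
  have hσθ : z.2 - t₁ = θ * σ := by rw [hσ]; field_simp
  have hz1 : z.1 = x₁ + d := by rw [hd]; abel
  have hz2 : z.2 = t₁ + θ * σ := by linarith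
  have hdec : (WithLp.toLp 2 (d, σ) : WithLp 2 (E × ℝ)) = spaceIncl E d + σ • e := by
    rw [spaceIncl_apply, he, ← WithLp.toLp_smul, ← WithLp.toLp_add]; simp
  have hXe : ⟪X e, spaceIncl E d⟫ = ⟪(X e).fst, d⟫ := by
    simp [spaceIncl_apply, WithLp.prod_inner_apply]
  have hXa : ⟪X (spaceIncl E d), e⟫ = ⟪(ContinuousLinearMap.adjoint X e).fst, d⟫ := by
    rw [← ContinuousLinearMap.adjoint_inner_right, real_inner_comm]
    simp [spaceIncl_apply, WithLp.prod_inner_apply]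
  have hform : ⟪X (WithLp.toLp 2 (d, σ)), WithLp.toLp 2 (d, σ)⟫ = ⟪spaceBlock X d, d⟫
      + σ * (⟪(X e).fst, d⟫ + ⟪(ContinuousLinearMap.adjoint X e).fst, d⟫) + σ ^ 2 * ⟪X e, e⟫ := by
    rw [hdec, inner_spaceBlock, ← hXe, ← hXa]
    simp only [map_add, map_smul, inner_add_left, inner_add_right, real_inner_smul_left,
      real_inner_smul_right]
    ring
  have hp : ⟪p, WithLp.toLp 2 (d, σ)⟫ = ⟪p.fst, d⟫ + p.snd * σ := by
    simp [WithLp.prod_inner_apply]; ring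
  have hn : ‖(WithLp.toLp 2 (d, σ) : WithLp 2 (E × ℝ))‖ ^ 2 = ‖d‖ ^ 2 + σ ^ 2 := by
    rw [WithLp.prod_norm_sq_eq_of_L2]; simp
  have hb : ‖ξ.fst + d‖ ^ 2 = ‖ξ.fst‖ ^ 2 + 2 * ⟪ξ.fst, d⟫ + ‖d‖ ^ 2 := norm_add_sq_real _ _
  rw [hform, hp, hn] at hz
  have ha : x₀ + (ξ + WithLp.toLp 2 (d, σ)).fst = z.1 := by
    rw [hz1, hx₁, WithLp.add_fst]; simp [add_assoc]
  have hat : t₀ + θ * (ξ + WithLp.toLp 2 (d, σ)).snd = z.2 := by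
    rw [hz2, ht₁, WithLp.add_snd]; simp; ring
  simp only [recentre] at hz
  rw [ha, hat, ← hx₁, ← ht₁] at hz
  simp only [WithLp.add_fst, WithLp.add_snd, inner_add_right] at hz
  change W z.1 z.2 - W x₀ t₀ - (⟪P, ξ.fst⟫ + ⟪P, d⟫) - c * (θ * (ξ.snd + σ))
    - β * ‖ξ.fst + d‖ ^ 2 ≤ _ at hz
  rw [hb] at hz
  simp only [add_apply, smul_apply, ContinuousLinearMap.id_apply, inner_add_left,
    real_inner_smul_left, real_inner_self_eq_norm_sq]
  rw [hσθ]
  have e1 : (c + p.snd / θ) * (θ * σ) = c * (θ * σ) + p.snd * σ := by field_simp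
  have e2 : θ * σ * (1 / (2 * θ) * (⟪(X e).fst, d⟫ + ⟪(ContinuousLinearMap.adjoint X e).fst, d⟫))
      = σ * (⟪(X e).fst, d⟫ + ⟪(ContinuousLinearMap.adjoint X e).fst, d⟫) / 2 := by field_simp
  have e3 : (⟪X e, e⟫ / 2 + δ) / θ ^ 2 * (θ * σ) ^ 2 = (⟪X e, e⟫ / 2 + δ) * σ ^ 2 := by field_simp
  rw [e1, e2, e3]
  linarith

theorem exists_parabolic_jets [FiniteDimensional ℝ E] {U V : E → ℝ → ℝ} {I : Set ℝ}
    (hU : UpperSemicontinuousOn (fun p : E × ℝ => U p.1 p.2) (univ ×ˢ I))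
    (hV : UpperSemicontinuousOn (fun p : E × ℝ => V p.1 p.2) (univ ×ˢ I)) {x₀ y₀ P Q : E}
    {t₀ s₀ c κ k β r : ℝ} (hκ : 0 < κ) (hk : 0 < k) (hβ : 0 ≤ β) (hr : 0 < r)
    (htI : ∀ t, |t - t₀| ≤ r → t ∈ I) (hsI : ∀ s, |s - s₀| ≤ r → s ∈ I)
    (hle : ∀ x t y s, ‖x - x₀‖ ≤ r → |t - t₀| ≤ r → ‖y - y₀‖ ≤ r → |s - s₀| ≤ r →
      U x t + V y s ≤ U x₀ t₀ + V y₀ s₀ + ⟪P, x - x₀⟫ + ⟪Q, y - y₀⟫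
        + κ / 2 * ‖(x - x₀) - (y - y₀)‖ ^ 2 + β * (‖x - x₀‖ ^ 2 + ‖y - y₀‖ ^ 2)
        + c * ((t - t₀) - (s - s₀)) + k * ((t - t₀) - (s - s₀)) ^ 2) {ε : ℝ} (hε : 0 < ε) :
    ∃ (x₁ y₁ P₁ Q₁ b₁ b₂ : E) (t₁ s₁ a₁ a₂ c₁ c₂ : ℝ) (X Y : E →L[ℝ] E),
      ‖x₁ - x₀‖ < ε ∧ ‖y₁ - y₀‖ < ε ∧ |t₁ - t₀| < ε ∧ |s₁ - s₀| < ε ∧ ‖P₁ - P‖ < ε ∧ ‖Q₁ - Q‖ < ε ∧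
      |a₁ + a₂| < ε ∧
      (∀ᶠ z : E × ℝ in nhds (x₁, t₁), U z.1 z.2 ≤ U x₁ t₁ + ⟪P₁, z.1 - x₁⟫
        + ⟪X (z.1 - x₁), z.1 - x₁⟫ / 2 + a₁ * (z.2 - t₁) + (z.2 - t₁) * ⟪b₁, z.1 - x₁⟫
        + c₁ * (z.2 - t₁) ^ 2) ∧
      (∀ᶠ z : E × ℝ in nhds (y₁, s₁), V z.1 z.2 ≤ V y₁ s₁ + ⟪Q₁, z.1 - y₁⟫
        + ⟪Y (z.1 - y₁), z.1 - y₁⟫ / 2 + a₂ * (z.2 - s₁) + (z.2 - s₁) * ⟪b₂, z.1 - y₁⟫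
        + c₂ * (z.2 - s₁) ^ 2) ∧
      (∀ a b, ⟪X a, a⟫ + ⟪Y b, b⟫ ≤ 2 * κ * ‖a - b‖ ^ 2 + (2 * β + ε) * (‖a‖ ^ 2 + ‖b‖ ^ 2)) ∧
      (∀ a, -(4 * κ) * ‖a‖ ^ 2 ≤ ⟪X a, a⟫) ∧ ∀ a, -(4 * κ) * ‖a‖ ^ 2 ≤ ⟪Y a, a⟫ := by
  set θ := √(κ / (2 * k)) with hθdef
  have hθ : 0 < θ := Real.sqrt_pos.2 (by positivity)
  have hθ2 : k * θ ^ 2 = κ / 2 := by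
    rw [hθdef, Real.sq_sqrt (by positivity)]; field_simp
  set ρ := min r (r / θ) with hρ
  have hρ0 : 0 < ρ := by positivity
  have hfst : ∀ ξ : WithLp 2 (E × ℝ), ‖ξ‖ ≤ ρ → ‖ξ.fst‖ ≤ r := fun ξ h =>
    ((WithLp.norm_fst_le E ξ).trans h).trans (min_le_left _ _)
  have hsnd : ∀ ξ : WithLp 2 (E × ℝ), ‖ξ‖ ≤ ρ → |θ * ξ.snd| ≤ r := fun ξ h => by
    have h1 := ((WithLp.norm_snd_le E ξ).trans h).trans (min_le_right _ _)
    rw [Real.norm_eq_abs, le_div_iff₀ hθ] at h1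
    rw [abs_mul, abs_of_pos hθ]; linarith
  set ε' := min (ε / 2) (min (ε / 2 / θ) (min (ε / 2 * θ) (ε / (4 * β + 2)))) with hε'
  have hε0 : 0 < ε' := by positivity
  have m1 : ε' ≤ ε / 2 := min_le_left _ _
  have m2 : ε' * θ ≤ ε / 2 := (le_div_iff₀ hθ).1 ((min_le_right _ _).trans (min_le_left _ _))
  have m3 : ε' / θ ≤ ε / 2 :=
    (div_le_iff₀ hθ).2 ((min_le_right _ _).trans ((min_le_right _ _).trans (min_le_left _ _)))
  have m4 : ε' * (4 * β + 2) ≤ ε := (le_div_iff₀ (by positivity)).1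
    ((min_le_right _ _).trans ((min_le_right _ _).trans (min_le_right _ _)))
  obtain ⟨ξ, η, p, q, X, Y, hξ, hη, hp, hq, jX, jY, hXY, hX, hY⟩ := exists_jets_of_sum_le
    (w₁ := recentre U x₀ t₀ P c β θ) (w₂ := recentre V y₀ s₀ Q (-c) β θ) (ρ := ρ) (κ := κ) hρ0 hκ
    (recentre_usc hU fun ξ h => htI _ (by simpa using hsnd ξ h))
    (recentre_usc hV fun ξ h => hsI _ (by simpa using hsnd ξ h))
    (recentre_zero _ _ _ _ _ _ _) (recentre_zero _ _ _ _ _ _ _) (by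
      intro ξ hξ η hη
      rw [mem_closedBall_zero_iff] at hξ hη
      have h := hle (x₀ + ξ.fst) (t₀ + θ * ξ.snd) (y₀ + η.fst) (s₀ + θ * η.snd)
        (by simpa using hfst ξ hξ) (by simpa using hsnd ξ hξ) (by simpa using hfst η hη)
        (by simpa using hsnd η hη)
      simp only [add_sub_cancel_left] at h
      have h2 : ‖ξ - η‖ ^ 2 = ‖ξ.fst - η.fst‖ ^ 2 + (ξ.snd - η.snd) ^ 2 := by
        rw [WithLp.prod_norm_sq_eq_of_L2]; simp
      have h3 : k * (θ * ξ.snd - θ * η.snd) ^ 2 = κ / 2 * (ξ.snd - η.snd) ^ 2 := by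
        rw [← hθ2]; ring
      simp only [recentre]
      rw [h2]
      linarith) hε0
  have hδ : 0 < ε / 8 := by positivity
  obtain ⟨b₁, c₁, J₁⟩ := jet_of_recentre hθ (jX _ hδ)
  obtain ⟨b₂, c₂, J₂⟩ := jet_of_recentre hθ (jY _ hδ)
  have hsm : ∀ ξ : WithLp 2 (E × ℝ), ‖ξ‖ < ε' → |θ * ξ.snd| < ε := fun ξ h => by
    have h1 := (WithLp.norm_snd_le E ξ).trans h.le
    rw [Real.norm_eq_abs] at h1
    rw [abs_mul, abs_of_pos hθ]
    nlinarith
  have hgr : ∀ ξ p : WithLp 2 (E × ℝ), ‖ξ‖ < ε' → ‖p‖ < ε' → ∀ R : E,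
      ‖R + p.fst + (2 * β) • ξ.fst - R‖ < ε := fun ξ p h h' R => by
    have h1 := (WithLp.norm_fst_le E ξ).trans_lt h
    have h2 := (WithLp.norm_fst_le E p).trans_lt h'
    have h3 : R + p.fst + (2 * β) • ξ.fst - R = p.fst + (2 * β) • ξ.fst := by abel
    rw [h3]
    refine (norm_add_le _ _).trans_lt ?_
    rw [norm_smul, Real.norm_eq_abs, abs_of_nonneg (by positivity)]
    nlinarith
  have hpt : ∀ p : WithLp 2 (E × ℝ), ‖p‖ < ε' → |p.snd / θ| < ε / 2 := fun p h => by
    have h1 := (WithLp.norm_snd_le E p).trans_lt h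
    rw [Real.norm_eq_abs] at h1
    rw [abs_div, abs_of_pos hθ]
    exact (div_lt_div_of_pos_right h1 hθ).trans_le m3
  have hJn : ∀ a : E, ‖spaceIncl E a‖ ^ 2 = ‖a‖ ^ 2 := fun a => by
    rw [spaceIncl_apply, WithLp.prod_norm_sq_eq_of_L2]; simp
  refine ⟨x₀ + ξ.fst, y₀ + η.fst, _, _, b₁, b₂, t₀ + θ * ξ.snd, s₀ + θ * η.snd, _, _, c₁, c₂, _, _,
    ?_, ?_, ?_, ?_, hgr ξ p hξ hp P, hgr η q hη hq Q, ?_, J₁, J₂, fun a b => ?_, fun a => ?_, fun a => ?_⟩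
  · rw [add_sub_cancel_left]; linarith [(WithLp.norm_fst_le E ξ).trans_lt hξ]
  · rw [add_sub_cancel_left]; linarith [(WithLp.norm_fst_le E η).trans_lt hη]
  · rw [add_sub_cancel_left]; exact hsm ξ hξ
  · rw [add_sub_cancel_left]; exact hsm η hη
  · have h1 := hpt p hp
    have h2 := hpt q hq
    have h3 : c + p.snd / θ + (-c + q.snd / θ) = p.snd / θ + q.snd / θ := by ring
    rw [h3]
    linarith [abs_add_le (p.snd / θ) (q.snd / θ)]
  · have h := hXY (spaceIncl E a) (spaceIncl E b)
    rw [← map_sub, hJn, hJn, hJn, ← inner_spaceBlock, ← inner_spaceBlock] at h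
    simp only [add_apply, smul_apply, ContinuousLinearMap.id_apply, inner_add_left,
      real_inner_smul_left, real_inner_self_eq_norm_sq]
    have h2 : 0 ≤ ‖a‖ ^ 2 + ‖b‖ ^ 2 := by positivity
    nlinarith
  all_goals
    simp only [add_apply, smul_apply, ContinuousLinearMap.id_apply, inner_add_left,
      real_inner_smul_left, real_inner_self_eq_norm_sq]
    have h2 : 0 ≤ (2 * β + 2 * (ε / 8)) * ‖a‖ ^ 2 := by positivity
  · have h := hX (spaceIncl E a)
    rw [hJn, ← inner_spaceBlock] at h
    linarith
  · have h := hY (spaceIncl E a)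
    rw [hJn, ← inner_spaceBlock] at h
    linarith

end ParabolicJets

section StructureEstimates

theorem rpow_le_of_comparable {a b s : ℝ} (hb : 0 < b) (h1 : b / 2 ≤ a) (h2 : a ≤ 2 * b) :
    a ^ s ≤ 2 ^ |s| * b ^ s := by
  have ha : 0 < a := by linarith
  rcases le_total 0 s with hs | hs
  · rw [abs_of_nonneg hs, ← Real.mul_rpow (by norm_num) hb.le]
    exact Real.rpow_le_rpow ha.le h2 hs
  · rw [abs_of_nonpos hs]
    refine (Real.rpow_le_rpow_of_nonpos (by positivity) h1 hs).trans (le_of_eq ?_)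
    rw [div_eq_mul_inv, Real.mul_rpow hb.le (by norm_num), Real.inv_rpow (by norm_num),
      Real.rpow_neg (by norm_num)]
    ring

variable {F : EucSp N → EucSp N → MatN N → ℝ} {α a A : ℝ}

theorem fromBlocks_posSemidef {P Q R S : MatN N} (hsymm : (Matrix.fromBlocks P Q R S).IsSymm)
    (h : ∀ v w : Fin N → ℝ, 0 ≤ v ⬝ᵥ P.mulVec v + v ⬝ᵥ Q.mulVec w + w ⬝ᵥ R.mulVec v
      + w ⬝ᵥ S.mulVec w) : (Matrix.fromBlocks P Q R S).PosSemidef := by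
  refine Matrix.PosSemidef.of_dotProduct_mulVec_nonneg ?_ fun v => ?_
  · rwa [Matrix.IsHermitian, Matrix.conjTranspose_eq_transpose_of_trivial]
  · have h1 := h (v ∘ Sum.inl) (v ∘ Sum.inr)
    rw [star_trivial, Matrix.fromBlocks_mulVec]
    have : v ⬝ᵥ Sum.elim (P.mulVec (v ∘ Sum.inl) + Q.mulVec (v ∘ Sum.inr))
        (R.mulVec (v ∘ Sum.inl) + S.mulVec (v ∘ Sum.inr)) =
        (v ∘ Sum.inl) ⬝ᵥ P.mulVec (v ∘ Sum.inl) + (v ∘ Sum.inl) ⬝ᵥ Q.mulVec (v ∘ Sum.inr)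
        + (v ∘ Sum.inr) ⬝ᵥ R.mulVec (v ∘ Sum.inl) + (v ∘ Sum.inr) ⬝ᵥ S.mulVec (v ∘ Sum.inr) := by
      rw [add_assoc ((v ∘ Sum.inl) ⬝ᵥ P.mulVec (v ∘ Sum.inl) + _), ← dotProduct_add, ← dotProduct_add]
      simp [dotProduct, Fintype.sum_sum_type]
    rw [this]; exact h1

theorem H3.exists_form_modulus (h : H3 univ F) :
    ∃ ω : ℝ → ℝ, Continuous ω ∧ ω 0 = 0 ∧ ∀ (X Y : EucSp N →L[ℝ] EucSp N) (ζ : ℝ), 0 < ζ →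
      (∀ b, -ζ * ‖b‖ ^ 2 ≤ ⟪X b, b⟫) → (∀ b, -ζ * ‖b‖ ^ 2 ≤ ⟪Y b, b⟫) →
      (∀ b c, ⟪X b, b⟫ + ⟪Y c, c⟫ ≤ 4 * ζ * ‖b - c‖ ^ 2) → ∀ x y, x ≠ y →
      F x (ζ • (x - y)) (symMat X) - F y (ζ • (x - y)) (symMat (-Y)) ≤ ω (ζ * ‖x - y‖ ^ 2) := by
  obtain ⟨ω, hω, hω0, hF⟩ := h
  refine ⟨ω, hω, hω0, fun X Y ζ hζ hX hY hXY x y hxy => ?_⟩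
  have hn : ∀ v : Fin N → ℝ, v ⬝ᵥ v = ‖(WithLp.toLp 2 v : EucSp N)‖ ^ 2 := fun v => by
    rw [EuclideanSpace.norm_sq_eq]
    simp [dotProduct, sq]
  have hs : ∀ X : EucSp N →L[ℝ] EucSp N, (symMat X).transpose = symMat X := symMat_isSymm
  rw [symMat_neg]
  refine hF _ _ (symMat_isSymm X) (symMat_isSymm Y) ζ hζ ?_ ?_ x (mem_univ _) y (mem_univ _) hxy
  · rw [← Matrix.fromBlocks_one, Matrix.fromBlocks_smul, Matrix.fromBlocks_add]
    refine fromBlocks_posSemidef ?_ fun v w => ?_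
    · simp [Matrix.IsSymm, Matrix.fromBlocks_transpose, hs]
    · simp only [Matrix.add_mulVec, dotProduct_add, dotProduct_symMat, smul_zero, add_zero,
        Matrix.zero_mulVec, dotProduct_zero, Matrix.smul_mulVec, Matrix.one_mulVec, dotProduct_smul,
        hn, smul_eq_mul]
      linarith [hX (WithLp.toLp 2 v), hY (WithLp.toLp 2 w)]
  · rw [Matrix.fromBlocks_smul, sub_eq_add_neg, Matrix.fromBlocks_neg, Matrix.fromBlocks_add]
    refine fromBlocks_posSemidef ?_ fun v w => ?_
    · simp [Matrix.IsSymm, Matrix.fromBlocks_transpose, hs]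
    · have e := hXY (WithLp.toLp 2 v) (WithLp.toLp 2 w)
      have e2 : ‖(WithLp.toLp 2 v : EucSp N) - WithLp.toLp 2 w‖ ^ 2
          = v ⬝ᵥ v - v ⬝ᵥ w - w ⬝ᵥ v + w ⬝ᵥ w := by
        rw [← WithLp.toLp_sub, ← hn, sub_dotProduct, dotProduct_sub, dotProduct_sub]; ring
      rw [e2] at e
      simp only [Matrix.add_mulVec, dotProduct_add, Matrix.neg_mulVec, dotProduct_neg,
        dotProduct_symMat, neg_zero, add_zero,
        Matrix.smul_mulVec, Matrix.one_mulVec, dotProduct_smul, smul_eq_mul]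
      linarith

set_option maxHeartbeats 1000000 in
theorem exists_far_bound (h1 : H1 univ F α) (h2 : H2 univ F α a A) (h3 : H3 univ F) (h6 : H6 F α)
    {Γ : ℝ} (hΓ : 0 < Γ) :
    ∃ ω : ℝ → ℝ, Continuous ω ∧ ω 0 = 0 ∧ ∃ K, 0 ≤ K ∧ ∀ (x y P R e : EucSp N)
      (X Y : EucSp N →L[ℝ] EucSp N) (c ζ μ : ℝ), 0 < c → 0 < ζ → 16 * ζ ≤ ‖e‖ → 0 ≤ μ →
      μ ≤ Γ * c → ‖x - y - e‖ ≤ 2 * ζ → ‖P - c • e‖ ≤ c * ζ → ‖R - c • e‖ ≤ c * ζ →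
      (∀ b d, ⟪X b, b⟫ + ⟪Y d, d⟫ ≤ 2 * (Γ * c) * ‖b - d‖ ^ 2 + μ * (‖b‖ ^ 2 + ‖d‖ ^ 2)) →
      (∀ b, -(4 * (Γ * c)) * ‖b‖ ^ 2 ≤ ⟪X b, b⟫) → (∀ b, -(4 * (Γ * c)) * ‖b‖ ^ 2 ≤ ⟪Y b, b⟫) →
      F x P (symMat X) - F y R (symMat (-Y)) ≤ ω (c * ‖x - y‖ ^ 2)
        + K * ((c * ‖e‖) ^ (α - 1) * c ^ 2 * ζ + (c * ‖e‖) ^ α * μ) := by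
  obtain ⟨ω, hω, hω0, hF⟩ := h3.exists_form_modulus
  obtain ⟨C, hC, h6⟩ := h6
  have hA : 0 ≤ A := h2.1.le.trans h2.2.1
  refine ⟨fun r => ((5 * Γ) ^ α)⁻¹ * ω (5 * Γ * r), by fun_prop, by simp [hω0],
    2 * (C * 2 ^ |α - 1| * 3 * (N * (5 * Γ))) + 2 * (A * N * 2 ^ |α|), by positivity, ?_⟩
  intro x y P R e X Y c ζ μ hc hζ hζe hμ hμc hxy hP hR hXY hX hY
  set z := ‖e‖ with hz
  have hz0 : 0 < z := by linarith
  set κ := Γ * c with hκ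
  have hκ0 : 0 < κ := by positivity
  set I := ContinuousLinearMap.id ℝ (EucSp N) with hI
  set X' := X - μ • I with hX'
  set Y' := Y - μ • I with hY'
  have fX : ∀ b, ⟪X' b, b⟫ = ⟪X b, b⟫ - μ * ‖b‖ ^ 2 := fun b => by
    rw [hX', sub_apply, inner_sub_left, smul_id_form]
  have fY : ∀ b, ⟪Y' b, b⟫ = ⟪Y b, b⟫ - μ * ‖b‖ ^ 2 := fun b => by
    rw [hY', sub_apply, inner_sub_left, smul_id_form]
  have fn : ∀ (Z : EucSp N →L[ℝ] EucSp N) b, ⟪(-Z) b, b⟫ = -⟪Z b, b⟫ := fun Z b => by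
    rw [neg_apply, inner_neg_left]
  have hsum : ∀ b d, ⟪X' b, b⟫ + ⟪Y' d, d⟫ ≤ 2 * κ * ‖b - d‖ ^ 2 := fun b d => by
    rw [fX, fY]; linarith [hXY b d]
  have mb : ∀ b : EucSp N, 0 ≤ μ * ‖b‖ ^ 2 ∧ μ * ‖b‖ ^ 2 ≤ κ * ‖b‖ ^ 2 := fun b =>
    ⟨by positivity, by gcongr⟩
  have hlX : ∀ b, -(5 * κ) * ‖b‖ ^ 2 ≤ ⟪X' b, b⟫ := fun b => by
    rw [fX]; linarith [hX b, (mb b).1, (mb b).2]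
  have hlY : ∀ b, -(5 * κ) * ‖b‖ ^ 2 ≤ ⟪Y' b, b⟫ := fun b => by
    rw [fY]; linarith [hY b, (mb b).1, (mb b).2]
  have huX : ∀ b, |⟪X' b, b⟫| ≤ 5 * κ * ‖b‖ ^ 2 := fun b => by
    have := hsum b 0
    simp only [map_zero, inner_zero_left, add_zero, sub_zero] at this
    rw [abs_le]; constructor <;> linarith [hlX b, (mb b).1, (mb b).2]
  have huY : ∀ b, |⟪(-Y') b, b⟫| ≤ 5 * κ * ‖b‖ ^ 2 := fun b => by
    have := hsum 0 b
    simp only [map_zero, inner_zero_left, zero_add, zero_sub, norm_neg] at this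
    rw [fn, abs_neg, abs_le]; constructor <;> linarith [hlY b, (mb b).1, (mb b).2]
  have hd1 : z / 2 ≤ ‖x - y‖ := by
    have := norm_sub_norm_le e (x - y)
    rw [norm_sub_rev e (x - y)] at this; linarith
  have hd2 : ‖x - y‖ ≤ 2 * z := by
    have := norm_sub_norm_le (x - y) e
    linarith
  have hd3 : 14 * ζ ≤ ‖x - y‖ := by
    have := norm_sub_norm_le e (x - y)
    rw [norm_sub_rev e (x - y)] at this; linarith
  set Q := c • (x - y) with hQ
  have hQn : ‖Q‖ = c * ‖x - y‖ := by rw [hQ, norm_smul, Real.norm_eq_abs, abs_of_pos hc]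
  have hQz : 0 < c * z := by positivity
  have hQ0 : Q ≠ 0 := by
    rw [← norm_pos_iff, hQn]; exact mul_pos hc (by linarith)
  have hQpow : ‖Q‖ ^ (α - 1) ≤ 2 ^ |α - 1| * (c * z) ^ (α - 1) :=
    rpow_le_of_comparable hQz (by rw [hQn]; nlinarith) (by rw [hQn]; nlinarith)
  have grad : ∀ (w R : EucSp N) (Z : EucSp N →L[ℝ] EucSp N), ‖R - c • e‖ ≤ c * ζ →
      (∀ b, |⟪Z b, b⟫| ≤ 5 * κ * ‖b‖ ^ 2) → R ≠ 0 ∧ ‖R‖ ^ α ≤ 2 ^ |α| * (c * z) ^ α ∧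
      |F w R (symMat Z) - F w Q (symMat Z)| ≤
        C * 2 ^ |α - 1| * 3 * (N * (5 * Γ)) * ((c * z) ^ (α - 1) * c ^ 2 * ζ) := by
    intro w R Z hR hZ
    have hce : ‖c • e‖ = c * z := by rw [norm_smul, Real.norm_eq_abs, abs_of_pos hc]
    have r1 := norm_sub_norm_le (c • e) R
    rw [norm_sub_rev (c • e) R, hce] at r1
    have r2 := norm_sub_norm_le R (c • e)
    rw [hce] at r2
    have r3 := mul_le_mul_of_nonneg_left hζe hc.le
    have r4 : 0 < c * ζ := by positivity
    refine ⟨norm_pos_iff.1 (by linarith), rpow_le_of_comparable hQz (by linarith) (by linarith), ?_⟩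
    have hdiff : ‖R - Q‖ ≤ 3 * (c * ζ) := by
      have : R - Q = (R - c • e) - c • (x - y - e) := by rw [hQ, smul_sub c (x - y) e]; abel
      rw [this]
      refine (norm_sub_le _ _).trans ?_
      rw [norm_smul, Real.norm_eq_abs, abs_of_pos hc]
      nlinarith
    have h := h6 w Q hQ0 (R - Q) (by rw [hQn]; nlinarith) (symMat Z) (symMat_isSymm Z)
    rw [add_sub_cancel] at h
    refine h.trans ?_
    have hf := frobNorm_symMat_le (by positivity) hZ
    calc C * ‖Q‖ ^ (α - 1) * ‖R - Q‖ * frobNorm (symMat Z)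
        ≤ C * (2 ^ |α - 1| * (c * z) ^ (α - 1)) * (3 * (c * ζ)) * (N * (5 * κ)) := by
          have : 0 ≤ frobNorm (symMat Z) := Real.sqrt_nonneg _
          gcongr
      _ = _ := by rw [hκ]; ring
  obtain ⟨hP0, hPα, hPF⟩ := grad x P X' hP huX
  obtain ⟨hR0, hRα, hRF⟩ := grad y R (-Y') hR huY
  have s1 := h2.sub_le x hP0 (X := X') (Y := X) (b := μ)
    (fun v => by rw [fX]; linarith [(mb v).1, (mb v).2]) (fun v => by rw [fX]; linarith)
  have s2 := h2.sub_le y hR0 (X := -Y) (Y := -Y') (b := μ)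
    (fun v => by rw [fn, fn, fY]; linarith [(mb v).1, (mb v).2]) (fun v => by rw [fn, fn, fY]; linarith)
  have hAN : 0 ≤ A * N := by positivity
  have s3 : A * N * (‖P‖ ^ α * μ) ≤ A * N * 2 ^ |α| * ((c * z) ^ α * μ) := by
    calc A * N * (‖P‖ ^ α * μ) ≤ A * N * (2 ^ |α| * (c * z) ^ α * μ) := by gcongr
      _ = _ := by ring
  have s4 : A * N * (‖R‖ ^ α * μ) ≤ A * N * 2 ^ |α| * ((c * z) ^ α * μ) := by
    calc A * N * (‖R‖ ^ α * μ) ≤ A * N * (2 ^ |α| * (c * z) ^ α * μ) := by gcongr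
      _ = _ := by ring
  have hxy0 : x ≠ y := fun h => by
    rw [h, sub_self, norm_zero] at hd3; linarith
  have s5 := hF X' Y' (5 * κ) (by positivity) hlX hlY
    (fun b d => (hsum b d).trans (by gcongr <;> linarith)) x y hxy0
  have e1 : (5 * κ) • (x - y) = (5 * Γ) • Q := by rw [hQ, smul_smul, hκ]; ring_nf
  have hom : ∀ (w : EucSp N) (Z : EucSp N →L[ℝ] EucSp N),
      F w ((5 * Γ) • Q) (symMat Z) = (5 * Γ) ^ α * F w Q (symMat Z) := fun w Z => by
    have := h1 w (mem_univ _) Q hQ0 (symMat Z) (symMat_isSymm Z) (5 * Γ) (by positivity) 1 zero_le_one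
    rw [one_smul, abs_of_pos (by positivity), mul_one] at this
    exact this
  rw [e1, hom, hom, ← mul_sub, hκ, ← mul_assoc 5 Γ c, mul_assoc (5 * Γ) c] at s5
  have hpow : 0 < (5 * Γ) ^ α := by positivity
  have s6 : F x Q (symMat X') - F y Q (symMat (-Y')) ≤
      ((5 * Γ) ^ α)⁻¹ * ω (5 * Γ * (c * ‖x - y‖ ^ 2)) := by
    rw [← div_eq_inv_mul, le_div_iff₀' hpow]; exact s5
  have s7 := (abs_le.1 hPF).2
  have s8 := (abs_le.1 hRF).1
  have s9 : 0 ≤ C * 2 ^ |α - 1| * 3 * (N * (5 * Γ)) * ((c * z) ^ α * μ) := by positivity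
  have s10 : 0 ≤ A * N * 2 ^ |α| * ((c * z) ^ (α - 1) * c ^ 2 * ζ) := by positivity
  beta_reduce
  rw [add_mul, mul_add, mul_add]
  linarith

theorem exists_near_bound (h1 : H1 univ F α) (h2 : H2 univ F α a A) {Γ : ℝ} (hΓ : 0 < Γ) :
    ∃ K, 0 ≤ K ∧ ∀ (x y P R e : EucSp N)
      (X Y : EucSp N →L[ℝ] EucSp N) (c μ : ℝ), 0 < c → e ≠ 0 → 0 ≤ μ → μ ≤ Γ * c →
      ‖P - c • e‖ ≤ c * ‖e‖ / 2 → ‖R - c • e‖ ≤ c * ‖e‖ / 2 →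
      (∀ b d, ⟪X b, b⟫ + ⟪Y d, d⟫ ≤ 2 * (Γ * c) * ‖b - d‖ ^ 2 + μ * (‖b‖ ^ 2 + ‖d‖ ^ 2)) →
      (∀ b, -(4 * (Γ * c)) * ‖b‖ ^ 2 ≤ ⟪X b, b⟫) → (∀ b, -(4 * (Γ * c)) * ‖b‖ ^ 2 ≤ ⟪Y b, b⟫) →
      F x P (symMat X) - F y R (symMat (-Y)) ≤ K * ((c * ‖e‖) ^ α * c) := by
  have hA : 0 ≤ A := h2.1.le.trans h2.2.1
  refine ⟨2 * (A * N * (2 ^ |α| * (5 * Γ))), by positivity, ?_⟩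
  intro x y P R e X Y c μ hc he hμ hμc hP hR hXY hX hY
  have hce : ‖c • e‖ = c * ‖e‖ := by rw [norm_smul, Real.norm_eq_abs, abs_of_pos hc]
  have hpos : 0 < c * ‖e‖ := mul_pos hc (norm_pos_iff.2 he)
  have mb : ∀ b : EucSp N, 0 ≤ μ * ‖b‖ ^ 2 ∧ μ * ‖b‖ ^ 2 ≤ Γ * c * ‖b‖ ^ 2 := fun b =>
    ⟨by positivity, by gcongr⟩
  have huX : ∀ b, |⟪X b, b⟫| ≤ 5 * (Γ * c) * ‖b‖ ^ 2 := fun b => by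
    have := hXY b 0
    simp only [map_zero, inner_zero_left, add_zero, sub_zero, norm_zero] at this
    rw [abs_le]; constructor <;> linarith [hX b, (mb b).1, (mb b).2]
  have huY : ∀ b, |⟪(-Y) b, b⟫| ≤ 5 * (Γ * c) * ‖b‖ ^ 2 := fun b => by
    have := hXY 0 b
    simp only [map_zero, inner_zero_left, zero_add, zero_sub, norm_neg, norm_zero] at this
    rw [neg_apply, inner_neg_left, abs_neg, abs_le]
    constructor <;> linarith [hY b, (mb b).1, (mb b).2]
  have main : ∀ (w R : EucSp N) (Z : EucSp N →L[ℝ] EucSp N), ‖R - c • e‖ ≤ c * ‖e‖ / 2 →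
      (∀ b, |⟪Z b, b⟫| ≤ 5 * (Γ * c) * ‖b‖ ^ 2) →
      |F w R (symMat Z)| ≤ A * N * (2 ^ |α| * (5 * Γ)) * ((c * ‖e‖) ^ α * c) := by
    intro w R Z hR hZ
    have r1 := norm_sub_norm_le (c • e) R
    rw [norm_sub_rev (c • e) R, hce] at r1
    have r2 := norm_sub_norm_le R (c • e)
    rw [hce] at r2
    have r3 := rpow_le_of_comparable (a := ‖R‖) (s := α) hpos (by linarith) (by linarith)
    refine (h2.abs_form_le h1 w (norm_pos_iff.1 (by linarith)) hZ).trans ?_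
    calc A * N * (‖R‖ ^ α * (5 * (Γ * c)))
        ≤ A * N * (2 ^ |α| * (c * ‖e‖) ^ α * (5 * (Γ * c))) := by gcongr
      _ = _ := by ring
  have m1 := (abs_le.1 (main x P X hP huX)).2
  have m2 := (abs_le.1 (main y R (-Y) hR huY)).1
  linarith

end StructureEstimates

section GradientTerm

theorem continuous_norm_rpow_smul {E : Type*} [NormedAddCommGroup E] [NormedSpace ℝ E] {α : ℝ}
    (hα : -1 < α) : Continuous fun p : E => ‖p‖ ^ α • p := by
  refine continuous_iff_continuousAt.2 fun p => ?_
  by_cases hp : p = 0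
  · subst hp
    rw [ContinuousAt, smul_zero, tendsto_zero_iff_norm_tendsto_zero]
    have h : Continuous fun p : E => ‖p‖ ^ (1 + α) :=
      continuous_norm.rpow_const fun _ => Or.inr (by linarith)
    have h0 := h.tendsto 0
    rw [norm_zero, Real.zero_rpow (by linarith)] at h0
    refine squeeze_zero (fun _ => norm_nonneg _) (fun p => ?_) h0
    by_cases hp : p = 0
    · subst hp; simp; positivity
    · rw [norm_smul, Real.norm_eq_abs, abs_of_nonneg (by positivity),
        Real.rpow_add (norm_pos_iff.2 hp), Real.rpow_one, mul_comm]
  · exact ((continuous_norm.continuousAt).rpow_const (Or.inl (norm_ne_zero_iff.2 hp))).smul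
      continuousAt_id

variable {h : EucSp N → ℝ → EucSp N} {α T : ℝ}

theorem gradTerm_eq_inner (x : EucSp N) (t : ℝ) (p : EucSp N) :
    gradTerm h α x t p = ⟪h x t, ‖p‖ ^ α • p⟫ := by
  rw [gradTerm, inner_smul_right, mul_comm]

theorem exists_gradTerm_modulus (hα : -1 < α) {H : ℝ}
    (hH : ∀ x, ∀ t ∈ Ioo 0 T, ‖h x t‖ ≤ H) (R : ℝ) {ε : ℝ} (hε : 0 < ε) :
    ∃ δ > 0, ∀ x, ∀ t ∈ Ioo 0 T, ∀ p p' : EucSp N, ‖p'‖ ≤ R → ‖p - p'‖ ≤ δ →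
      |gradTerm h α x t p - gradTerm h α x t p'| ≤ ε := by
  have hu := (isCompact_closedBall (0 : EucSp N) (R + 1)).uniformContinuousOn_of_continuous
    (continuous_norm_rpow_smul hα).continuousOn
  obtain ⟨δ, hδ, hd⟩ := Metric.uniformContinuousOn_iff.1 hu (ε / (|H| + 1)) (by positivity)
  refine ⟨min 1 (δ / 2), by positivity, fun x t ht p p' hp' hpp => ?_⟩
  have h1 := hpp.trans (min_le_left _ _)
  have h2 := hpp.trans (min_le_right _ _)
  have h3 := norm_le_norm_add_norm_sub' p p'
  have h4 := hd p (by rw [mem_closedBall_zero_iff]; linarith) p'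
    (by rw [mem_closedBall_zero_iff]; linarith) (by rw [dist_eq_norm]; linarith)
  rw [dist_eq_norm] at h4
  rw [gradTerm_eq_inner, gradTerm_eq_inner, ← inner_sub_right]
  refine (abs_real_inner_le_norm _ _).trans ?_
  calc ‖h x t‖ * ‖‖p‖ ^ α • p - ‖p'‖ ^ α • p'‖ ≤ (|H| + 1) * (ε / (|H| + 1)) := by
        gcongr
        exact (hH x t ht).trans ((le_abs_self H).trans (by linarith))
    _ = ε := by field_simp

theorem H5.exists_gradTerm_sub_le (h5 : H5 univ T h α) :
    ∃ γ : ℝ, 0 < γ ∧ ∃ K, 0 ≤ K ∧ ∀ x y, ∀ t ∈ Ioo 0 T, ∀ s ∈ Ioo 0 T, ∀ c > 0,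
      gradTerm h α x t (c • (x - y)) - gradTerm h α y s (c • (x - y)) ≤
        K * (|t - s| ^ γ * ‖c • (x - y)‖ ^ (1 + α)) + K * (c * ‖x - y‖ ^ 2) ^ (1 + α) := by
  obtain ⟨γ, hγ, -, K, hK, ht5, hn5, hp5⟩ := h5
  refine ⟨γ, hγ, K, hK.le, fun x y t ht s hs c hc => ?_⟩
  by_cases hxy : x = y
  · subst hxy
    simp only [sub_self, smul_zero, gradTerm, inner_zero_right, zero_mul]
    positivity
  have hd : 0 < ‖x - y‖ := norm_pos_iff.2 (sub_ne_zero.2 hxy)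
  have hn : ‖c • (x - y)‖ = c * ‖x - y‖ := by rw [norm_smul, Real.norm_eq_abs, abs_of_pos hc]
  have hp : 0 < ‖c • (x - y)‖ := by rw [hn]; positivity
  have e1 : gradTerm h α x t (c • (x - y)) - gradTerm h α x s (c • (x - y)) ≤
      K * (|t - s| ^ γ * ‖c • (x - y)‖ ^ (1 + α)) := by
    rw [gradTerm, gradTerm, ← sub_mul, ← inner_sub_left, Real.rpow_add hp, Real.rpow_one,
      ← mul_assoc, ← mul_assoc]
    gcongr
    exact (real_inner_le_norm _ _).trans
      (mul_le_mul_of_nonneg_right (ht5 x (mem_univ _) t ht s hs) (norm_nonneg _))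
  have e2 : gradTerm h α x s (c • (x - y)) - gradTerm h α y s (c • (x - y)) ≤
      K * (c * ‖x - y‖ ^ 2) ^ (1 + α) := by
    rw [gradTerm, gradTerm, ← sub_mul, ← inner_sub_left]
    rcases le_or_gt α 0 with h0 | h0
    · have : c * ‖x - y‖ ^ 2 = ‖x - y‖ * ‖c • (x - y)‖ := by rw [hn]; ring
      rw [this, Real.mul_rpow (by positivity) (by positivity), Real.rpow_add hp, Real.rpow_one,
        ← mul_assoc, ← mul_assoc]
      gcongr
      exact (real_inner_le_norm _ _).trans
        (mul_le_mul_of_nonneg_right (hn5 h0 x (mem_univ _) y (mem_univ _) s hs) (norm_nonneg _))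
    · refine le_trans (mul_nonpos_of_nonpos_of_nonneg ?_ (by positivity)) (by positivity)
      rw [inner_smul_right]
      exact mul_nonpos_of_nonneg_of_nonpos hc.le
        (hp5 h0 x (mem_univ _) y (mem_univ _) s hs)
  linarith

end GradientTerm

section SmallDifference

variable {F : EucSp N → EucSp N → MatN N → ℝ} {h : EucSp N → ℝ → EucSp N} {α a A T : ℝ}

/-- The factor of `z` in the gradient of `j * ‖z‖ ^ (2 * n + 4)`. -/
def powSlope (n : ℕ) (j z : ℝ) : ℝ := (2 * n + 4) * j * z ^ (2 * n + 2)

theorem powSlope_pos {n : ℕ} {j z : ℝ} (hj : 0 < j) (hz : 0 < z) : 0 < powSlope n j z := by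
  unfold powSlope; positivity

theorem powSlope_le {n : ℕ} {j z : ℝ} (hj : 0 < j) (hz : 0 < z) (hz1 : z ≤ 1) :
    powSlope n j z ≤ (2 * n + 4) * j := by
  unfold powSlope
  exact mul_le_of_le_one_right (by positivity) (pow_le_one₀ hz.le hz1)

theorem powSlope_rpow_mul_le {n : ℕ} {j z : ℝ} (hn : 2 ≤ (2 * n + 3) * (1 + α))
    (hj : 0 < j) (hz : 0 < z) (hz1 : z ≤ 1) :
    (powSlope n j z * z) ^ α * powSlope n j z ≤ ((2 * n + 4) * j) ^ (1 + α) * z := by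
  have hs : powSlope n j z * z = (2 * n + 4) * j * z ^ (2 * n + 3) := by unfold powSlope; ring
  have hsz : 0 < powSlope n j z * z := mul_pos (powSlope_pos hj hz) hz
  have e : (powSlope n j z * z) ^ α * powSlope n j z = (powSlope n j z * z) ^ (1 + α) * z⁻¹ := by
    rw [add_comm, Real.rpow_add hsz, Real.rpow_one]; field_simp
  rw [e, hs, Real.mul_rpow (by positivity) (by positivity), mul_assoc]
  gcongr
  rw [← Real.rpow_natCast, ← Real.rpow_mul hz.le, ← div_eq_mul_inv, div_le_iff₀ hz, ← sq,
    ← Real.rpow_natCast z 2]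
  exact Real.rpow_le_rpow_of_exponent_ge hz hz1 (by push_cast; exact hn)

theorem powSlope_rpow_mul_sq_le {n : ℕ} {j z : ℝ} (hn : 2 ≤ (2 * n + 3) * (1 + α))
    (hj : 0 < j) (hz : 0 < z) (hz1 : z ≤ 1) :
    (powSlope n j z * z) ^ (α - 1) * powSlope n j z ^ 2 ≤ ((2 * n + 4) * j) ^ (1 + α) := by
  have hsz : 0 < powSlope n j z * z := mul_pos (powSlope_pos hj hz) hz
  have e : (powSlope n j z * z) ^ (α - 1) * powSlope n j z ^ 2
      = (powSlope n j z * z) ^ α * powSlope n j z * z⁻¹ := by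
    have := powSlope_pos (n := n) hj hz
    rw [Real.rpow_sub_one hsz.ne']; field_simp
  rw [e, ← div_eq_mul_inv, div_le_iff₀ hz]
  exact powSlope_rpow_mul_le hn hj hz hz1

theorem exists_operator_sub_le (h1 : H1 univ F α) (h2 : H2 univ F α a A)
    (h3 : H3 univ F) (h6 : H6 F α) {n : ℕ} (hn : 2 ≤ (2 * n + 3) * (1 + α)) {Γ : ℝ} (hΓ : 0 < Γ) :
    ∃ ω : ℝ → ℝ, Continuous ω ∧ ω 0 = 0 ∧ ∃ K, 0 ≤ K ∧ ∀ (x y P R e : EucSp N)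
      (X Y : EucSp N →L[ℝ] EucSp N) (j c ζ μ : ℝ), 0 < j → e ≠ 0 → ‖e‖ ≤ 1 →
      c = powSlope n j ‖e‖ → 0 < ζ → 0 ≤ μ → μ ≤ Γ * c → ‖x - y - e‖ ≤ 2 * ζ →
      ‖P - c • e‖ ≤ c * ζ → ‖R - c • e‖ ≤ c * ζ →
      ‖P - c • e‖ ≤ c * ‖e‖ / 2 → ‖R - c • e‖ ≤ c * ‖e‖ / 2 →
      (∀ b d, ⟪X b, b⟫ + ⟪Y d, d⟫ ≤ 2 * (Γ * c) * ‖b - d‖ ^ 2 + μ * (‖b‖ ^ 2 + ‖d‖ ^ 2)) →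
      (∀ b, -(4 * (Γ * c)) * ‖b‖ ^ 2 ≤ ⟪X b, b⟫) → (∀ b, -(4 * (Γ * c)) * ‖b‖ ^ 2 ≤ ⟪Y b, b⟫) →
      F x P (symMat X) - F y R (symMat (-Y)) ≤ |ω (c * ‖x - y‖ ^ 2)|
        + K * (((2 * n + 4) * j) ^ (1 + α) * ζ + (c * ‖e‖) ^ α * μ) := by
  obtain ⟨ω, hω, hω0, K, hK, hfar⟩ := exists_far_bound h1 h2 h3 h6 hΓ
  obtain ⟨K', hK', hnear⟩ := exists_near_bound h1 h2 hΓ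
  refine ⟨ω, hω, hω0, K + 16 * K', by positivity, ?_⟩
  intro x y P R e X Y j c ζ μ hj he he1 hcs hζ hμ hμc hxy hP hR hP' hR' hXY hX hY
  have hz : 0 < ‖e‖ := norm_pos_iff.2 he
  have hc : 0 < c := hcs ▸ powSlope_pos hj hz
  have hb : 0 ≤ ((2 * n + 4) * j) ^ (1 + α) * ζ := by positivity
  have hb' : 0 ≤ (c * ‖e‖) ^ α * μ := by positivity
  rcases le_or_gt (16 * ζ) ‖e‖ with hfn | hfn
  · refine (hfar x y P R e X Y c ζ μ hc hζ hfn hμ hμc hxy hP hR hXY hX hY).trans ?_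
    have := powSlope_rpow_mul_sq_le hn hj hz he1
    rw [← hcs] at this
    refine add_le_add (le_abs_self _) (mul_le_mul (by linarith) ?_ (by positivity) (by positivity))
    gcongr
  · refine (hnear x y P R e X Y c μ hc he hμ hμc hP' hR' hXY hX hY).trans ?_
    have := powSlope_rpow_mul_le hn hj hz he1
    rw [← hcs] at this
    have h3 : (c * ‖e‖) ^ α * c ≤ 16 * (((2 * n + 4) * j) ^ (1 + α) * ζ) := by
      refine this.trans ?_
      have : 0 < ((2 * n + 4) * j) ^ (1 + α) := by positivity
      nlinarith
    have h4 := mul_le_mul_of_nonneg_left h3 hK'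
    have h5 : 0 ≤ K * (((2 * n + 4) * j) ^ (1 + α) * ζ + (c * ‖e‖) ^ α * μ) := by positivity
    have h6 : 0 ≤ 16 * K' * ((c * ‖e‖) ^ α * μ) := by positivity
    have h7 := abs_nonneg (ω (c * ‖x - y‖ ^ 2))
    rw [add_mul, mul_add (16 * K')]
    linarith

end SmallDifference

section SmallDifference

variable {F : EucSp N → EucSp N → MatN N → ℝ} {h : EucSp N → ℝ → EucSp N} {α a A T : ℝ}

theorem eventually_mul_rpow_le {K γ ε : ℝ} (hγ : 0 < γ) (hε : 0 < ε) :
    ∀ᶠ δ in nhdsWithin (0 : ℝ) (Ioi 0), K * δ ^ γ ≤ ε := by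
  have hc : Continuous fun δ : ℝ => K * δ ^ γ :=
    continuous_const.mul (continuous_id.rpow_const fun _ => Or.inr hγ.le)
  have h0 := hc.tendsto 0
  simp only [Real.zero_rpow hγ.ne', mul_zero] at h0
  exact nhdsWithin_le_nhds (h0.eventually_le_const hε)

theorem eventually_mul_le {K ε : ℝ} (hε : 0 < ε) :
    ∀ᶠ δ in nhdsWithin (0 : ℝ) (Ioi 0), K * δ ≤ ε := by
  simpa using eventually_mul_rpow_le (K := K) one_pos hε

set_option maxHeartbeats 1000000 in
theorem exists_right_side_sub_le (hα : -1 < α) (h1 : H1 univ F α) (h2 : H2 univ F α a A)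
    (h3 : H3 univ F) (h6 : H6 F α) (h5 : H5 univ T h α) {H : ℝ}
    (hH : ∀ x, ∀ t ∈ Ioo 0 T, ‖h x t‖ ≤ H)
    {n : ℕ} (hn : 2 ≤ (2 * n + 3) * (1 + α)) {Γ η : ℝ} (hΓ : 0 < Γ) (hη : 0 < η) :
    ∃ ν > 0, ∀ j > 0, ∃ δ > 0, ∀ ζ > 0, ζ ≤ δ → ∀ l > 0, ∃ m > 0,
      ∀ (x y P R e : EucSp N) (X Y : EucSp N →L[ℝ] EucSp N) (t s c μ : ℝ), l ≤ ‖e‖ → ‖e‖ ≤ 1 →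
      j * ‖e‖ ^ (2 * n + 4) ≤ ν → c = powSlope n j ‖e‖ → t ∈ Ioo 0 T →
      s ∈ Ioo 0 T → |t - s| ≤ δ → 0 ≤ μ → μ ≤ m → ‖x - y - e‖ ≤ 2 * ζ →
      ‖P - c • e‖ ≤ m → ‖R - c • e‖ ≤ m →
      (∀ b d, ⟪X b, b⟫ + ⟪Y d, d⟫ ≤ 2 * (Γ * c) * ‖b - d‖ ^ 2 + μ * (‖b‖ ^ 2 + ‖d‖ ^ 2)) →
      (∀ b, -(4 * (Γ * c)) * ‖b‖ ^ 2 ≤ ⟪X b, b⟫) → (∀ b, -(4 * (Γ * c)) * ‖b‖ ^ 2 ≤ ⟪Y b, b⟫) →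
      P ≠ 0 ∧ R ≠ 0 ∧ F x P (symMat X) + gradTerm h α x t P
        - F y R (symMat (-Y)) - gradTerm h α y s R ≤ η := by
  obtain ⟨ω, hω, hω0, K, hK, hF⟩ := exists_operator_sub_le h1 h2 h3 h6 hn hΓ
  obtain ⟨γ, hγ, K', hK', hh⟩ := h5.exists_gradTerm_sub_le
  have hη8 : 0 < η / 8 := by positivity
  have hω1 : ∀ᶠ r in nhdsWithin (0 : ℝ) (Ioi 0), |ω r| ≤ η / 8 := by
    have := (hω.abs).tendsto 0
    rw [hω0, abs_zero] at this
    exact nhdsWithin_le_nhds (this.eventually_le_const hη8)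
  obtain ⟨r₀, hr₀, hr⟩ := mem_nhdsGT_iff_exists_Ioc_subset.1
    (hω1.and (eventually_mul_rpow_le (K := K') (by linarith : 0 < 1 + α) hη8))
  have hr₀ : 0 < r₀ := hr₀
  refine ⟨r₀ / (4 * (2 * n + 4)), by positivity, fun j hj => ?_⟩
  set L := (2 * n + 4) * j with hL
  have hL0 : 0 < L := by positivity
  obtain ⟨δG, hδG, hG⟩ := exists_gradTerm_modulus hα hH (3 * L) hη8
  obtain ⟨δ, ⟨hδ1, hδ2, hδ3, hδ4, hδ5⟩, hδ0⟩ := (((eventually_mul_le (K := 1) one_pos).and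
    ((eventually_mul_le (K := 8 * L) (by positivity : 0 < r₀ / 2)).and
    ((eventually_mul_le (K := K * L ^ (1 + α)) hη8).and
    ((eventually_mul_rpow_le (K := K' * (3 * L) ^ (1 + α)) hγ hη8).and
    (eventually_mul_le (K := 3 * L) hδG))))).and self_mem_nhdsWithin).exists
  have hδ0 : 0 < δ := hδ0
  refine ⟨δ, hδ0, fun ζ hζ hζδ l hl => ?_⟩
  set d := powSlope n j l with hd
  have hd0 : 0 < d := powSlope_pos hj hl
  refine ⟨min (min (d * ζ) (d * l / 4)) (min (Γ * d) (η / 8 / (K * (L ^ (1 + α) / d) + 1))),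
    by positivity, ?_⟩
  have l1 := min_le_left (min (d * ζ) (d * l / 4))
    (min (Γ * d) (η / 8 / (K * (L ^ (1 + α) / d) + 1)))
  have l2 := min_le_right (min (d * ζ) (d * l / 4))
    (min (Γ * d) (η / 8 / (K * (L ^ (1 + α) / d) + 1)))
  have l3 := l1.trans (min_le_left _ _)
  have l4 := l1.trans (min_le_right _ _)
  have l5 := l2.trans (min_le_left _ _)
  have l6 := l2.trans (min_le_right _ _)
  generalize min (min (d * ζ) (d * l / 4))
    (min (Γ * d) (η / 8 / (K * (L ^ (1 + α) / d) + 1))) = m at *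
  intro x y P R e X Y t s c₀ μ hle he1 hje hc₀ ht hs hts hμ hμm hxy hP hR hXY hX hY
  have hz : 0 < ‖e‖ := hl.trans_le hle
  have he : e ≠ 0 := norm_pos_iff.1 hz
  have hc₀0 : 0 < c₀ := hc₀ ▸ powSlope_pos hj hz
  have hcL : c₀ ≤ L := hc₀ ▸ powSlope_le hj hz he1
  have hdc : d ≤ c₀ := by rw [hc₀, hd, powSlope, powSlope]; gcongr
  have hpow : (c₀ * ‖e‖) ^ α ≤ L ^ (1 + α) / d := by
    rw [le_div_iff₀ hd0]
    have h0 := powSlope_rpow_mul_le hn hj hz he1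
    rw [← hc₀] at h0
    calc (c₀ * ‖e‖) ^ α * d ≤ (c₀ * ‖e‖) ^ α * c₀ := by gcongr
      _ ≤ L ^ (1 + α) * ‖e‖ := h0
      _ ≤ L ^ (1 + α) := mul_le_of_le_one_right (by positivity) he1
  have l3' : m ≤ c₀ * ζ := l3.trans (by gcongr)
  have l4' : m ≤ c₀ * ‖e‖ / 4 := l4.trans (by gcongr)
  have l5' : m ≤ Γ * c₀ := l5.trans (by gcongr)
  have hce : ‖c₀ • e‖ = c₀ * ‖e‖ := by rw [norm_smul, Real.norm_eq_abs, abs_of_pos hc₀0]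
  have hce0 : 0 < c₀ * ‖e‖ := by positivity
  have nz : ∀ Q : EucSp N, ‖Q - c₀ • e‖ ≤ m → Q ≠ 0 := fun Q hQ h0 => by
    rw [h0, zero_sub, norm_neg, hce] at hQ; linarith
  refine ⟨nz P hP, nz R hR, ?_⟩
  have hFd := hF x y P R e X Y j c₀ ζ μ hj he he1 hc₀ hζ hμ (hμm.trans l5') hxy (hP.trans l3')
    (hR.trans l3') (by linarith) (by linarith) hXY hX hY
  have hd0 : ‖x - y‖ ≤ ‖e‖ + 2 * ζ := by
    have := norm_sub_norm_le (x - y) e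
    linarith
  have hζ1 : ζ ≤ 1 := by linarith
  have hr1 : c₀ * ‖x - y‖ ^ 2 ≤ r₀ := by
    calc c₀ * ‖x - y‖ ^ 2 ≤ c₀ * (‖e‖ + 2 * ζ) ^ 2 := by gcongr
      _ ≤ c₀ * (2 * ‖e‖ ^ 2 + 8 * ζ ^ 2) := by
          gcongr; linear_combination sq_nonneg (‖e‖ - 2 * ζ)
      _ = 2 * (2 * n + 4) * (j * ‖e‖ ^ (2 * n + 4)) + 8 * c₀ * ζ ^ 2 := by
          rw [hc₀, powSlope]; ring
      _ ≤ 2 * (2 * n + 4) * (r₀ / (4 * (2 * n + 4))) + 8 * L * δ := by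
          gcongr
          exact (pow_le_of_le_one hζ.le hζ1 two_ne_zero).trans hζδ
      _ ≤ r₀ := by
          have : 2 * (2 * n + 4) * (r₀ / (4 * (2 * n + 4))) = r₀ / 2 := by field_simp; ring
          linarith
  have hω2 : |ω (c₀ * ‖x - y‖ ^ 2)| ≤ η / 8 ∧ K' * (c₀ * ‖x - y‖ ^ 2) ^ (1 + α) ≤ η / 8 := by
    rcases eq_or_lt_of_le (by positivity : 0 ≤ c₀ * ‖x - y‖ ^ 2) with h0 | h0
    · rw [← h0, hω0, Real.zero_rpow (by linarith)]
      simp only [abs_zero, mul_zero]; exact ⟨hη8.le, hη8.le⟩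
    · exact hr ⟨h0, hr1⟩
  have hμ8 : K * ((c₀ * ‖e‖) ^ α * μ) ≤ η / 8 := by
    have h0 := hμm.trans l6
    rw [le_div_iff₀ (by positivity)] at h0
    have h1 : K * ((c₀ * ‖e‖) ^ α * μ) ≤ K * (L ^ (1 + α) / d * μ) := by gcongr
    linarith
  have hζ8 : K * (L ^ (1 + α) * ζ) ≤ η / 8 := by
    refine le_trans ?_ hδ3
    rw [← mul_assoc]; gcongr
  set Q := c₀ • (x - y) with hQ
  have hQn : ‖Q‖ ≤ 3 * L := by
    rw [hQ, norm_smul, Real.norm_eq_abs, abs_of_pos hc₀0]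
    calc c₀ * ‖x - y‖ ≤ L * 3 := by gcongr; linarith
      _ = _ := by ring
  have near : ∀ R : EucSp N, ‖R - c₀ • e‖ ≤ m → ‖R - Q‖ ≤ δG := fun R hR => by
    have e1 : R - Q = (R - c₀ • e) - c₀ • (x - y - e) := by rw [hQ, smul_sub c₀ (x - y) e]; abel
    rw [e1]
    refine (norm_sub_le _ _).trans (le_trans ?_ hδ5)
    rw [norm_smul, Real.norm_eq_abs, abs_of_pos hc₀0]
    calc ‖R - c₀ • e‖ + c₀ * ‖x - y - e‖ ≤ c₀ * ζ + c₀ * (2 * ζ) := by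
          gcongr; linarith
      _ = 3 * c₀ * ζ := by ring
      _ ≤ 3 * L * δ := by gcongr
  have g1 := (abs_le.1 (hG x t ht P Q hQn (near P hP))).2
  have g2 := (abs_le.1 (hG y s hs R Q hQn (near R hR))).1
  have g3 := hh x y t ht s hs c₀ hc₀0
  have g4 : K' * (|t - s| ^ γ * ‖Q‖ ^ (1 + α)) ≤ η / 8 := by
    refine le_trans ?_ hδ4
    rw [mul_assoc, mul_comm (|t - s| ^ γ)]
    have : 0 < 1 + α := by linarith
    gcongr
  rw [mul_add] at hFd
  linarith [hω2.1, hω2.2]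

end SmallDifference

section JetsFarFromDiagonal

variable {E : Type*} [NormedAddCommGroup E] [InnerProductSpace ℝ E]

theorem abs_sub_le_mem_Icc {t t₀ r T₂ : ℝ} (h1 : r ≤ t₀) (h2 : r ≤ T₂ - t₀) (h : |t - t₀| ≤ r) :
    t ∈ Icc 0 T₂ := by
  rw [abs_le] at h; constructor <;> linarith

theorem abs_sub_lt_mem_Ioo {t t₀ r T₂ : ℝ} (h1 : r ≤ t₀) (h2 : r ≤ T₂ - t₀) (h : |t - t₀| < r) :
    t ∈ Ioo 0 T₂ := by
  rw [abs_lt] at h; constructor <;> linarith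

theorem norm_sub_sq_expand (x x₁ x₀ : E) :
    ‖x - x₀‖ ^ 2 = ‖x₁ - x₀‖ ^ 2 + 2 * ⟪x₁ - x₀, x - x₁⟫ + ‖x - x₁‖ ^ 2 := by
  rw [← norm_add_sq_real]; congr 2; abel

set_option maxHeartbeats 1000000 in
theorem exists_jets_of_far [FiniteDimensional ℝ E] {U V : E → ℝ → ℝ} {T₂ : ℝ} (hT₂ : 0 ≤ T₂)
    (hU : UpperSemicontinuousOn (fun p : E × ℝ => U p.1 p.2) (univ ×ˢ Icc 0 T₂))
    (hV : UpperSemicontinuousOn (fun p : E × ℝ => V p.1 p.2) (univ ×ˢ Icc 0 T₂))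
    {n : ℕ} {j k B l ε₀ ε : ℝ} {ζ : E} (hj : 0 < j) (hk : 0 < k) (hl : 0 < l) (hε₀ : 0 < ε₀)
    (hε : 0 < ε) (hub : ∀ x, ∀ t ∈ Icc 0 T₂, ∀ y, ∀ s ∈ Icc 0 T₂, U x t + V y s ≤ B)
    (hfar : ∀ p, NearMax (dbl (2 * n + 4) U V j k ζ) (dblDom E (Icc 0 T₂)) ε₀ p →
      l ≤ ‖p.1.1 - p.2.1 - ζ‖ ∧ p.1.2 ∈ Ioo 0 T₂ ∧ p.2.2 ∈ Ioo 0 T₂) :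
    ∃ (p : (E × ℝ) × (E × ℝ)) (x₁ y₁ P₁ Q₁ e b₁ b₂ : E) (t₁ s₁ a₁ a₂ c c₁ c₂ : ℝ) (X Y : E →L[ℝ] E),
      NearMax (dbl (2 * n + 4) U V j k ζ) (dblDom E (Icc 0 T₂)) ε₀ p ∧ e = p.1.1 - p.2.1 - ζ ∧
      c = powSlope n j ‖e‖ ∧ t₁ ∈ Ioo 0 T₂ ∧ s₁ ∈ Ioo 0 T₂ ∧
      ‖x₁ - p.1.1‖ < ε ∧ ‖y₁ - p.2.1‖ < ε ∧ |t₁ - p.1.2| < ε ∧ |s₁ - p.2.2| < ε ∧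
      ‖P₁ - c • e‖ < ε ∧ ‖Q₁ + c • e‖ < ε ∧ |a₁ + a₂| < ε ∧
      (∀ᶠ z : E × ℝ in nhds (x₁, t₁), U z.1 z.2 ≤ U x₁ t₁ + ⟪P₁, z.1 - x₁⟫
        + ⟪X (z.1 - x₁), z.1 - x₁⟫ / 2 + a₁ * (z.2 - t₁) + (z.2 - t₁) * ⟪b₁, z.1 - x₁⟫
        + c₁ * (z.2 - t₁) ^ 2) ∧
      (∀ᶠ z : E × ℝ in nhds (y₁, s₁), V z.1 z.2 ≤ V y₁ s₁ + ⟪Q₁, z.1 - y₁⟫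
        + ⟪Y (z.1 - y₁), z.1 - y₁⟫ / 2 + a₂ * (z.2 - s₁) + (z.2 - s₁) * ⟪b₂, z.1 - y₁⟫
        + c₂ * (z.2 - s₁) ^ 2) ∧
      (∀ a b, ⟪X a, a⟫ + ⟪Y b, b⟫ ≤
        2 * (powC n / (n + 2) * c) * ‖a - b‖ ^ 2 + ε * (‖a‖ ^ 2 + ‖b‖ ^ 2)) ∧
      (∀ a, -(4 * (powC n / (n + 2) * c)) * ‖a‖ ^ 2 ≤ ⟪X a, a⟫) ∧
      ∀ a, -(4 * (powC n / (n + 2) * c)) * ‖a‖ ^ 2 ≤ ⟪Y a, a⟫ := by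
  set D := dblDom E (Icc 0 T₂) with hD
  set Φ := dbl (2 * n + 4) U V j k ζ with hΦ
  set ε' := min ε₀ (ε / 16) with hε'
  have hε'0 : 0 < ε' := by positivity
  have hε'1 : ε' ≤ ε₀ := min_le_left _ _
  have hε'2 : ε' ≤ ε / 16 := min_le_right _ _
  have hne : D.Nonempty := ⟨((0, 0), (0, 0)), mem_dblDom.2 ⟨⟨le_rfl, hT₂⟩, ⟨le_rfl, hT₂⟩⟩⟩
  have hbdd : BddAbove (Φ '' D) := ⟨B, by
    rintro _ ⟨p, hp, rfl⟩
    obtain ⟨h1, h2⟩ := mem_dblDom.1 hp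
    have h3 := hub p.1.1 _ h1 p.2.1 _ h2
    have h4 : 0 ≤ j * ‖p.1.1 - p.2.1 - ζ‖ ^ (2 * n + 4) := by positivity
    have h5 : 0 ≤ k * (p.1.2 - p.2.2) ^ 2 := by positivity
    rw [hΦ, dbl]; linarith⟩
  obtain ⟨⟨⟨x₀, t₀⟩, ⟨y₀, s₀⟩⟩, ⟨hp₀, hmax₀⟩, -⟩ := exists_nearMax hne hbdd hε'0
  obtain ⟨ht₀, hs₀⟩ := mem_dblDom.1 hp₀
  set β := 2 * ε' with hβ
  obtain ⟨x₂, hx₂, t₂, ht₂, y₂, hy₂, s₂, hs₂, hmax⟩ := exists_max_pair isCompact_Icc hU hV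
    (Ψ := fun p => j * ‖p.1.1 - p.2.1 - ζ‖ ^ (2 * n + 4) + k * (p.1.2 - p.2.2) ^ 2
      + β * (‖p.1.1 - x₀‖ ^ 2 + ‖p.2.1 - y₀‖ ^ 2)) (by fun_prop) (x₀ := x₀) (y₀ := y₀) zero_le_one
    ht₀ hs₀
  beta_reduce at hmax
  have h0 := hmax x₀ (mem_closedBall_self zero_le_one) t₀ ht₀ y₀
    (mem_closedBall_self zero_le_one) s₀ hs₀
  have hp₂ : ((x₂, t₂), (y₂, s₂)) ∈ D := mem_dblDom.2 ⟨ht₂, hs₂⟩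
  have h1 := hmax₀ _ hp₂
  simp only [sub_self, norm_zero] at h0
  have hΦ0 : Φ ((x₀, t₀), (y₀, s₀)) = U x₀ t₀ + V y₀ s₀ - j * ‖x₀ - y₀ - ζ‖ ^ (2 * n + 4)
    - k * (t₀ - s₀) ^ 2 := rfl
  have hΦ2 : Φ ((x₂, t₂), (y₂, s₂)) = U x₂ t₂ + V y₂ s₂ - j * ‖x₂ - y₂ - ζ‖ ^ (2 * n + 4)
    - k * (t₂ - s₂) ^ 2 := rfl
  have hpen : ‖x₂ - x₀‖ ^ 2 + ‖y₂ - y₀‖ ^ 2 ≤ 1 / 2 := by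
    have : β * (‖x₂ - x₀‖ ^ 2 + ‖y₂ - y₀‖ ^ 2) ≤ ε' := by linarith
    rw [hβ] at this
    by_contra! hc
    nlinarith
  have hx34 : ‖x₂ - x₀‖ ≤ 3 / 4 := by nlinarith [norm_nonneg (x₂ - x₀), sq_nonneg ‖y₂ - y₀‖]
  have hy34 : ‖y₂ - y₀‖ ≤ 3 / 4 := by nlinarith [norm_nonneg (y₂ - y₀), sq_nonneg ‖x₂ - x₀‖]
  have hnm : NearMax Φ D ε₀ ((x₂, t₂), (y₂, s₂)) := by
    refine ⟨hp₂, fun p' hp' => ?_⟩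
    have h2 := hmax₀ p' hp'
    have h3 : 0 ≤ β * (‖x₂ - x₀‖ ^ 2 + ‖y₂ - y₀‖ ^ 2) := by positivity
    linarith
  obtain ⟨hle, ht2, hs2⟩ := hfar _ hnm
  dsimp only at hle ht2 hs2
  set e := x₂ - y₂ - ζ with he
  have hz : 0 < ‖e‖ := hl.trans_le hle
  set c := powSlope n j ‖e‖ with hc
  have hc0 : 0 < c := powSlope_pos hj hz
  set κ := powC n / (n + 2) * c with hκ
  have hκ0 : 0 < κ := by have := powC_pos n; positivity
  have hκ2 : κ / 2 = j * (powC n * ‖e‖ ^ (2 * n + 2)) := by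
    rw [hκ, hc, powSlope]; field_simp; ring
  obtain ⟨r, hr0, hr1, hr2, hr3, hr4, hr5, hr6⟩ : ∃ r > 0, r ≤ 1 / 4 ∧ r ≤ l / 6 ∧ r ≤ t₂ ∧
      r ≤ T₂ - t₂ ∧ r ≤ s₂ ∧ r ≤ T₂ - s₂ := by
    have e1 := ht2.1
    have e2 := sub_pos.2 ht2.2
    have e3 := hs2.1
    have e4 := sub_pos.2 hs2.2
    refine ⟨min (min (1 / 4) (l / 6)) (min (min t₂ (T₂ - t₂)) (min s₂ (T₂ - s₂))), by positivity,
      ?_, ?_, ?_, ?_, ?_, ?_⟩ <;> simp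
  set ε₂ := min (ε / 2) r with hε₂
  have hε₂0 : 0 < ε₂ := by positivity
  have hε₂1 : ε₂ ≤ ε / 2 := min_le_left _ _
  have hε₂2 : ε₂ ≤ r := min_le_right _ _
  have hβ1 : 2 * β ≤ ε / 4 := by rw [hβ]; linarith
  have hβ0 : 0 < β := by positivity
  obtain ⟨x₁, y₁, P₁, Q₁, b₁, b₂, t₁, s₁, a₁, a₂, c₁, c₂, X, Y, hx1, hy1, ht1, hs1, hP1, hQ1, ha, hjX,
      hjY, hXY, hX, hY⟩ :=
    exists_parabolic_jets hU hV (x₀ := x₂) (y₀ := y₂) (t₀ := t₂) (s₀ := s₂)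
      (P := c • e + (2 * β) • (x₂ - x₀)) (Q := -(c • e) + (2 * β) • (y₂ - y₀))
      (c := 2 * k * (t₂ - s₂)) (κ := κ) (k := k) (β := β) (r := r) hκ0 hk hβ0.le hr0
      (fun t ht => abs_sub_le_mem_Icc hr3 hr4 ht) (fun s hs => abs_sub_le_mem_Icc hr5 hr6 hs)
      (fun x t y s hx ht hy hs => by
        have hxb : x ∈ closedBall x₀ 1 := by
          rw [mem_closedBall, dist_eq_norm]
          have := norm_add_le (x - x₂) (x₂ - x₀)
          rw [sub_add_sub_cancel] at this; linarith
        have hyb : y ∈ closedBall y₀ 1 := by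
          rw [mem_closedBall, dist_eq_norm]
          have := norm_add_le (y - y₂) (y₂ - y₀)
          rw [sub_add_sub_cancel] at this; linarith
        have hm := hmax x hxb t (abs_sub_le_mem_Icc hr3 hr4 ht) y hyb s
          (abs_sub_le_mem_Icc hr5 hr6 hs)
        have hpow := norm_add_pow_le n (z := e) (h := (x - x₂) - (y - y₂))
          ((norm_sub_le _ _).trans (by linarith))
        have e1 : e + ((x - x₂) - (y - y₂)) = x - y - ζ := by rw [he]; abel
        rw [e1] at hpow
        have hpow' := mul_le_mul_of_nonneg_left hpow hj.le
        have e2 : c * ⟪e, (x - x₂) - (y - y₂)⟫ =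
            j * ((2 * n + 4) * ‖e‖ ^ (2 * n + 2) * ⟪e, (x - x₂) - (y - y₂)⟫) := by
          rw [hc, powSlope]; ring
        rw [inner_sub_right e] at e2
        rw [inner_sub_right e] at hpow'
        rw [hκ2]
        rw [norm_sub_sq_expand x x₂ x₀, norm_sub_sq_expand y y₂ y₀] at hm
        simp only [inner_add_left, inner_neg_left, real_inner_smul_left]
        linarith) hε₂0
  refine ⟨((x₂, t₂), (y₂, s₂)), x₁, y₁, P₁, Q₁, e, b₁, b₂, t₁, s₁, a₁, a₂, c, c₁, c₂, X, Y, hnm, rfl,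
    rfl, abs_sub_lt_mem_Ioo hr3 hr4 (ht1.trans_le hε₂2),
    abs_sub_lt_mem_Ioo hr5 hr6 (hs1.trans_le hε₂2), by dsimp only; linarith, by dsimp only; linarith,
    by dsimp only; linarith, by dsimp only; linarith, ?_, ?_, by linarith, hjX, hjY, fun a b => ?_, hX, hY⟩
  · have e1 : P₁ - c • e = (P₁ - (c • e + (2 * β) • (x₂ - x₀))) + (2 * β) • (x₂ - x₀) := by abel
    rw [e1]
    refine (norm_add_le _ _).trans_lt ?_
    rw [norm_smul, Real.norm_eq_abs, abs_of_pos (by positivity)]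
    linarith [mul_le_mul_of_nonneg_left hx34 (by positivity : 0 ≤ 2 * β)]
  · have e1 : Q₁ + c • e = (Q₁ - (-(c • e) + (2 * β) • (y₂ - y₀))) + (2 * β) • (y₂ - y₀) := by abel
    rw [e1]
    refine (norm_add_le _ _).trans_lt ?_
    rw [norm_smul, Real.norm_eq_abs, abs_of_pos (by positivity)]
    linarith [mul_le_mul_of_nonneg_left hy34 (by positivity : 0 ≤ 2 * β)]
  · refine (hXY a b).trans ?_
    gcongr
    linarith

end JetsFarFromDiagonal

section FarFromDiagonal

variable {T α : ℝ} {F : EucSp N → EucSp N → MatN N → ℝ} {h : EucSp N → ℝ → EucSp N}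

theorem IsSubSol.pen_jet {g u : EucSp N → ℝ → ℝ}
    (hu : UpperSemicontinuousOn (fun p : EucSp N × ℝ => u p.1 p.2) (univ ×ˢ Ico 0 T))
    (hs : IsSubSol univ T F h α g u) {x₀ : EucSp N} {t₀ : ℝ} (ht : t₀ ∈ Ioo 0 T)
    {η τ C : ℝ} (hC : 0 ≤ C)
    {p b : EucSp N} {X : EucSp N →L[ℝ] EucSp N} {a c : ℝ} (hp : p ≠ 0)
    (hle : ∀ᶠ z : EucSp N × ℝ in nhds (x₀, t₀),
      pen η τ C u z.1 z.2 ≤ pen η τ C u x₀ t₀ + ⟪p, z.1 - x₀⟫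
      + ⟪X (z.1 - x₀), z.1 - x₀⟫ / 2 + a * (z.2 - t₀) + (z.2 - t₀) * ⟪b, z.1 - x₀⟫
      + c * (z.2 - t₀) ^ 2) :
    a + η - F x₀ p (symMat X) - gradTerm h α x₀ t₀ p ≤ g x₀ t₀ := by
  have h0 : 0 ≤ 2 * C * max (t₀ - τ) 0 := by positivity
  have key := hs.jet hu (x₀ := x₀) ht (p := p) (b := b) (X := X) (a := a + η + 2 * C * max (t₀ - τ) 0)
    (c := c + C) hp ?_
  · linarith
  · filter_upwards [hle] with z hz
    have := timePen_le (τ := τ) hC z.2 t₀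
    simp only [pen] at hz
    linear_combination hz + this

theorem IsSuperSol.pen_jet {f v : EucSp N → ℝ → ℝ}
    (hv : LowerSemicontinuousOn (fun p : EucSp N × ℝ => v p.1 p.2) (univ ×ˢ Ico 0 T))
    (hs : IsSuperSol univ T F h α f v) {x₀ : EucSp N} {t₀ : ℝ} (ht : t₀ ∈ Ioo 0 T)
    {τ C : ℝ} (hC : 0 ≤ C)
    {p b : EucSp N} {X : EucSp N →L[ℝ] EucSp N} {a c : ℝ} (hp : p ≠ 0)
    (hle : ∀ᶠ z : EucSp N × ℝ in nhds (x₀, t₀), pen 0 τ C (fun x t => -v x t) z.1 z.2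
      ≤ pen 0 τ C (fun x t => -v x t) x₀ t₀ + ⟪p, z.1 - x₀⟫
      + ⟪X (z.1 - x₀), z.1 - x₀⟫ / 2 + a * (z.2 - t₀) + (z.2 - t₀) * ⟪b, z.1 - x₀⟫
      + c * (z.2 - t₀) ^ 2) :
    a + F x₀ (-p) (symMat (-X)) - gradTerm h α x₀ t₀ p ≤ -f x₀ t₀ := by
  have h0 : 0 ≤ 2 * C * max (t₀ - τ) 0 := by positivity
  have key := hs.jet hv (x₀ := x₀) ht (p := p) (b := b) (X := X) (a := a + 2 * C * max (t₀ - τ) 0)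
    (c := c + C) hp ?_
  · linarith
  · filter_upwards [hle] with z hz
    have := timePen_le (τ := τ) hC z.2 t₀
    simp only [pen] at hz
    linear_combination hz + this

set_option maxHeartbeats 400000 in
/-- Near-maximisers of the doubled function cannot all stay away from the shifted diagonal. -/
theorem false_of_far {f g u v : EucSp N → ℝ → ℝ}
    (hu : UpperSemicontinuousOn (fun p : EucSp N × ℝ => u p.1 p.2) (univ ×ˢ Ico 0 T))
    (hv : LowerSemicontinuousOn (fun p : EucSp N × ℝ => v p.1 p.2) (univ ×ˢ Ico 0 T))
    (hsu : IsSubSol univ T F h α g u) (hsv : IsSuperSol univ T F h α f v)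
    {η τ C T₂ B : ℝ} (hη : 0 < η) (hC : 0 ≤ C) (hT₂ : 0 ≤ T₂) (hT₂T : T₂ < T)
    (hU : UpperSemicontinuousOn (fun p : EucSp N × ℝ => pen η τ C u p.1 p.2) (univ ×ˢ Icc 0 T₂))
    (hV : UpperSemicontinuousOn (fun p : EucSp N × ℝ => pen 0 τ C (fun x t => -v x t) p.1 p.2)
      (univ ×ˢ Icc 0 T₂))
    (hub : ∀ x, ∀ t ∈ Icc 0 T₂, ∀ y, ∀ s ∈ Icc 0 T₂,
      pen η τ C u x t + pen 0 τ C (fun x t => -v x t) y s ≤ B)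
    {n : ℕ} {j k ν δ ζ₀ l m r ε₀ : ℝ} {ζ : EucSp N} (hj : 0 < j) (hk : 0 < k) (hl : 0 < l)
    (hδ : 0 < δ) (hζ₀ : 0 < ζ₀) (hζ : ‖ζ‖ ≤ ζ₀) (hm : 0 < m) (hr : 0 < r) (hε₀ : 0 < ε₀)
    (hfar : ∀ p, NearMax (dbl (2 * n + 4) (pen η τ C u) (pen 0 τ C (fun x t => -v x t)) j k ζ)
      (dblDom (EucSp N) (Icc 0 T₂)) ε₀ p → l ≤ ‖p.1.1 - p.2.1 - ζ‖ ∧ ‖p.1.1 - p.2.1 - ζ‖ ≤ 1 ∧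
        j * ‖p.1.1 - p.2.1 - ζ‖ ^ (2 * n + 4) ≤ ν ∧ |p.1.2 - p.2.2| ≤ δ / 2 ∧
        |p.1.2 - p.2.2| ≤ r / 2 ∧ ‖p.1.1 - p.2.1‖ ≤ r / 2 ∧ p.1.2 ∈ Ioo 0 T₂ ∧ p.2.2 ∈ Ioo 0 T₂)
    (hrhs : ∀ (x y P R e : EucSp N) (X Y : EucSp N →L[ℝ] EucSp N) (t s c μ : ℝ),
      l ≤ ‖e‖ → ‖e‖ ≤ 1 → j * ‖e‖ ^ (2 * n + 4) ≤ ν → c = powSlope n j ‖e‖ → t ∈ Ioo 0 T →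
      s ∈ Ioo 0 T → |t - s| ≤ δ → 0 ≤ μ → μ ≤ m → ‖x - y - e‖ ≤ 2 * ζ₀ →
      ‖P - c • e‖ ≤ m → ‖R - c • e‖ ≤ m →
      (∀ b d, ⟪X b, b⟫ + ⟪Y d, d⟫ ≤
        2 * (powC n / (n + 2) * c) * ‖b - d‖ ^ 2 + μ * (‖b‖ ^ 2 + ‖d‖ ^ 2)) →
      (∀ b, -(4 * (powC n / (n + 2) * c)) * ‖b‖ ^ 2 ≤ ⟪X b, b⟫) →
      (∀ b, -(4 * (powC n / (n + 2) * c)) * ‖b‖ ^ 2 ≤ ⟪Y b, b⟫) →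
      P ≠ 0 ∧ R ≠ 0 ∧ F x P (symMat X) + gradTerm h α x t P
        - F y R (symMat (-Y)) - gradTerm h α y s R ≤ η / 4)
    (hgf : ∀ x y, ∀ t ∈ Ioo 0 T, ∀ s ∈ Ioo 0 T, ‖x - y‖ ≤ r → |t - s| ≤ r →
      g x t - f y s ≤ η / 4) : False := by
  set ε := min (min m (ζ₀ / 2)) (min (min (δ / 4) (r / 4)) (η / 8)) with hε
  have hε0 : 0 < ε := by positivity
  have e1 : ε ≤ m := (min_le_left _ _).trans (min_le_left _ _)
  have e2 : ε ≤ ζ₀ / 2 := (min_le_left _ _).trans (min_le_right _ _)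
  have e3 : ε ≤ δ / 4 := (min_le_right _ _).trans ((min_le_left _ _).trans (min_le_left _ _))
  have e4 : ε ≤ r / 4 := (min_le_right _ _).trans ((min_le_left _ _).trans (min_le_right _ _))
  have e5 : ε ≤ η / 8 := (min_le_right _ _).trans (min_le_right _ _)
  obtain ⟨p, x₁, y₁, P₁, Q₁, e, b₁, b₂, t₁, s₁, a₁, a₂, c, c₁, c₂, X, Y, hp, he, hc, ht₁, hs₁, hx, hy,
    ht, hs, hP, hQ, ha, jU, jV, hXY, hX, hY⟩ := exists_jets_of_far hT₂ hU hV hj hk hl hε₀ hε0 hub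
      (fun p hp => ⟨(hfar p hp).1, (hfar p hp).2.2.2.2.2.2⟩)
  obtain ⟨f1, f2, f3, f4, f5, f6, -, -⟩ := hfar p hp
  rw [← he] at f1 f2 f3
  have ht₁T : t₁ ∈ Ioo 0 T := ⟨ht₁.1, ht₁.2.trans hT₂T⟩
  have hs₁T : s₁ ∈ Ioo 0 T := ⟨hs₁.1, hs₁.2.trans hT₂T⟩
  have hts : |t₁ - s₁| ≤ |p.1.2 - p.2.2| + 2 * ε := by
    rw [abs_lt] at ht hs
    have := abs_le.1 (le_refl |p.1.2 - p.2.2|)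
    rw [abs_le]; constructor <;> linarith
  have hd : ‖x₁ - y₁ - (p.1.1 - p.2.1)‖ ≤ 2 * ε := by
    have : x₁ - y₁ - (p.1.1 - p.2.1) = (x₁ - p.1.1) - (y₁ - p.2.1) := by abel
    rw [this]; linarith [norm_sub_le (x₁ - p.1.1) (y₁ - p.2.1)]
  have hxy : ‖x₁ - y₁‖ ≤ r := by
    have : x₁ - y₁ = (x₁ - y₁ - (p.1.1 - p.2.1)) + (p.1.1 - p.2.1) := by abel
    rw [this]; linarith [norm_add_le (x₁ - y₁ - (p.1.1 - p.2.1)) (p.1.1 - p.2.1)]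
  have hxye : ‖x₁ - y₁ - e‖ ≤ 2 * ζ₀ := by
    have : x₁ - y₁ - e = (x₁ - y₁ - (p.1.1 - p.2.1)) + ζ := by rw [he]; abel
    rw [this]; linarith [norm_add_le (x₁ - y₁ - (p.1.1 - p.2.1)) ζ]
  have hR : ‖-Q₁ - c • e‖ ≤ m := by
    rw [show -Q₁ - c • e = -(Q₁ + c • e) by abel, norm_neg]; linarith
  obtain ⟨hP0, hR0, hle⟩ := hrhs x₁ y₁ P₁ (-Q₁) e X Y t₁ s₁ c ε f1 f2 f3 hc ht₁T hs₁T (by linarith)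
    hε0.le e1 hxye (hP.le.trans e1) hR hXY hX hY
  have k1 := hsu.pen_jet hu ht₁T hC hP0 jU
  have k2 := hsv.pen_jet hv hs₁T hC (neg_ne_zero.1 hR0) jV
  rw [gradTerm_neg] at hle
  have k3 := hgf x₁ y₁ t₁ ht₁T s₁ hs₁T hxy (by linarith)
  have := (abs_lt.1 ha).1
  linarith

end FarFromDiagonal

section Touching

variable {E : Type*} [NormedAddCommGroup E] [InnerProductSpace ℝ E]

/-- If for small shifts the near-maximisers of the doubled function can be found near the shifted
diagonal, then the supremum of the doubled function does not depend on the shift. -/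
theorem exists_flat_of_touching {U V : E → ℝ → ℝ} {I : Set ℝ} {B j k ζ₀ : ℝ} {n : ℕ}
    (hI : I.Nonempty) (hub : ∀ x, ∀ t ∈ I, ∀ y, ∀ s ∈ I, U x t + V y s ≤ B)
    (hj : 0 < j) (hk : 0 < k) (hζ₀ : 0 < ζ₀)
    (htouch : ∀ ζ : E, ‖ζ‖ < ζ₀ → ∀ l > 0, ∀ ε > 0, ∃ p,
      NearMax (dbl (2 * n + 4) U V j k ζ) (dblDom E I) ε p ∧ ‖p.1.1 - p.2.1 - ζ‖ < l) :
    ∃ S, (∀ x y, ∀ t ∈ I, ∀ s ∈ I, ‖x - y‖ < ζ₀ → U x t + V y s - k * (t - s) ^ 2 ≤ S) ∧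
      (∀ ε > 0, ∃ x y, ∃ t ∈ I, ∃ s ∈ I, ‖x - y‖ < ζ₀ / 2 ∧
        S - ε ≤ U x t + V y s - k * (t - s) ^ 2) ∧
      ∀ ε x y, ∀ t ∈ I, ∀ s ∈ I, ‖x - y‖ < ζ₀ → S - ε ≤ U x t + V y s - k * (t - s) ^ 2 →
        NearMax (dbl (2 * n + 4) U V j k (x - y)) (dblDom E I) ε ((x, t), (y, s)) := by
  set D := dblDom E I with hD
  have hDne : D.Nonempty := by
    obtain ⟨t, ht⟩ := hI
    exact ⟨((0, t), (0, t)), mem_dblDom.2 ⟨ht, ht⟩⟩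
  have hbdd : ∀ ζ : E, BddAbove (dbl (2 * n + 4) U V j k ζ '' D) := fun ζ => ⟨B, by
    rintro _ ⟨p, hp, rfl⟩
    obtain ⟨h1, h2⟩ := mem_dblDom.1 hp
    have h3 := hub p.1.1 _ h1 p.2.1 _ h2
    have h4 : 0 ≤ j * ‖p.1.1 - p.2.1 - ζ‖ ^ (2 * n + 4) := by positivity
    have h5 : 0 ≤ k * (p.1.2 - p.2.2) ^ 2 := by positivity
    rw [dbl]; linarith⟩
  set M : E → ℝ := fun ζ => sSup (dbl (2 * n + 4) U V j k ζ '' D) with hM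
  have hle : ∀ ζ, ∀ p ∈ D, dbl (2 * n + 4) U V j k ζ p ≤ M ζ := fun ζ p hp =>
    le_csSup (hbdd ζ) ⟨p, hp, rfl⟩
  have hnm : ∀ ζ ε p, NearMax (dbl (2 * n + 4) U V j k ζ) D ε p →
      M ζ ≤ dbl (2 * n + 4) U V j k ζ p + ε := fun ζ ε p hp =>
    csSup_le (hDne.image _) (by rintro _ ⟨p', hp', rfl⟩; exact hp.2 p' hp')
  have hconst := eventuallyConst_of_power_le (M := M) (K := j) (k := 2 * n + 2) (x₀ := (0 : E)) hζ₀ ?_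
  · have hconst : ∀ ζ : E, ‖ζ‖ < ζ₀ → M ζ = M 0 := fun ζ hζ => hconst ζ (by simpa using hζ)
    have hval : ∀ x y t s, dbl (2 * n + 4) U V j k (x - y) ((x, t), (y, s))
        = U x t + V y s - k * (t - s) ^ 2 := fun x y t s => by simp [dbl]
    refine ⟨M 0, fun x y t ht s hs hxy => ?_, fun ε hε => ?_, fun ε x y t ht s hs hxy hge => ?_⟩
    · rw [← hval, ← hconst _ hxy]
      exact hle _ _ (mem_dblDom.2 ⟨ht, hs⟩)
    · obtain ⟨p, hp, hpl⟩ := htouch 0 (by simpa using hζ₀) (ζ₀ / 2) (by positivity) ε hε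
      obtain ⟨h1, h2⟩ := mem_dblDom.1 hp.1
      refine ⟨p.1.1, p.2.1, p.1.2, h1, p.2.2, h2, by simpa using hpl, ?_⟩
      have h3 := hnm _ _ _ hp
      have h4 : 0 ≤ j * ‖p.1.1 - p.2.1 - 0‖ ^ (2 * n + 4) := by positivity
      rw [dbl] at h3; linarith
    · refine ⟨mem_dblDom.2 ⟨ht, hs⟩, fun p' hp' => ?_⟩
      have h3 := hle (x - y) p' hp'
      rw [hconst _ hxy] at h3
      rw [hval]; linarith
  · intro y hy z hz
    refine le_of_forall_pos_le_add fun ε hε => ?_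
    have hc : Continuous fun w : E => j * ‖w + (y - z)‖ ^ (2 * n + 4) := by fun_prop
    obtain ⟨l, hl, hlb⟩ := Metric.continuousAt_iff.1 (hc.continuousAt (x := 0)) (ε / 2)
      (by positivity)
    obtain ⟨p, hp, hpl⟩ := htouch y (by simpa using hy) l hl (ε / 2) (by positivity)
    have h1 := hnm _ _ _ hp
    have h2 := hle z p hp.1
    have h3 := hlb (x := p.1.1 - p.2.1 - y) (by simpa using hpl)
    rw [Real.dist_eq, zero_add, show p.1.1 - p.2.1 - y + (y - z) = p.1.1 - p.2.1 - z by abel] at h3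
    have h3 := (abs_lt.1 h3).2
    have h4 : 0 ≤ j * ‖p.1.1 - p.2.1 - y‖ ^ (2 * n + 4) := by positivity
    simp only [dbl] at h1 h2
    rw [show 2 * n + 2 + 2 = 2 * n + 4 by ring]
    linarith

end Touching

section Comparison

theorem NearMax.mono {β : Type*} {Ψ : β → ℝ} {D : Set β} {ε ε' : ℝ} {p : β} (h : NearMax Ψ D ε p)
    (hε : ε ≤ ε') : NearMax Ψ D ε' p :=
  ⟨h.1, fun p' hp' => (h.2 p' hp').trans (by linarith)⟩

theorem ParSub.barrier_Icc {T α Λ : ℝ} {g w : EucSp N → ℝ → ℝ} (hs : ParSub T α Λ g w)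
    (hΛ : 0 ≤ Λ) {n : ℕ} (hn : 2 ≤ (2 * n + 3) * (1 + α))
    (hg : ∀ x, ∀ t ∈ Ioo 0 T, ContinuousAt (fun p : EucSp N × ℝ => g p.1 p.2) (x, t)) {Mg B c γ : ℝ}
    (hgM : ∀ x, ∀ t ∈ Ioo 0 T, g x t ≤ Mg) (hB : ∀ x, ∀ t ∈ Ico 0 T, w x t ≤ B)
    (h0B : ∀ x, -B ≤ w x 0) (hγ : 0 < γ) (hol : ∀ x y, w x 0 ≤ w y 0 + c * ‖x - y‖ ^ γ)
    {T₂ : ℝ} (hT₂ : T₂ < T) {ε : ℝ} (hε : 0 < ε) :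
    ∃ L, 0 ≤ L ∧ ∀ x, ∀ t ∈ Icc 0 T₂, w x t ≤ w x 0 + ε + L * t := by
  obtain ⟨L, hL, h⟩ := hs.barrier hΛ hn hg hgM hB h0B hγ hol hε
  refine ⟨L, hL, fun x t ht => ?_⟩
  rcases ht.1.eq_or_lt with rfl | h0
  · linarith
  · exact h x t ⟨h0, ht.2.trans_lt hT₂⟩

theorem UniformContinuousOn.exists_dist_le {T : ℝ} {g : EucSp N → ℝ → ℝ}
    (hg : UniformContinuousOn (fun p : EucSp N × ℝ => g p.1 p.2) (univ ×ˢ Ioo 0 T)) {ε : ℝ}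
    (hε : 0 < ε) : ∃ r > 0, ∀ x y, ∀ t ∈ Ioo 0 T, ∀ s ∈ Ioo 0 T, ‖x - y‖ ≤ r → |t - s| ≤ r →
      g x t - g y s ≤ ε := by
  obtain ⟨δ, hδ, h⟩ := Metric.uniformContinuousOn_iff.1 hg ε hε
  refine ⟨δ / 2, by positivity, fun x y t ht s hs hxy hts => ?_⟩
  have := h (x, t) ⟨mem_univ _, ht⟩ (y, s) ⟨mem_univ _, hs⟩ (by
    rw [Prod.dist_eq, dist_eq_norm, Real.dist_eq]
    exact max_lt (by simp only; linarith) (by simp only; linarith))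
  exact ((le_abs_self _).trans (Real.dist_eq _ _).ge).trans this.le

theorem UniformContinuousOn.continuousAt_strip {T : ℝ} {g : EucSp N → ℝ → ℝ}
    (hg : UniformContinuousOn (fun p : EucSp N × ℝ => g p.1 p.2) (univ ×ˢ Ioo 0 T)) (x : EucSp N)
    {t : ℝ} (ht : t ∈ Ioo 0 T) : ContinuousAt (fun p : EucSp N × ℝ => g p.1 p.2) (x, t) :=
  hg.continuousOn.continuousAt ((isOpen_univ.prod isOpen_Ioo).mem_nhds ⟨mem_univ _, ht⟩)

end Comparison

/-- Comparison principle on `ℝ^N × (0,T)` (Theorem 3 of the paper). -/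
theorem comparison_principle_RN
    (N : ℕ) (hN : 1 ≤ N) (α : ℝ) (hα : -1 < α)
    (T : ℝ) (hT : 0 < T)
    (F : EucSp N → EucSp N → MatN N → ℝ) (a A : ℝ)
    (hFc : Fcont (Set.univ : Set (EucSp N)) F)
    (hF1 : H1 (Set.univ : Set (EucSp N)) F α)
    (hF2 : H2 (Set.univ : Set (EucSp N)) F α a A)
    (hF3 : H3 (Set.univ : Set (EucSp N)) F) (hF6 : H6 F α)
    (h : EucSp N → ℝ → EucSp N) (hh : HContBdd (Set.univ : Set (EucSp N)) T h)
    (hh5 : H5 (Set.univ : Set (EucSp N)) T h α)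
    (f g : EucSp N → ℝ → ℝ)
    (hfu : UniformContinuousOn (fun p : EucSp N × ℝ => f p.1 p.2)
      (Set.univ ×ˢ Set.Ioo 0 T))
    (hgu : UniformContinuousOn (fun p : EucSp N × ℝ => g p.1 p.2)
      (Set.univ ×ˢ Set.Ioo 0 T))
    (Mf : ℝ) (hfb : ∀ x : EucSp N, ∀ t ∈ Set.Ioo (0 : ℝ) T, |f x t| ≤ Mf)
    (hgb : ∀ x : EucSp N, ∀ t ∈ Set.Ioo (0 : ℝ) T, |g x t| ≤ Mf)
    (hgf : ∀ x : EucSp N, ∀ t ∈ Set.Ioo (0 : ℝ) T, g x t ≤ f x t)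
    (u v : EucSp N → ℝ → ℝ)
    (huusc : UpperSemicontinuousOn (fun p : EucSp N × ℝ => u p.1 p.2)
      (Set.univ ×ˢ Set.Ico 0 T))
    (hvlsc : LowerSemicontinuousOn (fun p : EucSp N × ℝ => v p.1 p.2)
      (Set.univ ×ˢ Set.Ico 0 T))
    (hu : IsSubSol (Set.univ : Set (EucSp N)) T F h α g u)
    (hv : IsSuperSol (Set.univ : Set (EucSp N)) T F h α f v)
    (hinit : ∀ x : EucSp N, u x 0 ≤ v x 0)
    (γ₀ : ℝ) (hγ₀ : γ₀ ∈ Set.Ioc (0 : ℝ) 1) (c₀ M₀ : ℝ)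
    (hu0H : ∀ x y : EucSp N, |u x 0 - u y 0| ≤ c₀ * ‖x - y‖ ^ γ₀)
    (hv0H : ∀ x y : EucSp N, |v x 0 - v y 0| ≤ c₀ * ‖x - y‖ ^ γ₀)
    (hu0b : ∀ x : EucSp N, |u x 0| ≤ M₀) (hv0b : ∀ x : EucSp N, |v x 0| ≤ M₀)
    (c₁ : ℝ)
    (hugrow : ∀ x y : EucSp N, ∀ t ∈ Set.Ioo (0 : ℝ) T,
      u x t ≤ u y 0 + c₁ * (‖x - y‖ + 1))
    (hvgrow : ∀ x y : EucSp N, ∀ t ∈ Set.Ioo (0 : ℝ) T,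
      v y 0 - c₁ * (‖x - y‖ + 1) ≤ v x t) :
    ∀ x : EucSp N, ∀ t ∈ Set.Ioo (0 : ℝ) T, u x t ≤ v x t := by
  intro xb tb htb
  by_contra! hcon
  obtain ⟨H, hH⟩ := hh.2
  have hH : ∀ x, ∀ t ∈ Ioo 0 T, ‖h x t‖ ≤ max H 0 := fun x t ht =>
    (hH x (mem_univ _) t ht).trans (le_max_left _ _)
  have hH0 : 0 ≤ max H 0 := le_max_right _ _
  set σ := (u xb tb - v xb tb) / 5 with hσd
  have hσ : 0 < σ := by simp only [hσd]; linarith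
  set η := σ / T with hηd
  have hη : 0 < η := by positivity
  have hηT : η * T = σ := by rw [hηd]; field_simp
  set B := M₀ + |c₁| with hBd
  have hM₀ : 0 ≤ M₀ := (abs_nonneg _).trans (hu0b 0)
  have hB0 : 0 ≤ B := by positivity
  have huB : ∀ x, ∀ t ∈ Ico 0 T, u x t ≤ B := fun x t ht => by
    rcases ht.1.eq_or_lt with rfl | h0
    · linarith [(abs_le.1 (hu0b x)).2, abs_nonneg c₁]
    · have := hugrow x x t ⟨h0, ht.2⟩
      rw [sub_self, norm_zero, zero_add, mul_one] at this
      linarith [(abs_le.1 (hu0b x)).2, le_abs_self c₁]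
  have hvB : ∀ x, ∀ t ∈ Ico 0 T, -v x t ≤ B := fun x t ht => by
    rcases ht.1.eq_or_lt with rfl | h0
    · linarith [(abs_le.1 (hv0b x)).1, abs_nonneg c₁]
    · have := hvgrow x x t ⟨h0, ht.2⟩
      rw [sub_self, norm_zero, zero_add, mul_one] at this
      linarith [(abs_le.1 (hv0b x)).1, le_abs_self c₁]
  set T₂ := (tb + T) / 2 with hT₂d
  have hT₂T : T₂ < T := by simp only [hT₂d]; linarith [htb.2]
  have htbT₂ : tb < T₂ := by simp only [hT₂d]; linarith [htb.2]
  have hT₂ : 0 < T₂ := htb.1.trans htbT₂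
  have hIco : ∀ t ∈ Icc 0 T₂, t ∈ Ico 0 T := fun t ht => ⟨ht.1, ht.2.trans_lt hT₂T⟩
  have hIoo : ∀ t ∈ Ioo 0 T₂, t ∈ Ioo 0 T := fun t ht => ⟨ht.1, ht.2.trans hT₂T⟩
  set C := 2 * B / (T₂ - tb) ^ 2 with hCd
  have hgap : 0 < T₂ - tb := by linarith
  have hC : 0 ≤ C := by positivity
  have hCB : 2 * B ≤ C * (T₂ - tb) ^ 2 := by rw [hCd]; field_simp; exact le_rfl
  obtain ⟨n, hn⟩ : ∃ n : ℕ, 2 ≤ (2 * n + 3) * (1 + α) := by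
    obtain ⟨n, hn⟩ := exists_nat_gt (2 / (1 + α))
    rw [div_lt_iff₀ (by linarith)] at hn
    refine ⟨n, ?_⟩
    have : (0 : ℝ) ≤ n := n.cast_nonneg
    nlinarith
  have hA : 0 ≤ A := hF2.1.le.trans hF2.2.1
  have hΛ : 0 ≤ A * N + max H 0 := by positivity
  have hpu := hu.parSub hF1 hF2 hH0 hH huusc
  have hpv := hv.parSub hF1 hF2 hH0 hH hvlsc
  have hgc := fun x t (ht : t ∈ Ioo 0 T) => hgu.continuousAt_strip x ht
  have hfc := fun x t (ht : t ∈ Ioo 0 T) => (hfu.continuousAt_strip x ht).neg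
  have hu0 : ∀ x y, u x 0 ≤ u y 0 + c₀ * ‖x - y‖ ^ γ₀ := fun x y => by
    linarith [(abs_le.1 (hu0H x y)).2]
  have hv0 : ∀ x y, -v x 0 ≤ -v y 0 + c₀ * ‖x - y‖ ^ γ₀ := fun x y => by
    linarith [(abs_le.1 (hv0H x y)).1]
  obtain ⟨r, hr, hinside⟩ := pen_interior (w₁ := u) (w₂ := fun x t => -v x t) hη.le hC
    (fun x t ht => huB x t (hIco t ht)) (fun x t ht => hvB x t (hIco t ht)) htbT₂ hCB
    (fun ε hε => hpu.barrier_Icc hΛ hn hgc (fun x t ht => (abs_le.1 (hgb x t ht)).2) huB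
      (fun x => by linarith [(abs_le.1 (hu0b x)).1, abs_nonneg c₁]) hγ₀.1 hu0 hT₂T hε)
    (fun ε hε => hpv.barrier_Icc hΛ hn hfc (Mg := Mf)
      (fun x t ht => by linarith [(abs_le.1 (hfb x t ht)).1]) hvB
      (fun x => by linarith [(abs_le.1 (hv0b x)).2, abs_nonneg c₁]) hγ₀.1 hv0 hT₂T hε)
    (fun x => by linarith [hinit x]) hγ₀.1 hu0 hσ
  obtain ⟨rg, hrg, hgr⟩ := UniformContinuousOn.exists_dist_le hgu (by positivity : 0 < η / 4)
  have hgf4 : ∀ x y, ∀ t ∈ Ioo 0 T, ∀ s ∈ Ioo 0 T, ‖x - y‖ ≤ rg → |t - s| ≤ rg →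
      g x t - f y s ≤ η / 4 := fun x y t ht s hs h1 h2 => by
    linarith [hgr x y t ht s hs h1 h2, hgf y s hs]
  set U := pen η tb C u with hUd
  set V := pen 0 tb C (fun x t => -v x t) with hVd
  have hub : ∀ x, ∀ t ∈ Icc 0 T₂, ∀ y, ∀ s ∈ Icc 0 T₂, U x t + V y s ≤ 2 * B :=
    fun x t ht y s hs => by
      linarith [pen_le (τ := tb) hη.le hC ht.1 u x,
        pen_le (τ := tb) le_rfl hC hs.1 (fun x t => -v x t) y, huB x t (hIco t ht),
        hvB y s (hIco s hs)]
  have hbase : ∃ x, ∃ t ∈ Icc 0 T₂, 4 * σ ≤ U x t + V x t := by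
    refine ⟨xb, tb, ⟨htb.1.le, htbT₂.le⟩, ?_⟩
    have h1 : η * tb ≤ σ := by rw [← hηT]; exact mul_le_mul_of_nonneg_left htb.2.le hη.le
    have h2 : u xb tb - v xb tb = 5 * σ := by rw [hσd]; ring
    simp only [hUd, hVd, pen, timePen_of_le le_rfl]
    linarith
  have hU : UpperSemicontinuousOn (fun p : EucSp N × ℝ => U p.1 p.2) (univ ×ˢ Icc 0 T₂) :=
    pen_usc (huusc.mono (prod_mono_right hIco))
  have hV : UpperSemicontinuousOn (fun p : EucSp N × ℝ => V p.1 p.2) (univ ×ˢ Icc 0 T₂) :=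
    pen_usc (hpv.usc.mono (prod_mono_right hIco))
  have hΓ : 0 < powC n / (n + 2) := div_pos (powC_pos n) (by positivity)
  obtain ⟨ν, hν, hrhs⟩ := exists_right_side_sub_le hα hF1 hF2 hF3 hF6 hh5 hH hn hΓ
    (by positivity : 0 < η / 4)
  set R := min r rg with hRd
  have hR : 0 < R := lt_min hr hrg
  have hRr : R ≤ r := min_le_left _ _
  have hRg : R ≤ rg := min_le_right _ _
  choose! δ hδ hrhs using hrhs
  set d : ℝ → ℝ := fun j => min (δ j / 2) (R / 2) with hd
  obtain ⟨j, k, ρ, ε₁, hj1, hκ, hk, hρ, hε₁, hgood⟩ := exists_good_parameters (q := 2 * n + 4)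
    (ε := min ν ((min 1 (R / 4)) ^ (2 * n + 4))) (by positivity) hub hσ hbase (by positivity)
    (fun j => 2 * B / d j ^ 2)
  have hj : 0 < j := by linarith
  have hδj := hδ j hj
  have hdj : 0 < d j := lt_min (by positivity) (by positivity)
  have hdκ : 2 * B ≤ k * d j ^ 2 := (div_le_iff₀ (by positivity)).1 hκ
  set ζ₀ := min ρ (min (δ j) (R / 4)) with hζd
  have hζ₀ : 0 < ζ₀ := by positivity
  have hζρ : ζ₀ ≤ ρ := min_le_left _ _
  have hζδ : ζ₀ ≤ δ j := (min_le_right _ _).trans (min_le_left _ _)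
  have hζR : ζ₀ ≤ R / 4 := (min_le_right _ _).trans (min_le_right _ _)
  have hctl : ∀ ζ, ‖ζ‖ < ζ₀ → ∀ p, NearMax (dbl (2 * n + 4) U V j k ζ)
      (dblDom (EucSp N) (Icc 0 T₂)) ε₁ p → ‖p.1.1 - p.2.1 - ζ‖ ≤ 1 ∧
        j * ‖p.1.1 - p.2.1 - ζ‖ ^ (2 * n + 4) ≤ ν ∧ |p.1.2 - p.2.2| ≤ δ j / 2 ∧
        |p.1.2 - p.2.2| ≤ R / 2 ∧ ‖p.1.1 - p.2.1‖ ≤ R / 2 ∧ p.1.2 ∈ Ioo 0 T₂ ∧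
        p.2.2 ∈ Ioo 0 T₂ := by
    intro ζ hζ p hp
    obtain ⟨h1, h2, h3⟩ := hgood ζ (hζ.trans_le hζρ) p hp
    have hts : |p.1.2 - p.2.2| ≤ d j := by
      refine abs_le_of_sq_le_sq (le_of_mul_le_mul_left (h3.trans hdκ) hk) hdj.le
    have he : ‖p.1.1 - p.2.1 - ζ‖ ≤ min 1 (R / 4) := by
      refine le_of_pow_le_pow_left₀ (n := 2 * n + 4) (by positivity) (by positivity) ?_
      refine le_trans ?_ (h1.trans (min_le_right _ _))
      exact le_mul_of_one_le_left (by positivity) hj1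
    have hxy : ‖p.1.1 - p.2.1‖ ≤ R / 2 := by
      have h4 := norm_add_le (p.1.1 - p.2.1 - ζ) ζ
      rw [sub_add_cancel] at h4
      linarith [he.trans (min_le_right _ _)]
    have htsR : |p.1.2 - p.2.2| ≤ R / 2 := hts.trans (min_le_right _ _)
    obtain ⟨m1, m2⟩ := mem_dblDom.1 hp.1
    exact ⟨he.trans (min_le_left _ _), h1.trans (min_le_left _ _), hts.trans (min_le_left _ _), htsR,
      hxy, hinside _ _ _ m1 _ m2 (by linarith) (by linarith) h2⟩
  by_cases hA : ∃ ζ, ‖ζ‖ < ζ₀ ∧ ∃ l > 0, ∃ ε₀ > 0, ∀ p, NearMax (dbl (2 * n + 4) U V j k ζ)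
      (dblDom (EucSp N) (Icc 0 T₂)) ε₀ p → l ≤ ‖p.1.1 - p.2.1 - ζ‖
  · obtain ⟨ζ, hζ, l, hl, ε₀, hε₀, hfar⟩ := hA
    obtain ⟨m, hm, hrhs⟩ := hrhs j hj ζ₀ hζ₀ hζδ l hl
    exact false_of_far huusc hvlsc hu hv hη hC hT₂.le hT₂T hU hV hub hj hk hl hδj hζ₀ hζ.le hm hR
      (lt_min hε₀ hε₁) (fun p hp => ⟨hfar p (hp.mono (min_le_left _ _)),
        hctl ζ hζ p (hp.mono (min_le_right _ _))⟩) hrhs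
      fun x y t ht s hs h1 h2 => hgf4 x y t ht s hs (h1.trans hRg) (h2.trans hRg)
  · push Not at hA
    obtain ⟨S, hflat, hnear, hmax⟩ := exists_flat_of_touching (I := Icc 0 T₂) ⟨0, le_rfl, hT₂.le⟩ hub hj hk hζ₀
      fun ζ hζ l hl ε hε => hA ζ hζ l hl ε hε
    refine hpu.not_flat hpv hΛ hα hn hgc hfc hC hη hT₂T hζ₀ hε₁ hflat hnear
      fun x y t ht s hs hxy hge => ?_
    obtain ⟨-, -, -, h1, h2, h3, h4⟩ := hctl _ hxy _ (hmax _ x y t ht s hs hxy hge)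
    refine ⟨h3, h4, ?_⟩
    have := hgf4 x y t (hIoo t h3) s (hIoo s h4) (h2.trans (by linarith)) (h1.trans (by linarith))
    linarith
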